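/- Let Γ be a finite simple graph and let A(Γ) be the right-angled Artin group it defines. Then the following are equivalent: (i) Γ is a forest (contains no cycles); (ii) there exist a finite alphabet B and a word r over B ∪ B^{-1} such that A(Γ) embeds (via an injective group homomorphism) into the one-relator group Gp⟨B | r = 1⟩; (iii) there exist a finite alphabet B and a positive word r ∈ B* such that A(Γ) embeds into the positive one-relator group Gp⟨B | r = 1⟩; (iv) there exist a finite alphabet A and words u, v ∈ A* such that there is an injective monoid homomorphism from A(Γ) into the one-relation monoid Mon⟨A | u = v⟩; (v) there exist a finite alphabet A and a word w ∈ A* such that there is an injective monoid homomorphism from A(Γ) into the special one-relation monoid Mon⟨A | w = 1⟩. -/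

import Mathlib

/-- The one-relation monoid `Mon⟨A | u = v⟩` over the alphabet `Fin k`. -/
abbrev OneRelMonoid {k : ℕ} (u v : List (Fin k)) :=
  PresentedMonoid (fun x y : FreeMonoid (Fin k) =>
    x = FreeMonoid.ofList u ∧ y = FreeMonoid.ofList v)

/-- The commutation relators of the right-angled Artin group `A(Γ)` of a simple graph:
`x y x⁻¹ y⁻¹` for every pair of adjacent vertices. -/
def raagRels {V : Type*} (Γ : SimpleGraph V) : Set (FreeGroup V) :=
  {r | ∃ x y : V, Γ.Adj x y ∧
    r = FreeGroup.of x * FreeGroup.of y * (FreeGroup.of y * FreeGroup.of x)⁻¹}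

/-- The right-angled Artin group `A(Γ)` of a simple graph `Γ`. -/
abbrev RAAG {V : Type*} (Γ : SimpleGraph V) := PresentedGroup (raagRels Γ)

namespace OneRelator

section

open Finset

/-- The formal inverse of a letter. -/
def invLetter {B : Type*} (l : B × Bool) : B × Bool := (l.1, !l.2)

lemma invLetter_invLetter {B : Type*} (l : B × Bool) : invLetter (invLetter l) = l := by
  simp [invLetter]

lemma invLetter_ne {B : Type*} (l : B × Bool) : l ≠ invLetter l := by
  rcases l with ⟨b, _ | _⟩ <;> simp [invLetter]

/-- A cyclic word is reduced. -/
def CycReduced {B : Type*} {m : ℕ} (W : ZMod m → B × Bool) : Prop :=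
  ∀ i, W (i + 1) ≠ invLetter (W i)

/-- A cyclic word is not a proper power. -/
def CycPrimitive {B : Type*} {m : ℕ} (W : ZMod m → B × Bool) : Prop :=
  ∀ j, (∀ i, W (i + j) = W i) → j = 0

/-- The letter read when leaving position `i` forwards (`true`) or backwards (`false`). -/
def outLetter {B : Type*} {m : ℕ} (W : ZMod m → B × Bool) (i : ZMod m) (ε : Bool) : B × Bool :=
  if ε then W i else invLetter (W (i - 1))

/-- The position reached when leaving position `i` forwards (`true`) or backwards (`false`). -/
def cstep {m : ℕ} (i : ZMod m) (ε : Bool) : ZMod m := if ε then i + 1 else i - 1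

section
variable {B : Type*} {m : ℕ} {W : ZMod m → B × Bool}

@[simp] lemma outLetter_true (i : ZMod m) : outLetter W i true = W i := rfl
@[simp] lemma outLetter_false (i : ZMod m) : outLetter W i false = invLetter (W (i - 1)) := rfl
@[simp] lemma cstep_true (i : ZMod m) : cstep i true = i + 1 := rfl
@[simp] lemma cstep_false (i : ZMod m) : cstep i false = i - 1 := rfl

@[simp] lemma outLetter_cstep (i : ZMod m) (ε : Bool) :
    outLetter W (cstep i ε) (!ε) = invLetter (outLetter W i ε) := by
  cases ε <;> simp [invLetter_invLetter]

@[simp] lemma cstep_cstep (i : ZMod m) (ε : Bool) : cstep (cstep i ε) (!ε) = i := by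
  cases ε <;> simp

lemma outLetter_ne (hW : CycReduced W) (i : ZMod m) : outLetter W i true ≠ outLetter W i false := by
  have := hW (i - 1)
  simpa using this

/-- An equivalence relation on positions is folded if equal letters lead to equivalent positions. -/
def Folded (W : ZMod m → B × Bool) (s : Setoid (ZMod m)) : Prop :=
  ∀ i j ε δ, s i j → outLetter W i ε = outLetter W j δ → s (cstep i ε) (cstep j δ)

/-- A potential on positions whose increments depend only on the class and the letter. -/
def IsHeight (W : ZMod m → B × Bool) (s : Setoid (ZMod m)) (h : ZMod m → ℚ) : Prop :=
  ∀ i j ε δ, s i j → outLetter W i ε = outLetter W j δ →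
    h (cstep i ε) - h i = h (cstep j δ) - h j

/-- The edge (in the folded quotient) traversed by a half-edge. -/
def foldKey (W : ZMod m → B × Bool) (s : Setoid (ZMod m)) (i : ZMod m) (ε : Bool) :
    Quotient s × B :=
  (if (outLetter W i ε).2 then Quotient.mk s i else Quotient.mk s (cstep i ε), (outLetter W i ε).1)

lemma foldKey_cstep (s : Setoid (ZMod m)) (i : ZMod m) (ε : Bool) :
    foldKey W s (cstep i ε) (!ε) = foldKey W s i ε := by
  unfold foldKey
  simp only [outLetter_cstep, cstep_cstep, invLetter]
  cases (outLetter W i ε).2 <;> simp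

lemma foldKey_congr {s : Setoid (ZMod m)} (hs : Folded W s) {i j : ZMod m} {ε δ : Bool}
    (hij : s i j) (h : outLetter W i ε = outLetter W j δ) : foldKey W s i ε = foldKey W s j δ := by
  unfold foldKey
  rw [h, Quotient.sound hij, Quotient.sound (hs i j ε δ hij h)]

lemma foldKey_inj {s : Setoid (ZMod m)} (hs : Folded W s) {i j : ZMod m} {ε δ : Bool}
    (h : foldKey W s i ε = foldKey W s j δ)
    (h2 : (outLetter W i ε).2 = (outLetter W j δ).2) : s i j ∧ outLetter W i ε = outLetter W j δ := by
  have e : outLetter W i ε = outLetter W j δ := Prod.ext (congrArg (fun z => z.2) h) h2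
  refine ⟨?_, e⟩
  have h1 := congrArg Prod.fst h
  unfold foldKey at h1
  simp only [h2] at h1
  by_cases hb : (outLetter W j δ).2 = true
  · simp only [hb, if_true] at h1; exact Quotient.exact h1
  · simp only [hb] at h1
    have := hs _ _ (!ε) (!δ) (Quotient.exact h1) (by simp [e])
    simpa using this

variable [NeZero m]

lemma zmod_all_nat {p : ZMod m → Prop} (h : ∀ n : ℕ, p n) (i : ZMod m) : p i := by
  simpa using h i.val

lemma exists_third_letter (hW : CycReduced W) (hP : CycPrimitive W) {s : Setoid (ZMod m)}
    (hs : Folded W s) {i j : ZMod m} (hij : s i j) (hne : i ≠ j) :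
    ∃ i j, s i j ∧ W j ≠ W i ∧ W j ≠ invLetter (W (i - 1)) ∨
      s i j ∧ invLetter (W (j - 1)) ≠ W i ∧ invLetter (W (j - 1)) ≠ invLetter (W (i - 1)) := by
  by_contra! hc
  have h1 : ∀ i j, s i j → W j ≠ W i → W j = invLetter (W (i - 1)) := fun i j => (hc i j).1
  have h2 : ∀ i j, s i j → invLetter (W (j - 1)) ≠ W i →
    invLetter (W (j - 1)) = invLetter (W (i - 1)) := fun i j => (hc i j).2
  by_cases hf : W j = W i
  · have key : ∀ n : ℕ, s (i + n) (j + n) ∧ W (j + n) = W (i + n) := by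
      intro n
      induction n with
      | zero => simpa using ⟨hij, hf⟩
      | succ n ih =>
        have a : s (i + n + 1) (j + n + 1) := hs (i + n) (j + n) true true ih.1 ih.2.symm
        refine ⟨by push_cast; rw [← add_assoc, ← add_assoc]; exact a, ?_⟩
        push_cast
        rw [← add_assoc, ← add_assoc]
        by_contra hne
        have := h1 _ _ a hne
        simp only [add_sub_cancel_right] at this
        rw [← ih.2] at this
        exact hW _ this
    have := hP (j - i) (fun k => by
      have := zmod_all_nat (p := fun n => W (j + n) = W (i + n)) (fun n => (key n).2) (k - i)
      rw [show k + (j - i) = j + (k - i) by ring, this]; simp)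
    exact hne (sub_eq_zero.1 this).symm
  · have hb := h1 i j hij hf
    have key : ∀ n : ℕ, s (i - n) (j + n) ∧ W (j + n) = invLetter (W (i - n - 1)) := by
      intro n
      induction n with
      | zero => simpa using ⟨hij, hb⟩
      | succ n ih =>
        have a : s (i - n - 1) (j + n + 1) := hs (i - n) (j + n) false true ih.1 ih.2.symm
        have e1 : i - ((n + 1 : ℕ) : ZMod m) = i - n - 1 := by push_cast; ring
        have e2 : j + ((n + 1 : ℕ) : ZMod m) = j + n + 1 := by push_cast; ring
        rw [e1, e2]
        refine ⟨a, ?_⟩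
        refine h1 _ _ a fun h => ?_
        refine hW (j + n) ?_
        rw [h, ih.2, invLetter_invLetter]
    have all : ∀ k, W k = invLetter (W (i + j - 1 - k)) := fun k => by
      have := zmod_all_nat (p := fun n => W (j + n) = invLetter (W (i - n - 1)))
        (fun n => (key n).2) (k - j)
      rw [show j + (k - j) = k by ring] at this
      rw [this]; congr 2; ring
    set c := i + j - 1
    rcases Nat.even_or_odd' c.val with ⟨q, hq | hq⟩
    · have hc : c = q + q := by
        rw [← ZMod.natCast_zmod_val c, hq]; push_cast; ring
      have := all q
      rw [hc] at this
      simp only [add_sub_cancel_right] at this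
      exact invLetter_ne _ this
    · have hc : c = q + q + 1 := by
        rw [← ZMod.natCast_zmod_val c, hq]; push_cast; ring
      have := all (q + 1)
      rw [hc, show (q + q + 1 - (q + 1) : ZMod m) = q by ring] at this
      exact hW _ this

open Classical in
lemma card_quotient_lt (hW : CycReduced W) (hP : CycPrimitive W) {s : Setoid (ZMod m)}
    (hs : Folded W s) {i j : ZMod m} (hij : s i j) (hne : i ≠ j) :
    Fintype.card (Quotient s) < (univ.image fun i => foldKey W s i true).card := by
  obtain ⟨i₀, j₀, h₀⟩ := exists_third_letter hW hP hs hij hne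
  set E := univ.image fun i => foldKey W s i true
  set H : Finset (Quotient s × (B × Bool)) :=
    univ.image fun p : ZMod m × Bool => (Quotient.mk s p.1, outLetter W p.1 p.2)
  have hE : ∀ i ε, foldKey W s i ε ∈ E := by
    intro i ε
    cases ε
    · rw [← foldKey_cstep]
      exact mem_image_of_mem _ (mem_univ _)
    · exact mem_image_of_mem _ (mem_univ _)
  have hH : ∀ i ε, (Quotient.mk s i, outLetter W i ε) ∈ H := fun i ε =>
    mem_image_of_mem (fun p : ZMod m × Bool => (Quotient.mk s p.1, outLetter W p.1 p.2))
      (mem_univ (i, ε))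
  have h1 : H.card ≤ (E ×ˢ (univ : Finset Bool)).card := by
    refine card_le_card_of_surjOn (fun x : (Quotient s × B) × Bool =>
      if h : ∃ p : ZMod m × Bool, foldKey W s p.1 p.2 = x.1 ∧ (outLetter W p.1 p.2).2 = x.2 then
        (Quotient.mk s h.choose.1, outLetter W h.choose.1 h.choose.2)
      else (Quotient.mk s 0, outLetter W 0 true)) ?_
    rintro x hx
    simp only [H, coe_image, coe_univ, Set.image_univ, Set.mem_range] at hx
    obtain ⟨p, rfl⟩ := hx
    refine ⟨(foldKey W s p.1 p.2, (outLetter W p.1 p.2).2), by simp [hE], ?_⟩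
    have hex : ∃ q : ZMod m × Bool, foldKey W s q.1 q.2 = foldKey W s p.1 p.2 ∧
      (outLetter W q.1 q.2).2 = (outLetter W p.1 p.2).2 := ⟨p, rfl, rfl⟩
    simp only
    rw [dif_pos hex]
    have := foldKey_inj hs hex.choose_spec.1 hex.choose_spec.2
    rw [Quotient.sound this.1, this.2]
  have h2 : ∀ c : Quotient s, 2 ≤ (H.filter fun x => x.1 = c).card := by
    intro c
    induction c using Quotient.inductionOn with | _ i
    refine le_trans (le_of_eq (card_pair (a := (Quotient.mk s i, outLetter W i true))
      (b := (Quotient.mk s i, outLetter W i false)) ?_).symm) (card_le_card ?_)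
    · intro h; exact outLetter_ne hW i (congrArg Prod.snd h)
    · intro x hx
      simp only [mem_insert, mem_singleton] at hx
      rcases hx with rfl | rfl <;> simp only [mem_filter, hH, and_self]
  have h3 : ∃ c : Quotient s, 2 < (H.filter fun x => x.1 = c).card := by
    refine ⟨Quotient.mk s i₀, ?_⟩
    rw [two_lt_card]
    have a1 : (Quotient.mk s i₀, outLetter W i₀ true) ∈ H.filter fun x => x.1 = Quotient.mk s i₀ := by
      simp only [mem_filter, hH, and_self]
    have a2 : (Quotient.mk s i₀, outLetter W i₀ false) ∈ H.filter fun x => x.1 = Quotient.mk s i₀ := by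
      simp only [mem_filter, hH, and_self]
    have a3 : ∀ ε, s i₀ j₀ → (Quotient.mk s i₀, outLetter W j₀ ε) ∈
        H.filter fun x => x.1 = Quotient.mk s i₀ := by
      intro ε h
      have := hH j₀ ε
      rw [← Quotient.sound h] at this
      simp only [mem_filter, this, and_self]
    have b12 : (Quotient.mk s i₀, outLetter W i₀ true) ≠ (Quotient.mk s i₀, outLetter W i₀ false) :=
      fun h => outLetter_ne hW i₀ (congrArg Prod.snd h)
    rcases h₀ with ⟨h, n1, n2⟩ | ⟨h, n1, n2⟩
    · exact ⟨_, a1, _, a2, _, a3 true h, b12, fun h => n1 (congrArg Prod.snd h).symm,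
        fun h => n2 (congrArg Prod.snd h).symm⟩
    · exact ⟨_, a1, _, a2, _, a3 false h, b12, fun h => n1 (congrArg Prod.snd h).symm,
        fun h => n2 (congrArg Prod.snd h).symm⟩
  have h4 : H.card = ∑ c : Quotient s, (H.filter fun x => x.1 = c).card :=
    card_eq_sum_card_fiberwise (by intro x _; simp)
  have h5 : ∑ c : Quotient s, 2 < H.card := by
    rw [h4]
    obtain ⟨c, hc⟩ := h3
    exact sum_lt_sum (fun c _ => h2 c) ⟨c, mem_univ _, hc⟩
  simp only [sum_const, card_univ, smul_eq_mul, card_product, Fintype.card_bool] at h5 h1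
  omega

open Classical in
lemma exists_height (hW : CycReduced W) (hP : CycPrimitive W) {s : Setoid (ZMod m)}
    (hs : Folded W s) {i j : ZMod m} (hij : s i j) (hne : i ≠ j) :
    ∃ h : ZMod m → ℚ, IsHeight W s h ∧ ∃ i j, s i j ∧ h i ≠ h j := by
  have hcard := card_quotient_lt hW hP hs hij hne
  set E := univ.image fun i => foldKey W s i true with hEdef
  let sg : Bool → ℚ := fun b => if b then 1 else -1
  let key : ZMod m → E := fun i => ⟨foldKey W s i true, mem_image_of_mem _ (mem_univ _)⟩
  let dl : ZMod m → (E → ℚ) →ₗ[ℚ] ℚ := fun i => sg (W i).2 • LinearMap.proj (key i)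
  let hl : ZMod m → (E → ℚ) →ₗ[ℚ] ℚ := fun i => ∑ n ∈ range i.val, dl n
  let tot : (E → ℚ) →ₗ[ℚ] ℚ := ∑ n ∈ range m, dl n
  let Φ : (E → ℚ) →ₗ[ℚ] (Quotient s → ℚ) := LinearMap.pi fun c =>
    if c = Quotient.mk s 0 then tot else hl c.out
  have hker : LinearMap.ker Φ ≠ ⊥ := by
    apply LinearMap.ker_ne_bot_of_finrank_lt
    simpa using hcard
  obtain ⟨α, hα, hα0⟩ := (Submodule.ne_bot_iff _).1 hker
  have hΦ : ∀ c, Φ α c = 0 := fun c => by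
    rw [LinearMap.mem_ker.1 hα]; rfl
  have htot : tot α = 0 := by simpa [Φ] using hΦ (Quotient.mk s 0)
  have hout : ∀ c : Quotient s, c ≠ Quotient.mk s 0 → hl c.out α = 0 := fun c hc => by
    simpa [Φ, hc] using hΦ c
  have hinc : ∀ i, hl (i + 1) α - hl i α = dl i α := by
    intro i
    have hv : i.val < m := ZMod.val_lt i
    have hcast : ((i.val : ℕ) : ZMod m) = i := ZMod.natCast_zmod_val i
    have e : hl i α + dl i α = ∑ n ∈ range (i.val + 1), dl n α := by
      rw [sum_range_succ, hcast]; simp [hl]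
    rcases Nat.lt_or_ge (i.val + 1) m with h | h
    · have : (i + 1).val = i.val + 1 := by
        rw [← hcast]
        have : ((i.val : ℕ) : ZMod m) + 1 = ((i.val + 1 : ℕ) : ZMod m) := by push_cast; rfl
        rw [this, ZMod.val_natCast_of_lt h, hcast]
      have e2 : hl (i + 1) α = ∑ n ∈ range (i.val + 1), dl n α := by simp [hl, this]
      linarith
    · have hm : i.val + 1 = m := by omega
      have : i + 1 = 0 := by
        rw [← hcast]
        have : ((i.val : ℕ) : ZMod m) + 1 = ((i.val + 1 : ℕ) : ZMod m) := by push_cast; rfl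
        rw [this, hm]; simp
      have e2 : hl (i + 1) α = 0 := by simp [hl, this]
      rw [hm] at e
      have : tot α = ∑ n ∈ range m, dl n α := by simp [tot]
      linarith
  have hzero : hl 0 α = 0 := by simp [hl]
  let keyE : ZMod m → Bool → ℚ := fun i ε =>
    if h : foldKey W s i ε ∈ E then α ⟨_, h⟩ else 0
  have hstep : ∀ i ε, hl (cstep i ε) α - hl i α = sg (outLetter W i ε).2 * keyE i ε := by
    have h1 : ∀ i, hl (i + 1) α - hl i α = sg (W i).2 * keyE i true := by
      intro i
      rw [hinc]
      simp only [dl, keyE, LinearMap.smul_apply, LinearMap.proj_apply, smul_eq_mul]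
      rw [dif_pos (mem_image_of_mem _ (mem_univ _))]
    intro i ε
    cases ε
    · have := h1 (i - 1)
      have e := foldKey_cstep (W := W) s i false
      simp only [sub_add_cancel] at this
      simp only [cstep_false, outLetter_false, invLetter, keyE, Bool.not_false] at e this ⊢
      rw [e] at this
      have hsg : sg (!(W (i - 1)).2) = - sg (W (i - 1)).2 := by
        cases (W (i - 1)).2 <;> simp [sg]
      rw [hsg]
      linarith
    · exact h1 i
  refine ⟨fun i => hl i α, ?_, ?_⟩
  · intro i j ε δ hij h
    simp only
    rw [hstep, hstep, h]
    simp only [keyE]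
    rw [foldKey_congr hs hij h]
  · by_contra! hc
    have hall : ∀ i, hl i α = 0 := by
      intro i
      by_cases h : Quotient.mk s i = Quotient.mk s 0
      · rw [hc i 0 (Quotient.exact h), hzero]
      · rw [hc i (Quotient.mk s i).out (Quotient.exact (Quotient.out_eq _).symm)]
        exact hout _ h
    apply hα0
    ext ⟨e, he⟩
    obtain ⟨i, -, rfl⟩ := mem_image.1 he
    have := hinc i
    rw [hall, hall] at this
    simp only [dl, LinearMap.smul_apply, LinearMap.proj_apply, smul_eq_mul, sub_zero] at this
    have hsg : sg (W i).2 ≠ 0 := by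
      simp only [sg]; split_ifs <;> norm_num
    simpa [hsg, key] using this.symm

/-- A labelling of positions by a linear order in which equal letters preserve the order. -/
lemma exists_stacking_aux (hW : CycReduced W) (hP : CycPrimitive W) (N : ℕ) :
    ∀ s : Setoid (ZMod m), Folded W s →
      (Set.ncard {p : ZMod m × ZMod m | s p.1 p.2}) ≤ N →
    ∃ (α : Type) (_ : LinearOrder α) (ρ : ZMod m → α),
      (∀ i j, s i j → ρ i = ρ j → i = j) ∧
      ∀ i j ε δ, s i j → outLetter W i ε = outLetter W j δ → ρ i < ρ j →
        ρ (cstep i ε) < ρ (cstep j δ) := by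
  induction N with
  | zero =>
    intro s _ hN
    exfalso
    have := (Set.ncard_eq_zero (Set.toFinite _)).1 (Nat.le_zero.1 hN)
    have h0 : ((0 : ZMod m), (0 : ZMod m)) ∈ {p : ZMod m × ZMod m | s p.1 p.2} := s.refl 0
    rw [this] at h0
    exact h0
  | succ N ih =>
    intro s hs hN
    by_cases htriv : ∀ i j, s i j → i = j
    · exact ⟨Unit, inferInstance, fun _ => (), fun i j h _ => htriv i j h,
        fun i j ε δ _ _ h => absurd h (lt_irrefl _)⟩
    · push Not at htriv
      obtain ⟨i, j, hij, hne⟩ := htriv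
      obtain ⟨h, hh, i', j', hij', hne'⟩ := exists_height hW hP hs hij hne
      let s' : Setoid (ZMod m) := s ⊓ Setoid.ker h
      have hs' : Folded W s' := by
        intro a b ε δ hab e
        refine ⟨hs a b ε δ hab.1 e, ?_⟩
        have h1 := hh a b ε δ hab.1 e
        have h2 : h a = h b := hab.2
        change h _ = h _
        linarith
      have hlt : Set.ncard {p : ZMod m × ZMod m | s' p.1 p.2} <
          Set.ncard {p : ZMod m × ZMod m | s p.1 p.2} := by
        apply Set.ncard_lt_ncard _ (Set.toFinite _)
        refine ⟨fun p hp => hp.1, fun hsub => ?_⟩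
        have : ((i', j') : ZMod m × ZMod m) ∈ {p : ZMod m × ZMod m | s p.1 p.2} := hij'
        exact hne' (hsub this).2
      obtain ⟨α, _, ρ, h1, h2⟩ := ih s' hs' (by omega)
      refine ⟨ℚ ×ₗ α, inferInstance, fun a => toLex (h a, ρ a), ?_, ?_⟩
      · intro a b hab e
        have e' := toLex.injective e
        exact h1 a b ⟨hab, congrArg Prod.fst e'⟩ (congrArg Prod.snd e')
      · intro a b ε δ hab e hlt
        rw [Prod.Lex.toLex_lt_toLex] at hlt ⊢
        have h3 := hh a b ε δ hab e
        simp only at hlt ⊢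
        rcases hlt with hlt | ⟨heq, hlt⟩
        · left; linarith
        · right; exact ⟨by linarith, h2 a b ε δ ⟨hab, heq⟩ e hlt⟩

theorem exists_stacking (hW : CycReduced W) (hP : CycPrimitive W) :
    ∃ (α : Type) (_ : LinearOrder α) (ρ : ZMod m → α), Function.Injective ρ ∧
      ∀ i j ε δ, outLetter W i ε = outLetter W j δ → ρ i < ρ j →
        ρ (cstep i ε) < ρ (cstep j δ) := by
  obtain ⟨α, o, ρ, h1, h2⟩ := exists_stacking_aux hW hP _ ⊤ (fun _ _ _ _ _ _ => trivial) le_rfl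
  exact ⟨α, o, ρ, fun i j h => h1 i j trivial h, fun i j ε δ => h2 i j ε δ trivial⟩

end

section
variable {B X α : Type*} [LinearOrder α] {m : ℕ}

/-- The half-edge leaving `p` in direction `ε` is the highest among parallel half-edges. -/
def HalfTop (W : ZMod m → B × Bool) (ρ : ZMod m → α) (P : Finset (X × ZMod m))
    (p : X × ZMod m) (ε : Bool) : Prop :=
  ∀ j δ, (p.1, j) ∈ P → outLetter W j δ = outLetter W p.2 ε → ρ j ≤ ρ p.2

/-- The position `p` is the highest above its vertex. -/
def VertexTop (ρ : ZMod m → α) (P : Finset (X × ZMod m)) (p : X × ZMod m) : Prop :=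
  ∀ j, (p.1, j) ∈ P → ρ j ≤ ρ p.2

lemma VertexTop.halfTop {W : ZMod m → B × Bool} {ρ : ZMod m → α} {P : Finset (X × ZMod m)}
    {p : X × ZMod m} (h : VertexTop ρ P p) (ε : Bool) : HalfTop W ρ P p ε := fun j _ hj _ => h j hj

end

section
variable {B : Type*} {X : Type*} [MulAction (FreeGroup B) X]

/-- The action of a letter. -/
def act (l : B × Bool) (x : X) : X := FreeGroup.mk [l] • x

@[simp] lemma act_invLetter_act (l : B × Bool) (x : X) : act (invLetter l) (act l x) = x := by
  have : FreeGroup.mk [invLetter l] = (FreeGroup.mk [l])⁻¹ := by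
    simp [FreeGroup.inv_mk, FreeGroup.invRev, invLetter]
  rw [act, act, this, inv_smul_smul]

@[simp] lemma act_act_invLetter (l : B × Bool) (x : X) : act l (act (invLetter l) x) = x := by
  simpa [invLetter_invLetter] using act_invLetter_act (invLetter l) x

/-- The positively oriented edge of the Schreier graph traversed when reading `l` from `x`. -/
def edgeKey (x : X) (l : B × Bool) : X × B := (if l.2 then x else act l x, l.1)

@[simp] lemma edgeKey_act (x : X) (l : B × Bool) :
    edgeKey (act l x) (invLetter l) = edgeKey x l := by
  rcases l with ⟨b, _ | _⟩ <;> simp [edgeKey, invLetter]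
  exact act_invLetter_act (b, true) x

lemma edgeKey_eq_iff {x y : X} {l k : B × Bool} :
    edgeKey x l = edgeKey y k ↔ (l = k ∧ x = y) ∨ (l = invLetter k ∧ x = act k y) := by
  constructor
  · intro h
    have h1 : l.1 = k.1 := congrArg (fun z => z.2) h
    have h2 := congrArg (fun z => z.1) h
    by_cases hb : l.2 = k.2
    · obtain rfl : l = k := Prod.ext h1 hb
      refine Or.inl ⟨rfl, ?_⟩
      simp only [edgeKey] at h2
      split_ifs at h2 with hc
      · exact h2
      · rw [← act_invLetter_act l x, h2, act_invLetter_act]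
    · have hl : l = invLetter k := by
        refine Prod.ext h1 ?_
        simp only [invLetter]
        cases h3 : l.2 <;> cases h4 : k.2 <;> simp_all
      refine Or.inr ⟨hl, ?_⟩
      subst hl
      rw [← edgeKey_act y k] at h
      have h2 := congrArg (fun z => z.1) h
      simp only [edgeKey] at h2
      split_ifs at h2 with hc
      · exact h2
      · rw [← act_invLetter_act (invLetter k) x, h2, act_invLetter_act]
  · rintro (⟨rfl, rfl⟩ | ⟨rfl, rfl⟩)
    · rfl
    · exact edgeKey_act y k

variable {m : ℕ} (W : ZMod m → B × Bool)

/-- Moving one step along the cyclic word, forwards or backwards. -/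
def pstep (p : X × ZMod m) (ε : Bool) : X × ZMod m :=
  (act (outLetter W p.2 ε) p.1, cstep p.2 ε)

/-- Moving one step forwards along the cyclic word. -/
def next (p : X × ZMod m) : X × ZMod m := (act (W p.2) p.1, p.2 + 1)

lemma pstep_true (p : X × ZMod m) : pstep W p true = next W p := rfl

@[simp] lemma pstep_pstep (p : X × ZMod m) (ε : Bool) : pstep W (pstep W p ε) (!ε) = p := by
  unfold pstep
  simp

lemma next_injective : Function.Injective (next (X := X) W) := fun p q h => by
  rw [← pstep_pstep W p true, ← pstep_pstep W q true, pstep_true, pstep_true, h]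

lemma iterate_next_snd (n : ℕ) (p : X × ZMod m) : ((next W)^[n] p).2 = p.2 + n := by
  induction n with
  | zero => simp
  | succ n ih => rw [Function.iterate_succ_apply', next, ih]; push_cast; ring

/-- The edge traversed by the step forwards from a position. -/
def posKey (p : X × ZMod m) : X × B := edgeKey p.1 (W p.2)

variable {W}
variable {α : Type*} [LinearOrder α] {ρ : ZMod m → α}

lemma HalfTop.pstep {P : Finset (X × ZMod m)} (hP : ∀ p ∈ P, ∀ ε, pstep W p ε ∈ P)
    (hst : ∀ i j ε δ, outLetter W i ε = outLetter W j δ → ρ i < ρ j →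
      ρ (cstep i ε) < ρ (cstep j δ)) {p : X × ZMod m} {ε : Bool} (h : HalfTop W ρ P p ε) :
    HalfTop W ρ P (pstep W p ε) (!ε) := by
  intro j δ hj e
  by_contra! hlt
  have h1 := hst _ _ _ _ e.symm hlt
  have e' : outLetter W j δ = invLetter (outLetter W p.2 ε) := by
    rw [e]; exact outLetter_cstep _ _
  have hj' := hP _ hj δ
  simp only [OneRelator.pstep, e', act_invLetter_act] at hj'
  have := h (cstep j δ) (!δ) hj' (by rw [outLetter_cstep, e', invLetter_invLetter])
  simp only [OneRelator.pstep, cstep_cstep] at h1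
  exact absurd this (not_le.2 h1)

open Classical in
theorem card_add_card_le_card_edges [NeZero m] (hW : CycReduced W) (hρ : Function.Injective ρ)
    (hst : ∀ i j ε δ, outLetter W i ε = outLetter W j δ → ρ i < ρ j →
      ρ (cstep i ε) < ρ (cstep j δ))
    (P : Finset (X × ZMod m)) (hP : ∀ p ∈ P, ∀ ε, pstep W p ε ∈ P)
    {b : B} (hb : ∃ i, (W i).1 = b)
    (hmul : ∀ p ∈ P, (W p.2).1 = b → ∃ q ∈ P, q ≠ p ∧ posKey W q = posKey W p)
    (D : Finset X) (hD : ∀ x ∈ D, (x, 0) ∈ P) :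
    D.card + (P.image Prod.fst).card ≤ (P.image (posKey W)).card := by
  have hnext : ∀ n : ℕ, ∀ p ∈ P, (next W)^[n] p ∈ P := by
    intro n p hp
    induction n with
    | zero => exact hp
    | succ n ih => rw [Function.iterate_succ_apply']; exact hP _ ih true
  set ET := P.filter fun p => HalfTop W ρ P p true with hET
  set VT := P.filter fun p => VertexTop ρ P p with hVT
  have hinjE : Set.InjOn (posKey W) (ET : Set (X × ZMod m)) := by
    rintro ⟨x, i⟩ hp ⟨y, j⟩ hq h
    simp only [hET, coe_filter, Set.mem_ofPred_eq] at hp hq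
    rcases edgeKey_eq_iff.1 h with ⟨h1, h2⟩ | ⟨h1, h2⟩
    · simp only at h1 h2
      subst h2
      have a := hp.2 j true hq.1 h1.symm
      have a' := hq.2 i true hp.1 h1
      rw [hρ (le_antisymm a a')]
    · simp only at h1 h2
      have t := (hq.2).pstep hP hst
      simp only [pstep, outLetter_true, ← h2] at t
      have a := t i true hp.1 (by simp [h1])
      have a' := hp.2 (j + 1) false (by
        have := hP _ hq.1 true
        simpa [pstep, ← h2] using this) (by simp [h1])
      have e : i = j + 1 := hρ (le_antisymm a a')
      exact absurd (e ▸ h1) (hW j)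
  have hsubE : VT ⊆ ET := by
    intro p hp
    simp only [hVT, hET, mem_filter] at hp ⊢
    exact ⟨hp.1, hp.2.halfTop _⟩
  have hcardE : ET.card ≤ (P.image (posKey W)).card := by
    rw [← card_image_of_injOn hinjE]
    exact card_le_card (image_subset_image (filter_subset _ _))
  have hcardV : (P.image Prod.fst).card ≤ VT.card := by
    refine card_le_card_of_surjOn Prod.fst ?_
    intro x hx
    simp only [coe_image, Set.mem_image, mem_coe] at hx
    obtain ⟨⟨x', i⟩, hp, rfl⟩ := hx
    obtain ⟨⟨y, j⟩, hq, hmax⟩ := exists_max_image (P.filter fun q => q.1 = x') (fun q => ρ q.2)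
      ⟨(x', i), by simp [hp]⟩
    simp only [mem_filter] at hq
    refine ⟨(y, j), ?_, hq.2⟩
    simp only [hVT, coe_filter, Set.mem_ofPred_eq]
    refine ⟨hq.1, fun k hk => ?_⟩
    have := hmax (y, k) (by simp only [mem_filter]; exact ⟨hk, hq.2⟩)
    exact this
  -- a position index whose forward half-edge is never on top
  have hlow : ∃ i₁ : ZMod m, ∀ x, (x, i₁) ∈ P → ¬ HalfTop W ρ P (x, i₁) true := by
    have hmul' : ∀ x i ε, (x, i) ∈ P → (outLetter W i ε).1 = b →
        ∃ j δ, (x, j) ∈ P ∧ j ≠ i ∧ outLetter W j δ = outLetter W i ε := by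
      have base : ∀ x i, (x, i) ∈ P → (W i).1 = b →
          (∃ j δ, (x, j) ∈ P ∧ j ≠ i ∧ outLetter W j δ = outLetter W i true) ∧
          (∃ j δ, (act (W i) x, j) ∈ P ∧ j ≠ i + 1 ∧
            outLetter W j δ = invLetter (W i)) := by
        intro x i hp hi
        obtain ⟨⟨y, j⟩, hq, hne, hk⟩ := hmul _ hp hi
        rcases edgeKey_eq_iff.1 hk with ⟨h1, h2⟩ | ⟨h1, h2⟩
        · simp only at h1 h2
          subst h2
          have hji : j ≠ i := fun h => hne (by rw [h])
          refine ⟨⟨j, true, hq, hji, h1⟩, j + 1, false, ?_, fun h => hji (add_right_cancel h), ?_⟩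
          · have := hP _ hq true
            simpa [pstep, h1] using this
          · simp [h1]
        · simp only at h1 h2
          have := hP _ hq true
          simp only [pstep, outLetter_true, cstep_true, h1, h2, act_invLetter_act] at this
          refine ⟨⟨j + 1, false, this, fun h => ?_, by simp [h1, invLetter_invLetter]⟩,
            j, true, h2 ▸ hq, fun h => ?_, h1⟩
          · apply hW j
            rw [h, h1, invLetter_invLetter]
          · apply hW i
            rw [← h, h1]
      intro x i ε hp hi
      cases ε
      · have hq := hP _ hp false
        obtain ⟨j, δ, h1, h2, h3⟩ := (base _ _ hq hi).2
        simp only [outLetter_false, cstep_false, act_act_invLetter, sub_add_cancel]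
          at h1 h2 h3
        exact ⟨j, δ, h1, h2, h3⟩
      · exact (base x i hp hi).1
    obtain ⟨i, hi⟩ := hb
    have hne : (univ.filter fun q : ZMod m × Bool => outLetter W q.1 q.2 = (b, true)).Nonempty := by
      by_cases h : (W i).2 = true
      · exact ⟨(i, true), by simp [Prod.ext_iff, hi, h]⟩
      · exact ⟨(i + 1, false), by simp [Prod.ext_iff, hi, h, invLetter]⟩
    obtain ⟨⟨k, ε⟩, hk, hmin⟩ := exists_min_image _ (fun q : ZMod m × Bool => ρ q.1) hne
    simp only [mem_filter, mem_univ, true_and, Prod.forall] at hk hmin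
    have hnot : ∀ x, (x, k) ∈ P → ¬ HalfTop W ρ P (x, k) ε := by
      intro x hx ht
      obtain ⟨j, δ, h1, h2, h3⟩ := hmul' x k ε hx (by rw [hk])
      have a := ht j δ h1 h3
      have a' := hmin j δ (h3.trans hk)
      exact h2 (hρ (le_antisymm a a'))
    cases ε
    · refine ⟨k - 1, fun x hx ht => ?_⟩
      have h1 := hP _ hx true
      have h2 := ht.pstep hP hst
      simp only [pstep, cstep_true, sub_add_cancel, Bool.not_true] at h1 h2
      exact hnot _ h1 h2
    · exact ⟨k, hnot⟩
  obtain ⟨i₁, hi₁⟩ := hlow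
  obtain ⟨i₂, -, hi₂⟩ := exists_max_image (univ : Finset (ZMod m)) ρ ⟨0, mem_univ _⟩
  have htop : ∀ x, VertexTop ρ P (x, i₂) := fun x j _ => hi₂ j (mem_univ _)
  have hstart : ∀ x ∈ D, ∃ t < m, (next W)^[t] ((next W)^[i₁.val] (x, 0)) ∈ ET \ VT := by
    intro x hx
    set p := (next W)^[i₁.val] (x, 0) with hpdef
    have hp : p ∈ P := hnext _ _ (hD x hx)
    have hp2 : p.2 = i₁ := by rw [hpdef, iterate_next_snd]; simp
    have h₂ : HalfTop W ρ P ((next W)^[(i₂ - i₁).val] p) true := by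
      refine VertexTop.halfTop (W := W) (fun j hj => ?_) true
      have : ((next W)^[(i₂ - i₁).val] p).2 = i₂ := by rw [iterate_next_snd, hp2]; simp
      rw [this]
      exact htop _ j hj
    have hex : ∃ t, HalfTop W ρ P ((next W)^[t] p) true := ⟨_, h₂⟩
    refine ⟨Nat.find hex, lt_of_le_of_lt (Nat.find_min' hex h₂) (ZMod.val_lt _), ?_⟩
    have hs := Nat.find_spec hex
    simp only [hET, hVT, mem_sdiff, mem_filter, not_and]
    refine ⟨⟨hnext _ _ hp, hs⟩, fun _ hv => ?_⟩
    rcases Nat.eq_zero_or_pos (Nat.find hex) with h0 | h0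
    · rw [h0] at hs
      have : p = (p.1, i₁) := Prod.ext rfl hp2
      simp only [Function.iterate_zero, id] at hs
      rw [this] at hs hp
      exact hi₁ _ hp hs
    · obtain ⟨t, ht⟩ := Nat.exists_eq_add_of_lt h0
      rw [zero_add] at ht
      have hmin := Nat.find_min hex (m := t) (by omega)
      rw [ht, Function.iterate_succ_apply'] at hv
      have := (hv.halfTop (W := W) false).pstep hP hst
      rw [← pstep_true] at this
      rw [show pstep W (pstep W ((next W)^[t] p) true) false = (next W)^[t] p from
        pstep_pstep W _ true] at this
      exact hmin this
  choose! t ht1 ht2 using hstart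
  have hD' : D.card ≤ (ET \ VT).card := by
    refine card_le_card_of_injOn (fun x => (next W)^[t x] ((next W)^[i₁.val] (x, 0)))
      (fun x hx => ht2 x hx) ?_
    intro x hx y hy h
    simp only at h
    have h2 := congrArg Prod.snd h
    simp only [iterate_next_snd] at h2
    have h3 : ((t x : ℕ) : ZMod m) = t y := by simpa using h2
    have h4 : t x = t y := by
      have := congrArg ZMod.val h3
      rwa [ZMod.val_natCast_of_lt (ht1 x hx), ZMod.val_natCast_of_lt (ht1 y hy)] at this
    rw [h4] at h
    have h5 := (next_injective W).iterate _ h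
    have h6 := (next_injective W).iterate _ h5
    exact congrArg Prod.fst h6
  rw [card_sdiff_of_subset hsubE] at hD'
  have := card_le_card hsubE
  omega

end

section
variable {B : Type*} {X : Type*} [MulAction (FreeGroup B) X]

/-- The sign of a letter. -/
def lsign (l : B × Bool) : ℚ := if l.2 then 1 else -1

lemma lsign_ne_zero (l : B × Bool) : lsign l ≠ 0 := by
  unfold lsign; split_ifs <;> norm_num

/-- The oriented edge traversed when reading `l` from `x`, as a chain. -/
noncomputable def echain (x : X) (l : B × Bool) : X × B →₀ ℚ :=
  Finsupp.single (edgeKey x l) (lsign l)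

/-- The boundary map of the Schreier graph. -/
noncomputable def bdry : (X × B →₀ ℚ) →ₗ[ℚ] (X →₀ ℚ) :=
  Finsupp.linearCombination ℚ fun e : X × B =>
    Finsupp.single (act (e.2, true) e.1) 1 - Finsupp.single e.1 1

lemma bdry_echain (x : X) (l : B × Bool) :
    bdry (echain x l) = Finsupp.single (act l x) 1 - Finsupp.single x 1 := by
  rcases l with ⟨b, _ | _⟩
  · have := act_act_invLetter (b, true) x
    simp only [invLetter, Bool.not_true] at this
    simp [bdry, echain, edgeKey, lsign, this]
  · simp [bdry, echain, edgeKey, lsign]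

variable {m : ℕ} (W : ZMod m → B × Bool)

/-- The chain traversed in `M` steps along the cyclic word starting from `x` at position `0`. -/
noncomputable def pathChain (M : ℕ) (x : X) : X × B →₀ ℚ :=
  ∑ t ∈ range M, echain ((next W)^[t] (x, 0)).1 (W ((next W)^[t] (x, 0)).2)

lemma bdry_pathChain (M : ℕ) (x : X) :
    bdry (pathChain W M x) = Finsupp.single ((next W)^[M] (x, 0)).1 1 - Finsupp.single x 1 := by
  induction M with
  | zero => simp [pathChain]
  | succ M ih =>
    rw [pathChain, sum_range_succ, map_add, ← pathChain, ih, bdry_echain,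
      Function.iterate_succ_apply']
    simp [next]

/-- The cycles of the Schreier graph supported on a set of edges. -/
noncomputable def cyclesOn (T : Finset (X × B)) : Submodule ℚ (X × B →₀ ℚ) :=
  LinearMap.ker bdry ⊓ Finsupp.supported ℚ ℚ (T : Set (X × B))

instance finite_supported {ι : Type*} (T : Finset ι) :
    Module.Finite ℚ (Finsupp.supported ℚ ℚ (T : Set ι)) :=
  Module.Finite.equiv (Finsupp.supportedEquivFinsupp (T : Set ι)).symm

lemma finrank_supported {ι : Type*} (T : Finset ι) :
    Module.finrank ℚ (Finsupp.supported ℚ ℚ (T : Set ι)) = T.card := by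
  rw [(Finsupp.supportedEquivFinsupp (M := ℚ) (R := ℚ) (T : Set ι)).finrank_eq]
  simp

instance finite_cyclesOn (T : Finset (X × B)) : Module.Finite ℚ (cyclesOn T) :=
  Submodule.finiteDimensional_of_le (inf_le_right : _ ≤ Finsupp.supported ℚ ℚ (T : Set (X × B)))

lemma cyclesOn_mono {S T : Finset (X × B)} (h : S ⊆ T) : cyclesOn S ≤ cyclesOn T :=
  inf_le_inf_left _ (Finsupp.supported_mono (by exact_mod_cast h))

lemma card_lt_finrank_cyclesOn (T : Finset (X × B)) (V : Finset X) (hV : V.Nonempty)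
    (h : ∀ e ∈ T, e.1 ∈ V ∧ act (e.2, true) e.1 ∈ V) :
    T.card < Module.finrank ℚ (cyclesOn T) + V.card := by
  set S := Finsupp.supported ℚ ℚ (T : Set (X × B))
  set Φ : S →ₗ[ℚ] (X →₀ ℚ) := bdry.domRestrict S
  have h1 := LinearMap.finrank_range_add_finrank_ker Φ
  rw [finrank_supported] at h1
  have h2 : Module.finrank ℚ (LinearMap.ker Φ) = Module.finrank ℚ (cyclesOn T) := by
    have : Submodule.map S.subtype (LinearMap.ker Φ) = cyclesOn T := by
      ext c
      simp only [Submodule.mem_map, LinearMap.mem_ker, cyclesOn, Submodule.mem_inf]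
      constructor
      · rintro ⟨c, hc, rfl⟩
        exact ⟨hc, c.2⟩
      · rintro ⟨h1, h2⟩
        exact ⟨⟨c, h2⟩, h1, rfl⟩
    rw [← this, Submodule.finrank_map_subtype_eq]
  have h3 : LinearMap.range Φ < Finsupp.supported ℚ ℚ (V : Set X) := by
    have haug : ∀ c : X × B →₀ ℚ, Finsupp.linearCombination ℚ (fun _ : X => (1 : ℚ)) (bdry c) = 0 := by
      intro c
      induction c using Finsupp.induction_linear with
      | zero => simp
      | add f g hf hg => rw [map_add, map_add, hf, hg, add_zero]
      | single e a => simp [bdry]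
    refine lt_of_le_of_ne ?_ fun he => ?_
    · rintro _ ⟨⟨c, hc⟩, rfl⟩
      change bdry c ∈ _
      rw [Finsupp.mem_supported] at hc
      rw [bdry, Finsupp.linearCombination_apply, Finsupp.sum]
      refine Submodule.sum_mem _ fun e he => Submodule.smul_mem _ _ (Submodule.sub_mem _ ?_ ?_)
      · exact Finsupp.single_mem_supported _ _ (h e (hc he)).2
      · exact Finsupp.single_mem_supported _ _ (h e (hc he)).1
    · obtain ⟨v, hv⟩ := hV
      have : Finsupp.single v (1 : ℚ) ∈ LinearMap.range Φ := by
        rw [he]; exact Finsupp.single_mem_supported _ _ hv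
      obtain ⟨⟨c, hc⟩, hcv⟩ := this
      have h4 := haug c
      change bdry c = _ at hcv
      rw [hcv] at h4
      simp at h4
  have h4 := Submodule.finrank_lt_finrank_of_lt h3
  rw [finrank_supported] at h4
  omega

open Classical in
lemma pathChain_apply_self {M : ℕ} (x : X) (p : X × ZMod m)
    (h : ∀ t < M, posKey W ((next W)^[t] (x, 0)) = posKey W p → (next W)^[t] (x, 0) = p) :
    pathChain W M x (posKey W p) =
      #{t ∈ range M | (next W)^[t] (x, 0) = p} * lsign (W p.2) := by
  rw [pathChain, Finsupp.finsetSum_apply, card_filter, Nat.cast_sum, sum_mul]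
  refine sum_congr rfl fun t ht => ?_
  rw [echain, Finsupp.single_apply]
  by_cases hp : (next W)^[t] (x, 0) = p
  · rw [hp]; simp [posKey]
  · have h' := fun h' => hp (h t (mem_range.1 ht) h')
    rw [posKey] at h'
    rw [if_neg h']; simp [hp]

lemma pathChain_mem_supported {M : ℕ} {x : X} {T : Finset (X × B)}
    (h : ∀ t, posKey W ((next W)^[t] (x, 0)) ∈ T) :
    pathChain W M x ∈ Finsupp.supported ℚ ℚ (T : Set (X × B)) :=
  Submodule.sum_mem _ fun t _ => Finsupp.single_mem_supported _ _ (h t)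

variable {W} {α : Type*} [LinearOrder α] {ρ : ZMod m → α}

open Classical in
theorem card_lt_finrank_cyclesOn_of_relation [NeZero m] (hW : CycReduced W)
    (hP : CycPrimitive W) {b : B} (hb : ∃ i, (W i).1 = b) {M : ℕ} (hM : 0 < M) (f : X → ℚ) (N : ℕ) :
    ∀ (T : Finset (X × B)) (D : Finset X), T.card ≤ N →
    (∀ x ∈ D, (next W)^[M] (x, 0) = (x, 0)) →
    (∀ x ∈ D, ∀ y ∈ D, ∀ t, (next W)^[t] (x, 0) = (y, 0) → x = y) →
    (∀ x ∈ D, ∀ t, posKey W ((next W)^[t] (x, 0)) ∈ T) →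
    (∃ x ∈ D, f x ≠ 0) →
    (∀ y, (∑ x ∈ D, f x • pathChain W M x) (y, b) = 0) →
    D.card < Module.finrank ℚ (cyclesOn T) := by
  induction N with
  | zero =>
    intro T D hT _ _ hk ⟨x, hx, _⟩ _
    have := hk x hx 0
    rw [card_eq_zero.1 (Nat.le_zero.1 hT)] at this
    simp at this
  | succ N ih =>
    intro T D hT hper hdis hk hf hzero
    set P := D.biUnion fun x => (range M).image fun t => (next W)^[t] (x, 0) with hPdef
    have hmod : ∀ x ∈ D, ∀ t, (next W)^[t] (x, 0) = (next W)^[t % M] (x, 0) := by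
      intro x hx t
      exact (Function.IsPeriodicPt.iterate_mod_apply (hper x hx) t).symm
    have hPmem : ∀ p, p ∈ P ↔ ∃ x ∈ D, ∃ t, (next W)^[t] (x, 0) = p := by
      intro p
      simp only [hPdef, mem_biUnion, mem_image, mem_range]
      constructor
      · rintro ⟨x, hx, t, _, rfl⟩; exact ⟨x, hx, t, rfl⟩
      · rintro ⟨x, hx, t, rfl⟩; exact ⟨x, hx, t % M, Nat.mod_lt _ hM, (hmod x hx t).symm⟩
    have hPstep : ∀ p ∈ P, ∀ ε, pstep W p ε ∈ P := by
      intro p hp ε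
      obtain ⟨x, hx, t, rfl⟩ := (hPmem p).1 hp
      cases ε
      · refine (hPmem _).2 ⟨x, hx, t + (M - 1), ?_⟩
        have : (next W)^[t] (x, 0) = next W ((next W)^[t + (M - 1)] (x, 0)) := by
          rw [← Function.iterate_succ_apply' (next W), show (t + (M - 1)).succ = t + M by omega,
            hmod x hx t, hmod x hx (t + M), Nat.add_mod_right]
        rw [this, ← pstep_true]
        exact (pstep_pstep W _ true).symm
      · exact (hPmem _).2 ⟨x, hx, t + 1, by rw [Function.iterate_succ_apply', pstep_true]⟩
    have hPT : P.image (posKey W) ⊆ T := by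
      intro e he
      obtain ⟨p, hp, rfl⟩ := mem_image.1 he
      obtain ⟨x, hx, t, rfl⟩ := (hPmem p).1 hp
      exact hk x hx t
    by_cases hA : P.image (posKey W) = T
    swap
    · obtain ⟨e, he, hne⟩ := exists_of_ssubset (lt_of_le_of_ne hPT hA)
      have := ih (T.erase e) D (by rw [card_erase_of_mem he]; omega) hper hdis
        (fun x hx t => mem_erase.2 ⟨fun h => hne (h ▸ mem_image_of_mem _ ((hPmem _).2 ⟨x, hx, t, rfl⟩)),
          hk x hx t⟩) hf hzero
      exact this.trans_le (Submodule.finrank_mono (cyclesOn_mono (erase_subset _ _)))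
    by_cases hB : ∀ p ∈ P, (W p.2).1 = b → ∃ q ∈ P, q ≠ p ∧ posKey W q = posKey W p
    · obtain ⟨α, _, ρ, hρ, hst⟩ := exists_stacking hW hP
      have hcount := card_add_card_le_card_edges hW hρ hst P hPstep hb hB D
        fun x hx => (hPmem _).2 ⟨x, hx, 0, rfl⟩
      obtain ⟨x, hx, -⟩ := hf
      have := card_lt_finrank_cyclesOn T (P.image Prod.fst)
        ⟨x, mem_image.2 ⟨(x, 0), (hPmem _).2 ⟨x, hx, 0, rfl⟩, rfl⟩⟩ (by
          intro e he
          rw [← hA] at he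
          obtain ⟨⟨y, i⟩, hp, rfl⟩ := mem_image.1 he
          have h1 : y ∈ P.image Prod.fst := mem_image.2 ⟨_, hp, rfl⟩
          have h2 : act (W i) y ∈ P.image Prod.fst := mem_image.2 ⟨_, hPstep _ hp true, rfl⟩
          simp only [posKey, edgeKey]
          have hl : W i = ((W i).1, (W i).2) := rfl
          cases hs : (W i).2
          · rw [hs] at hl
            refine ⟨by simpa using h2, ?_⟩
            have h3 := act_invLetter_act (W i) y
            rw [hl] at h3
            simp only [invLetter, Bool.not_false] at h3
            rw [← hl] at h3
            simpa [h3] using h1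
          · rw [hs] at hl
            refine ⟨by simpa using h1, ?_⟩
            simp only [if_true]
            rw [← hl]; exact h2)
      rw [hA] at hcount
      omega
    · push Not at hB
      obtain ⟨p, hp, hpb, hpu⟩ := hB
      obtain ⟨x₀, hx₀, t₀, rfl⟩ := (hPmem p).1 hp
      set p := (next W)^[t₀] (x₀, 0) with hpdef
      have huniq : ∀ x ∈ D, ∀ t, posKey W ((next W)^[t] (x, 0)) = posKey W p →
          (next W)^[t] (x, 0) = p := by
        intro x hx t h
        by_contra hne
        exact hpu _ ((hPmem _).2 ⟨x, hx, t, rfl⟩) hne h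
      have horb : ∀ x ∈ D, ∀ t, (next W)^[t] (x, 0) = p → x = x₀ := by
        intro x hx t h
        have h1 : (next W)^[M - t₀ % M + t] (x, 0) = (x₀, 0) := by
          rw [Function.iterate_add_apply, h, hpdef, hmod x₀ hx₀ t₀, ← Function.iterate_add_apply,
            Nat.sub_add_cancel (Nat.mod_lt _ hM).le, hper x₀ hx₀]
        exact hdis x hx x₀ hx₀ _ h1
      have hoff : ∀ x ∈ D, x ≠ x₀ → pathChain W M x (posKey W p) = 0 := by
        intro x hx hne
        rw [pathChain_apply_self W x p fun t _ => huniq x hx t]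
        rw [filter_false_of_mem fun t _ h => hne (horb x hx t h)]
        simp
      have hon : pathChain W M x₀ (posKey W p) ≠ 0 := by
        rw [pathChain_apply_self W x₀ p fun t _ => huniq x₀ hx₀ t]
        refine mul_ne_zero ?_ (lsign_ne_zero _)
        rw [Nat.cast_ne_zero]
        refine card_ne_zero.2 ⟨t₀ % M, ?_⟩
        rw [mem_filter]
        exact ⟨mem_range.2 (Nat.mod_lt _ hM), (hmod x₀ hx₀ t₀).symm⟩
      have hf0 : f x₀ = 0 := by
        have h1 : posKey W p = ((posKey W p).1, b) := Prod.ext rfl hpb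
        have h2 := hzero (posKey W p).1
        rw [← h1, Finsupp.finsetSum_apply, sum_eq_single x₀] at h2
        · simpa [hon] using h2
        · intro x hx hne
          simp [hoff x hx hne]
        · exact fun h => absurd hx₀ h
      have hpT : posKey W p ∈ T := hk x₀ hx₀ t₀
      have hsum : ∑ x ∈ D.erase x₀, f x • pathChain W M x = ∑ x ∈ D, f x • pathChain W M x := by
        rw [← add_sum_erase _ _ hx₀, hf0, zero_smul, zero_add]
      have := ih (T.erase (posKey W p)) (D.erase x₀) (by rw [card_erase_of_mem hpT]; omega)
        (fun x hx => hper x (mem_of_mem_erase hx))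
        (fun x hx y hy => hdis x (mem_of_mem_erase hx) y (mem_of_mem_erase hy))
        (fun x hx t => mem_erase.2 ⟨fun h => (mem_erase.1 hx).1
          (horb x (mem_of_mem_erase hx) t (huniq x (mem_of_mem_erase hx) t h)),
          hk x (mem_of_mem_erase hx) t⟩)
        (by
          obtain ⟨x, hx, hfx⟩ := hf
          exact ⟨x, mem_erase.2 ⟨fun h => hfx (h ▸ hf0), hx⟩, hfx⟩)
        (by rw [hsum]; exact hzero)
      have hlt : cyclesOn (T.erase (posKey W p)) < cyclesOn T := by
        refine lt_of_le_of_ne (cyclesOn_mono (erase_subset _ _)) fun he => ?_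
        have hmem : pathChain W M x₀ ∈ cyclesOn T :=
          ⟨by rw [SetLike.mem_coe, LinearMap.mem_ker, bdry_pathChain, hper x₀ hx₀, sub_self],
            pathChain_mem_supported W (hk x₀ hx₀)⟩
        rw [← he] at hmem
        have h2 := (Finsupp.mem_supported _ _).1 hmem.2
        have h3 := h2 (Finsupp.mem_support_iff.2 hon)
        simp at h3
      have := Submodule.finrank_lt_finrank_of_lt hlt
      rw [card_erase_of_mem hx₀] at *
      omega

end

section
variable {B : Type*} {m : ℕ}

/-- The group element spelled by the first `t` letters of a cyclic word (applied right to left). -/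
def wordElt (W : ZMod m → B × Bool) : ℕ → FreeGroup B
  | 0 => 1
  | t + 1 => FreeGroup.mk [W t] * wordElt W t

lemma iterate_next {X : Type*} [MulAction (FreeGroup B) X] (W : ZMod m → B × Bool) (t : ℕ) (x : X) :
    (next W)^[t] (x, 0) = (wordElt W t • x, (t : ZMod m)) := by
  induction t with
  | zero => simp [wordElt]
  | succ t ih =>
    rw [Function.iterate_succ_apply', ih]
    simp [next, wordElt, act, mul_smul]

lemma wordElt_add (W : ZMod m → B × Bool) {t : ℕ} (ht : (t : ZMod m) = 0) (s : ℕ) :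
    wordElt W (s + t) = wordElt W s * wordElt W t := by
  induction s with
  | zero => simp [wordElt]
  | succ s ih =>
    rw [Nat.succ_add, wordElt, ih, wordElt, mul_assoc]
    simp [ht]

lemma wordElt_commute (W : ZMod m → B × Bool) {s t : ℕ} (hs : (s : ZMod m) = 0)
    (ht : (t : ZMod m) = 0) : Commute (wordElt W s) (wordElt W t) := by
  rw [commute_iff_eq, ← wordElt_add W ht, ← wordElt_add W hs, add_comm]

theorem exists_cyclic_word (v : List (B × Bool)) (hv : FreeGroup.IsCyclicallyReduced v)
    (hne : v ≠ []) :
    ∃ (m : ℕ) (_ : NeZero m) (M : ℕ) (W : ZMod m → B × Bool), 0 < M ∧ (M : ZMod m) = 0 ∧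
      CycReduced W ∧ CycPrimitive W ∧ (∀ l ∈ v, ∃ i, W i = l) ∧ wordElt W M = FreeGroup.mk v := by
  have hn : 0 < v.length := List.length_pos_iff.2 hne
  set n := v.length with hndef
  have hlen : v.reverse.length = n := by simp [hndef]
  let u : ℕ → B × Bool := fun t => v.reverse[t % n]'(by rw [hlen]; exact Nat.mod_lt _ hn)
  have hun : ∀ t, u (t + n) = u t := fun t => by simp [u]
  have hex : ∃ m, 0 < m ∧ ∀ t, u (t + m) = u t := ⟨n, hn, hun⟩
  classical
  set m := Nat.find hex with hmdef
  obtain ⟨hm, hper⟩ : 0 < m ∧ ∀ t, u (t + m) = u t := Nat.find_spec hex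
  have hmin : ∀ k, k < m → (∀ t, u (t + k) = u t) → k = 0 := by
    intro k hk h
    by_contra h0
    exact Nat.find_min hex hk ⟨Nat.pos_of_ne_zero h0, h⟩
  have hperk : ∀ k t, u (t + m * k) = u t := by
    intro k t
    induction k with
    | zero => rfl
    | succ k ih => rw [Nat.mul_succ, ← add_assoc, hper, ih]
  have hdvd : m ∣ n := by
    refine Nat.dvd_of_mod_eq_zero (hmin _ (Nat.mod_lt _ hm) fun t => ?_)
    rw [← hperk (n / m) (t + n % m), add_assoc, Nat.mod_add_div, hun]
  have : NeZero m := ⟨hm.ne'⟩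
  let W : ZMod m → B × Bool := fun i => u i.val
  have hW : ∀ t : ℕ, W t = u t := by
    intro t
    change u (t : ZMod m).val = u t
    rw [ZMod.val_natCast]
    conv_rhs => rw [← Nat.mod_add_div t m, hperk]
  have hred : ∀ t, u (t + 1) ≠ invLetter (u t) := by
    intro t h
    have h2 := (hv.flatten_replicate 2).isReduced
    simp only [List.replicate, List.flatten_cons, List.flatten_nil, List.append_nil] at h2
    have h3 : List.IsChain (fun a b : B × Bool => b.1 = a.1 → b.2 = a.2) (v.reverse ++ v.reverse) := by
      rw [← List.reverse_append, List.isChain_reverse]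
      exact h2
    rw [List.isChain_iff_getElem] at h3
    have hs : t % n < n := Nat.mod_lt _ hn
    have h4 := h3 (t % n) (by simp; omega)
    have e1 : (v.reverse ++ v.reverse)[t % n]'(by simp; omega) = u t := by
      rw [List.getElem_append_left (by simpa using hs)]
    have e2 : (v.reverse ++ v.reverse)[t % n + 1]'(by simp; omega) = u (t + 1) := by
      rcases Nat.lt_or_ge (t % n + 1) n with hlt | hge
      · rw [List.getElem_append_left (by simpa using hlt)]
        simp only [u]
        congr 1
        rw [Nat.add_mod, Nat.mod_eq_of_lt (b := n) (a := t % n + 1 % n)]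
        · rcases Nat.lt_or_ge 1 n with h1 | h1
          · rw [Nat.mod_eq_of_lt h1]
          · omega
        · have := Nat.mod_le 1 n
          omega
      · rw [List.getElem_append_right (by simpa using hge)]
        simp only [u]
        congr 1
        have hmod : (t + 1) % n = 0 := by
          have : t + 1 = n + n * (t / n) := by
            have := Nat.mod_add_div t n; omega
          rw [this]; simp
        rw [hmod]; simp; omega
    rw [e1, e2, h] at h4
    simp [invLetter] at h4
  refine ⟨m, this, n, W, hn, (ZMod.natCast_eq_zero_iff _ _).2 hdvd, ?_, ?_, ?_, ?_⟩
  · intro i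
    have : i + 1 = ((i.val + 1 : ℕ) : ZMod m) := by push_cast; simp
    rw [this, hW]
    exact hred _
  · intro j hj
    have := hmin j.val (ZMod.val_lt _) fun t => by
      rw [← hW, ← hW, Nat.cast_add, ZMod.natCast_zmod_val]; exact hj _
    exact (ZMod.val_eq_zero _).1 this
  · intro l hl
    obtain ⟨t, ht, rfl⟩ := List.getElem_of_mem (List.mem_reverse.2 hl)
    refine ⟨t, ?_⟩
    rw [hW]
    simp only [u]
    congr 1
    exact Nat.mod_eq_of_lt (by rwa [hlen] at ht)
  · have key : ∀ t ≤ n, wordElt W t = FreeGroup.mk (v.reverse.take t).reverse := by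
      intro t
      induction t with
      | zero => intro _; simp [wordElt, FreeGroup.one_eq_mk]
      | succ t ih =>
        intro ht
        rw [wordElt, ih (by omega), List.take_succ_eq_append_getElem (by rw [hlen]; omega), hW]
        have : u t = v.reverse[t]'(by rw [hlen]; omega) := by
          simp only [u]; congr 1; exact Nat.mod_eq_of_lt (by omega)
        rw [this, List.reverse_append, List.reverse_singleton, FreeGroup.mul_mk]
    rw [key n le_rfl, ← hlen, List.take_length, List.reverse_reverse]

end

section
variable {B : Type*} {X : Type*} [MulAction (FreeGroup B) X]

/-- The action of the free group on points together with accumulated chains. -/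
noncomputable def flowHom : FreeGroup B →* Equiv.Perm (X × (X × B →₀ ℚ)) :=
  FreeGroup.lift fun b =>
    { toFun := fun p => (FreeGroup.of b • p.1, p.2 + Finsupp.single (p.1, b) 1)
      invFun := fun p => ((FreeGroup.of b)⁻¹ • p.1,
        p.2 - Finsupp.single ((FreeGroup.of b)⁻¹ • p.1, b) 1)
      left_inv := fun p => by simp
      right_inv := fun p => by simp }

/-- The chain traversed by the path labelled `g` from `x`. -/
noncomputable def flow (g : FreeGroup B) (x : X) : X × B →₀ ℚ := (flowHom g (x, 0)).2

lemma flowHom_apply (g : FreeGroup B) (x : X) (c : X × B →₀ ℚ) :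
    flowHom g (x, c) = (g • x, c + flow g x) := by
  unfold flow
  induction g using FreeGroup.induction_on generalizing x c with
  | C1 => simp
  | of b => simp [flowHom]
  | inv_of b _ =>
    rw [map_inv]
    simp [flowHom, Equiv.Perm.inv_def, Equiv.symm, sub_eq_add_neg]
  | mul g h hg hh =>
    rw [map_mul, Equiv.Perm.mul_apply, Equiv.Perm.mul_apply, hh, hg, hh x 0, hg (h • x), hg (h • x) (0 + _),
      mul_smul]
    simp [add_assoc]

lemma flow_mul (g h : FreeGroup B) (x : X) : flow (g * h) x = flow h x + flow g (h • x) := by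
  have := flowHom_apply (g * h) x 0
  rw [map_mul, Equiv.Perm.mul_apply, flowHom_apply, flowHom_apply] at this
  simpa using (congrArg Prod.snd this).symm

@[simp] lemma flow_one (x : X) : flow (1 : FreeGroup B) x = 0 := by simp [flow]

lemma flow_inv (g : FreeGroup B) (x : X) : flow g⁻¹ x = -flow g (g⁻¹ • x) := by
  have := flow_mul g g⁻¹ x
  rw [mul_inv_cancel, flow_one] at this
  exact eq_neg_of_add_eq_zero_left this.symm

lemma flow_inv_mul_mul (g h : FreeGroup B) (x : X) (hx : h • g • x = g • x) :
    flow (g⁻¹ * h * g) x = flow h (g • x) := by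
  rw [flow_mul, flow_mul, hx, flow_inv, inv_smul_smul]
  abel

lemma flow_of (b : B) (x : X) : flow (FreeGroup.of b) x = Finsupp.single (x, b) 1 := by
  simp [flow, flowHom]

lemma flow_mk_singleton (l : B × Bool) (x : X) : flow (FreeGroup.mk [l]) x = echain x l := by
  rcases l with ⟨b, _ | _⟩
  · have : FreeGroup.mk [(b, false)] = (FreeGroup.of b)⁻¹ := rfl
    rw [this, flow_inv, flow_of]
    simp [echain, lsign, edgeKey, act, this]
  · exact (flow_of b x).trans (by simp [echain, lsign, edgeKey])

lemma flow_mk_cons (a : B × Bool) (l : List (B × Bool)) (x : X) :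
    flow (FreeGroup.mk (a :: l)) x = flow (FreeGroup.mk l) x + echain (FreeGroup.mk l • x) a := by
  rw [← flow_mk_singleton, ← flow_mul, FreeGroup.mul_mk]; rfl

lemma bdry_flow (g : FreeGroup B) (x : X) :
    bdry (flow g x) = Finsupp.single (g • x) 1 - Finsupp.single x 1 := by
  induction g using FreeGroup.induction_on generalizing x with
  | C1 => simp
  | of b =>
    change bdry (flow (FreeGroup.mk [(b, true)]) x) = Finsupp.single ((FreeGroup.mk [(b, true)]) • x) 1 - _
    rw [flow_mk_singleton, bdry_echain]; rfl
  | inv_of b _ => 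
    change bdry (flow (FreeGroup.mk [(b, false)]) x) = Finsupp.single ((FreeGroup.mk [(b, false)]) • x) 1 - _
    rw [flow_mk_singleton, bdry_echain]; rfl
  | mul g h hg hh => rw [flow_mul, map_add, hg, hh, mul_smul]; abel

lemma flow_wordElt {m : ℕ} (W : ZMod m → B × Bool) (t : ℕ) (x : X) :
    flow (wordElt W t) x = pathChain W t x := by
  induction t with
  | zero => simp [wordElt, pathChain]
  | succ t ih =>
    rw [wordElt, flow_mul, ih, flow_mk_singleton]
    conv_rhs => rw [pathChain, sum_range_succ, iterate_next]
    rfl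

lemma flow_eq_of_commute {g h : FreeGroup B} (hgh : Commute g h) {x : X} (hx : h • x = x) :
    flow h (g • x) = flow h x := by
  have := congrArg (flow · x) hgh.eq
  simp only [flow_mul, hx] at this
  rw [add_comm] at this
  exact (add_left_cancel this).symm

lemma ker_bdry_le_span (L : Subgroup (FreeGroup B)) :
    LinearMap.ker (bdry (B := B) (X := FreeGroup B ⧸ L)) ≤
      Submodule.span ℚ (Set.range fun l : L => flow (l : FreeGroup B) (QuotientGroup.mk 1 : FreeGroup B ⧸ L)) := by
  classical
  set x₀ : FreeGroup B ⧸ L := QuotientGroup.mk 1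
  set S := Submodule.span ℚ (Set.range fun l : L => flow (l : FreeGroup B) x₀)
  have hout : ∀ x : FreeGroup B ⧸ L, x.out • x₀ = x := fun x => by
    change QuotientGroup.mk (x.out * 1) = x
    rw [mul_one]; exact QuotientGroup.out_eq' x
  let Λ : ((FreeGroup B ⧸ L) × B →₀ ℚ) →ₗ[ℚ] ((FreeGroup B ⧸ L) × B →₀ ℚ) :=
    Finsupp.linearCombination ℚ fun e : (FreeGroup B ⧸ L) × B =>
      flow ((FreeGroup.of e.2 • e.1).out⁻¹ * FreeGroup.of e.2 * e.1.out) x₀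
  let Q : ((FreeGroup B ⧸ L) →₀ ℚ) →ₗ[ℚ] ((FreeGroup B ⧸ L) × B →₀ ℚ) :=
    Finsupp.linearCombination ℚ fun x => flow x.out x₀
  have hΛ : ∀ c, Λ c ∈ S := by
    intro c
    simp only [Λ, Finsupp.linearCombination_apply, Finsupp.sum]
    refine Submodule.sum_mem _ fun e _ => Submodule.smul_mem _ _ (Submodule.subset_span ⟨⟨_, ?_⟩, rfl⟩)
    rw [mul_assoc, ← QuotientGroup.eq, QuotientGroup.out_eq']
    have h2 : (QuotientGroup.mk (FreeGroup.of e.2 * e.1.out) : FreeGroup B ⧸ L) =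
        FreeGroup.of e.2 • QuotientGroup.mk e.1.out := rfl
    rw [h2, QuotientGroup.out_eq']
  have hid : ∀ c, Λ c + Q (bdry c) = c := by
    intro c
    induction c using Finsupp.induction_linear with
    | zero => simp
    | add f g hf hg =>
      rw [map_add, map_add, map_add]
      conv_rhs => rw [← hf, ← hg]
      abel
    | single e a =>
      have h1 : act (e.2, true) e.1 = FreeGroup.of e.2 • e.1 := rfl
      have h2 : (FreeGroup.of e.2 • e.1).out⁻¹ • FreeGroup.of e.2 • e.1 = x₀ := by
        conv_lhs => rw [← hout (FreeGroup.of e.2 • e.1)]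
        rw [hout, inv_smul_eq_iff, hout]
      simp only [Λ, Q, bdry, Finsupp.linearCombination_single, map_smul, map_sub, h1, ← smul_add,
        one_smul]
      rw [flow_mul, flow_mul, hout, flow_of, flow_inv, h2]
      rw [show flow e.1.out x₀ + (Finsupp.single (e.1, e.2) 1 + -flow (FreeGroup.of e.2 • e.1).out x₀) +
        (flow (FreeGroup.of e.2 • e.1).out x₀ - flow e.1.out x₀) = Finsupp.single (e.1, e.2) 1 by abel]
      simp
  intro c hc
  rw [← hid c, LinearMap.mem_ker.1 hc, map_zero, add_zero]
  exact hΛ c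

lemma exists_orbit_reps {m : ℕ} (W : ZMod m → B × Bool) {M : ℕ} (hM : 0 < M) (D₀ : Finset X)
    (h₀ : ∀ x ∈ D₀, (next W)^[M] (x, 0) = (x, 0)) :
    ∃ D ⊆ D₀, (∀ x ∈ D, ∀ y ∈ D, ∀ t, (next W)^[t] (x, 0) = (y, 0) → x = y) ∧
      ∀ y ∈ D₀, ∃ x ∈ D, ∃ t, (next W)^[t] (x, 0) = (y, 0) := by
  classical
  have hback : ∀ x ∈ D₀, ∀ y t, (next W)^[t] (x, 0) = (y, 0) → ∃ s, (next W)^[s] (y, 0) = (x, 0) := by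
    intro x hx y t h
    refine ⟨M * t - t, ?_⟩
    rw [← h, ← Function.iterate_add_apply, Nat.sub_add_cancel (Nat.le_mul_of_pos_left t hM)]
    exact (Function.IsPeriodicPt.mul_const (h₀ x hx) t)
  induction D₀ using Finset.induction_on with
  | empty => exact ⟨∅, le_rfl, by simp, by simp⟩
  | insert y D₀ _ ih =>
    obtain ⟨D, hD, h1, h2⟩ := ih (fun x hx => h₀ x (mem_insert_of_mem hx))
      fun x hx => hback x (mem_insert_of_mem hx)
    by_cases hy : ∃ x ∈ D, ∃ t, (next W)^[t] (x, 0) = (y, 0)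
    · refine ⟨D, hD.trans (subset_insert _ _), h1, fun z hz => ?_⟩
      rcases mem_insert.1 hz with rfl | hz
      · exact hy
      · exact h2 z hz
    · push Not at hy
      refine ⟨insert y D, insert_subset_insert _ hD, ?_, ?_⟩
      · intro x hx z hz t h
        rcases mem_insert.1 hx with rfl | hx <;> rcases mem_insert.1 hz with rfl | hz
        · rfl
        · obtain ⟨s, hs⟩ := hback _ (mem_insert_self _ _) _ _ h
          exact absurd hs (hy z hz s)
        · exact absurd h (hy x ‹_› t)
        · exact h1 x hx z hz t h
      · intro z hz
        rcases mem_insert.1 hz with rfl | hz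
        · exact ⟨z, mem_insert_self _ _, 0, rfl⟩
        · obtain ⟨x, hx, t, h⟩ := h2 z hz
          exact ⟨x, mem_insert_of_mem hx, t, h⟩

theorem card_lt_finrank_ker_bdry {m : ℕ} [NeZero m] {W : ZMod m → B × Bool} (hW : CycReduced W)
    (hP : CycPrimitive W) {b : B} (hb : ∃ i, (W i).1 = b) {M : ℕ} (hM : 0 < M) (f : X → ℚ)
    [Module.Finite ℚ (LinearMap.ker (bdry (B := B) (X := X)))] (D : Finset X)
    (hper : ∀ x ∈ D, (next W)^[M] (x, 0) = (x, 0))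
    (hdis : ∀ x ∈ D, ∀ y ∈ D, ∀ t, (next W)^[t] (x, 0) = (y, 0) → x = y)
    (hf : ∃ x ∈ D, f x ≠ 0)
    (hz : ∀ y, (∑ x ∈ D, f x • pathChain W M x) (y, b) = 0) :
    D.card < Module.finrank ℚ (LinearMap.ker (bdry (B := B) (X := X))) := by
  classical
  refine (card_lt_finrank_cyclesOn_of_relation hW hP hb hM f _
    (D.biUnion fun x => (range M).image fun t => posKey W ((next W)^[t] (x, 0))) D le_rfl hper hdis
    (fun x hx t => ?_) hf hz).trans_le (Submodule.finrank_mono inf_le_left)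
  refine mem_biUnion.2 ⟨x, hx, mem_image.2 ⟨t % M, mem_range.2 (Nat.mod_lt _ hM), ?_⟩⟩
  rw [Function.IsPeriodicPt.iterate_mod_apply (hper x hx)]

lemma exists_finset_mem_closure_conj {G : Type*} [Group G] (r : G) (S : Set G) (hS : S.Finite)
    (h : ∀ u ∈ S, u ∈ Subgroup.normalClosure {r}) :
    ∃ C : Finset G, ∀ u ∈ S, u ∈ Subgroup.closure ((fun g => g⁻¹ * r * g) '' (C : Set G)) := by
  classical
  have h1 : ∀ u ∈ Subgroup.normalClosure {r},
      ∃ C : Finset G, u ∈ Subgroup.closure ((fun g => g⁻¹ * r * g) '' (C : Set G)) := by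
    intro u hu
    induction hu using Subgroup.closure_induction with
    | mem x hx =>
      obtain ⟨_, rfl, hc⟩ := Group.mem_conjugatesOfSet_iff.1 hx
      obtain ⟨g, rfl⟩ := isConj_iff.1 hc
      exact ⟨{g⁻¹}, Subgroup.subset_closure ⟨g⁻¹, by simp, by simp⟩⟩
    | one => exact ⟨∅, one_mem _⟩
    | mul x y _ _ hx hy =>
      obtain ⟨C, hC⟩ := hx
      obtain ⟨C', hC'⟩ := hy
      refine ⟨C ∪ C', mul_mem (Subgroup.closure_mono (Set.image_mono ?_) hC)
        (Subgroup.closure_mono (Set.image_mono ?_) hC')⟩ <;> simp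
    | inv x _ hx =>
      obtain ⟨C, hC⟩ := hx
      exact ⟨C, inv_mem hC⟩
  choose! C hC using h1
  refine ⟨hS.toFinset.biUnion C, fun u hu => Subgroup.closure_mono (Set.image_mono ?_) (hC u (h u hu))⟩
  intro g hg
  simp only [coe_biUnion, Set.mem_iUnion]
  exact ⟨u, by simpa using hu, hg⟩

end

section
variable {B : Type*} {X : Type*} [MulAction (FreeGroup B) X]

lemma exists_coeff_of_mem_span {ι E : Type*} [AddCommGroup E] [Module ℚ E] {v : ι → E}
    {D : Finset ι} {c : E} (h : c ∈ Submodule.span ℚ (v '' (D : Set ι))) :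
    ∃ f : ι → ℚ, c = ∑ x ∈ D, f x • v x := by
  obtain ⟨l, hl, rfl⟩ := (Finsupp.mem_span_image_iff_linearCombination ℚ).1 h
  exact ⟨l, by
    rw [Finsupp.linearCombination_apply]
    exact Finsupp.sum_of_support_subset _ (by simpa [Finsupp.mem_supported] using hl) _ (by simp)⟩

lemma finrank_le_card_of_le_span {ι E : Type*} [AddCommGroup E] [Module ℚ E] {v : ι → E}
    {D : Finset ι} {K : Submodule ℚ E} (h : K ≤ Submodule.span ℚ (v '' (D : Set ι))) :
    Module.Finite ℚ K ∧ Module.finrank ℚ K ≤ D.card := by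
  classical
  have hfin : Module.Finite ℚ (Submodule.span ℚ (v '' (D : Set ι))) :=
    Module.Finite.span_of_finite ℚ (D.finite_toSet.image v)
  refine ⟨Submodule.finiteDimensional_of_le h, (Submodule.finrank_mono h).trans ?_⟩
  rw [← coe_image]
  exact (finrank_span_finset_le_card _).trans card_image_le

lemma flow_apply_eq_zero {b : B} {l : List (B × Bool)} (hl : ∀ a ∈ l, a.1 ≠ b) (x y : X) :
    flow (FreeGroup.mk l) x (y, b) = 0 := by
  classical
  induction l with
  | nil => rw [← FreeGroup.one_eq_mk]; simp
  | cons a l ih =>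
    rw [flow_mk_cons, Finsupp.add_apply, ih fun c hc => hl c (List.mem_cons_of_mem _ hc), zero_add,
      echain, Finsupp.single_apply, if_neg]
    intro h
    exact hl a List.mem_cons_self (congrArg (fun z => z.2) h)

lemma exists_split_of_flow_ne_zero {l : List (B × Bool)} {x : X} {e : X × B}
    (h : flow (FreeGroup.mk l) x e ≠ 0) :
    ∃ l₁ c l₂, l = l₁ ++ c :: l₂ ∧ edgeKey (FreeGroup.mk l₂ • x) c = e := by
  classical
  induction l with
  | nil => rw [← FreeGroup.one_eq_mk] at h; simp at h
  | cons a l ih =>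
    by_cases he : edgeKey (FreeGroup.mk l • x) a = e
    · exact ⟨[], a, l, rfl, he⟩
    · rw [flow_mk_cons, Finsupp.add_apply, echain, Finsupp.single_apply, if_neg he, add_zero] at h
      obtain ⟨l₁, c, l₂, rfl, h2⟩ := ih h
      exact ⟨a :: l₁, c, l₂, rfl, h2⟩

lemma mk_append_smul (l₁ l₂ : List (B × Bool)) (x : X) :
    FreeGroup.mk (l₁ ++ l₂) • x = FreeGroup.mk l₁ • FreeGroup.mk l₂ • x := by
  rw [← FreeGroup.mul_mk, mul_smul]

/-- A closed reduced path avoiding `b` yields a nonzero cycle avoiding `b`. -/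
lemma exists_cycle_of_loop {b : B} (N : ℕ) : ∀ (l : List (B × Bool)) (x : X), l.length ≤ N → l ≠ [] →
    FreeGroup.IsReduced l → (∀ a ∈ l, a.1 ≠ b) → FreeGroup.mk l • x = x →
    ∃ c : X × B →₀ ℚ, c ≠ 0 ∧ bdry c = 0 ∧ ∀ y, c (y, b) = 0 := by
  induction N with
  | zero => intro l x h hne; exact absurd (List.length_eq_zero_iff.1 (Nat.le_zero.1 h)) hne
  | succ N ih =>
    intro l x hlen hne hred hb hx
    by_cases hshort : ∃ (l' : List (B × Bool)) (y : X), l'.length < l.length ∧ l' ≠ [] ∧ l' <:+: l ∧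
        FreeGroup.mk l' • y = y
    · obtain ⟨l', y, h1, h2, h3, h4⟩ := hshort
      exact ih l' y (by omega) h2 (hred.infix h3) (fun a ha => hb a (h3.subset ha)) h4
    · push Not at hshort
      refine ⟨flow (FreeGroup.mk l) x, ?_, by rw [bdry_flow, hx, sub_self],
        fun y => flow_apply_eq_zero hb x y⟩
      obtain ⟨a, l, rfl⟩ := List.exists_cons_of_ne_nil hne
      have hz : flow (FreeGroup.mk l) x (edgeKey (FreeGroup.mk l • x) a) = 0 := by
        by_contra hnz
        obtain ⟨l₁, c, l₂, rfl, he⟩ := exists_split_of_flow_ne_zero hnz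
        rcases edgeKey_eq_iff.1 he with ⟨rfl, h2⟩ | ⟨rfl, h2⟩
        · refine hshort (l₁ ++ [c]) (FreeGroup.mk l₂ • x) (by simp) (by simp)
            ⟨[c], l₂, by simp⟩ ?_
          rw [← mk_append_smul, List.append_assoc, List.singleton_append, ← h2]
        · have h3 : FreeGroup.mk l₂ • x = x := by
            rw [h2, act, ← mk_append_smul]
            exact hx
          by_cases hl₂ : l₂ = []
          · subst hl₂
            by_cases hl₁ : l₁ = []
            · subst hl₁
              simp [FreeGroup.IsReduced, invLetter] at hred
            · refine hshort l₁ (act (invLetter a) x) (by simp) hl₁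
                ⟨[a], [invLetter a], by simp⟩ ?_
              have h4 : act a (FreeGroup.mk (l₁ ++ [invLetter a]) • x) = x := by
                rw [act, ← mk_append_smul]; exact hx
              have h5 := congrArg (act (invLetter a)) h4
              rw [act_invLetter_act, mk_append_smul] at h5
              exact h5
          · exact hshort l₂ x (by simp; omega) hl₂ ⟨a :: (l₁ ++ [invLetter a]), [], by simp⟩ h3
      intro h0
      have := congrArg (fun c => c (edgeKey (FreeGroup.mk l • x) a)) h0
      simp only [flow_mk_cons, Finsupp.add_apply, hz, zero_add, echain, Finsupp.single_eq_same,
        Finsupp.zero_apply] at this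
      exact lsign_ne_zero a this

theorem freiheitssatz {v : List (B × Bool)} (hv : FreeGroup.IsCyclicallyReduced v) {b : B}
    (hb : ∃ a ∈ v, a.1 = b) {l : List (B × Bool)} (hl : ∀ a ∈ l, a.1 ≠ b)
    (h : FreeGroup.mk l ∈ Subgroup.normalClosure {FreeGroup.mk v}) : FreeGroup.mk l = 1 := by
  classical
  obtain ⟨a, hav, hab⟩ := hb
  obtain ⟨m, _, M, W, hM, hM0, hred, hprim, hocc, hr⟩ :=
    exists_cyclic_word v hv (List.ne_nil_of_mem hav)
  have hbW : ∃ i, (W i).1 = b := by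
    obtain ⟨i, hi⟩ := hocc a hav
    exact ⟨i, by rw [hi, hab]⟩
  obtain ⟨C, hC⟩ := exists_finset_mem_closure_conj _ {FreeGroup.mk l} (Set.finite_singleton _)
    (by simpa using h)
  rw [← hr] at hC
  set r := wordElt W M
  set L := Subgroup.closure ((fun g => g⁻¹ * r * g) '' (C : Set (FreeGroup B)))
  have hlL : FreeGroup.mk l ∈ L := hC _ rfl
  set x₀ : FreeGroup B ⧸ L := QuotientGroup.mk 1
  have hfix : ∀ g ∈ L, g • x₀ = x₀ := fun g hg => by
    change QuotientGroup.mk (g * 1) = QuotientGroup.mk 1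
    rw [QuotientGroup.eq]
    simpa using hg
  have hCfix : ∀ g ∈ C, r • g • x₀ = g • x₀ := fun g hg => by
    have := hfix _ (Subgroup.subset_closure ⟨g, hg, rfl⟩)
    rwa [mul_smul, mul_smul, inv_smul_eq_iff] at this
  obtain ⟨D, hD, hdis, hrep⟩ := exists_orbit_reps W hM (C.image fun g => g • x₀) (by
    intro x hx
    obtain ⟨g, hg, rfl⟩ := mem_image.1 hx
    rw [iterate_next, hCfix g hg, hM0])
  have hDfix : ∀ x ∈ D, r • x = x := fun x hx => by
    obtain ⟨g, hg, rfl⟩ := mem_image.1 (hD hx)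
    exact hCfix g hg
  have hspan : LinearMap.ker (bdry (B := B) (X := FreeGroup B ⧸ L)) ≤
      Submodule.span ℚ (pathChain W M '' (D : Set (FreeGroup B ⧸ L))) := by
    refine (ker_bdry_le_span L).trans (Submodule.span_le.2 ?_)
    rintro _ ⟨⟨g, hg⟩, rfl⟩
    simp only
    change flow g x₀ ∈ _
    induction hg using Subgroup.closure_induction with
    | mem g hg =>
      obtain ⟨g, hg, rfl⟩ := hg
      simp only
      rw [flow_inv_mul_mul _ _ _ (hCfix g hg)]
      obtain ⟨x, hx, t, ht⟩ := hrep (g • x₀) (mem_image_of_mem _ hg)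
      rw [iterate_next] at ht
      have h1 : wordElt W t • x = g • x₀ := congrArg Prod.fst ht
      have h2 : (t : ZMod m) = 0 := congrArg Prod.snd ht
      rw [← h1, flow_eq_of_commute (wordElt_commute W h2 hM0) (hDfix x hx), flow_wordElt]
      exact Submodule.subset_span ⟨x, hx, rfl⟩
    | one => simp
    | mul g h hg hh ihg ihh =>
      rw [flow_mul, hfix h hh]
      exact Submodule.add_mem _ ihh ihg
    | inv g hg ih =>
      rw [flow_inv, hfix _ (inv_mem hg)]
      exact Submodule.neg_mem _ ih
  obtain ⟨hfin, hle⟩ := finrank_le_card_of_le_span hspan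
  by_contra hne
  obtain ⟨c, hc0, hc1, hc2⟩ := exists_cycle_of_loop (b := b) _ (FreeGroup.reduce l) x₀ le_rfl
    (fun h0 => hne (by rw [← FreeGroup.mk_toWord (x := FreeGroup.mk l), FreeGroup.toWord_mk, h0]; rfl))
    (by rw [FreeGroup.isReduced_iff_reduce_eq, FreeGroup.reduce.idem])
    (fun a ha => hl a (FreeGroup.reduce.red.sublist.subset ha))
    (by rw [FreeGroup.reduce.self]; exact hfix _ hlL)
  obtain ⟨f, rfl⟩ := exists_coeff_of_mem_span (hspan (LinearMap.mem_ker.2 hc1))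
  have := card_lt_finrank_ker_bdry hred hprim hbW hM f D
    (fun x hx => by rw [iterate_next, hDfix x hx, hM0]) hdis (by
      by_contra! h0
      exact hc0 (sum_eq_zero fun x hx => by rw [h0 x hx, zero_smul])) hc2
  omega

end

section
variable {V ι : Type*} (src tgt : ι → V)

/-- The two-step nilpotent group associated with the bilinear form `(a, b) ↦ a (src e) * b (tgt e)`. -/
@[ext] structure Heis (src tgt : ι → V) where
  /-- The abelianized part. -/
  a : V → ℚ
  /-- The central part. -/
  z : ι → ℚ

namespace Heis
variable {src tgt}

instance : Group (Heis src tgt) :=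
  letI : Mul (Heis src tgt) :=
    ⟨fun x y => ⟨x.a + y.a, fun e => x.z e + y.z e + x.a (src e) * y.a (tgt e)⟩⟩
  letI : One (Heis src tgt) := ⟨⟨0, 0⟩⟩
  letI : Inv (Heis src tgt) := ⟨fun x => ⟨-x.a, fun e => -x.z e + x.a (src e) * x.a (tgt e)⟩⟩
  Group.ofLeftAxioms
    (fun x y w => Heis.ext (add_assoc _ _ _) (funext fun e => by
      change x.z e + y.z e + x.a (src e) * y.a (tgt e) + w.z e +
        (x.a (src e) + y.a (src e)) * w.a (tgt e) =
        x.z e + (y.z e + w.z e + y.a (src e) * w.a (tgt e)) +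
        x.a (src e) * (y.a (tgt e) + w.a (tgt e))
      ring))
    (fun x => Heis.ext (zero_add _) (funext fun e => by
      change 0 + x.z e + 0 * x.a (tgt e) = x.z e
      ring))
    (fun x => Heis.ext (neg_add_cancel _) (funext fun e => by
      change -x.z e + x.a (src e) * x.a (tgt e) + x.z e + (-x.a (src e)) * x.a (tgt e) = 0
      ring))

@[simp] lemma mul_a (x y : Heis src tgt) : (x * y).a = x.a + y.a := rfl
@[simp] lemma mul_z (x y : Heis src tgt) (e : ι) :
    (x * y).z e = x.z e + y.z e + x.a (src e) * y.a (tgt e) := rfl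
@[simp] lemma inv_a (x : Heis src tgt) : (x⁻¹).a = -x.a := rfl
@[simp] lemma inv_z (x : Heis src tgt) (e : ι) :
    (x⁻¹).z e = -x.z e + x.a (src e) * x.a (tgt e) := rfl

/-- The projection to the abelianized part. -/
def fstHom : Heis src tgt →* Multiplicative (V → ℚ) where
  toFun x := Multiplicative.ofAdd x.a
  map_one' := rfl
  map_mul' _ _ := rfl

lemma conj_eq {x : Heis src tgt} (hx : x.a = 0) (y : Heis src tgt) : y⁻¹ * x * y = x := by
  have : x * y = y * x := by
    ext e
    · simp [hx]
    · simp [hx]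
      ring
  rw [mul_assoc, this, inv_mul_cancel_left]

lemma commutator_z (x y : Heis src tgt) :
    (x * y * (y * x)⁻¹).z = fun e => x.a (src e) * y.a (tgt e) - y.a (src e) * x.a (tgt e) := by
  ext e
  simp
  ring

lemma exists_lift (src tgt : ι → V) {L : Type*} [Group L] [IsFreeGroup L]
    (a : L →* Multiplicative (V → ℚ)) :
    ∃ Q : L →* Heis src tgt, ∀ l, (Q l).a = Multiplicative.toAdd (a l) := by
  refine ⟨IsFreeGroup.lift fun i => ⟨Multiplicative.toAdd (a (IsFreeGroup.of i)), 0⟩, fun l => ?_⟩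
  have : (fstHom (src := src) (tgt := tgt)).comp
      (IsFreeGroup.lift fun i => ⟨Multiplicative.toAdd (a (IsFreeGroup.of i)), 0⟩) = a :=
    IsFreeGroup.ext_hom fun i => by
      rw [MonoidHom.comp_apply, IsFreeGroup.lift_of]; rfl
  exact congrArg Multiplicative.toAdd (DFunLike.congr_fun this l)

end Heis

lemma exists_lift_of_closure {F Q K : Type*} [Group F] [Group Q] [Group K] (φ : K →* Q)
    (hφ : Function.Injective φ) (π : F →* Q) (S : Set F) (hS : ∀ s ∈ S, ∃ k, φ k = π s) :
    ∃ p : Subgroup.closure S →* K, ∀ l, φ (p l) = π l := by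
  have h : Subgroup.closure S ≤ φ.range.comap π := by
    rw [Subgroup.closure_le]
    exact hS
  refine ⟨(MonoidHom.ofInjective hφ).symm.toMonoidHom.comp
    ((π.comp (Subgroup.closure S).subtype).codRestrict φ.range fun l => h l.2), fun l => ?_⟩
  exact congrArg Subtype.val ((MonoidHom.ofInjective hφ).apply_symm_apply _)

lemma finrank_map_fst_add_card_le {ι E : Type*} [Fintype ι] [AddCommGroup E] [Module ℚ E]
    {I : Submodule ℚ (E × (ι → ℚ))} [Module.Finite ℚ I] (h : ∀ s : ι → ℚ, ((0, s) : E × (ι → ℚ)) ∈ I) :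
    Module.finrank ℚ (I.map (LinearMap.fst ℚ E (ι → ℚ))) + Fintype.card ι ≤ Module.finrank ℚ I := by
  set f := (LinearMap.fst ℚ E (ι → ℚ)).domRestrict I
  have h1 := LinearMap.finrank_range_add_finrank_ker f
  rw [LinearMap.range_domRestrict] at h1
  rw [← h1, ← Module.finrank_fintype_fun_eq_card ℚ]
  refine Nat.add_le_add_left ?_ _
  refine LinearMap.finrank_le_finrank_of_injective
    (f := ((LinearMap.inr ℚ E (ι → ℚ)).codRestrict I h).codRestrict (LinearMap.ker f) fun s => rfl) ?_
  intro s s' hs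
  exact congrArg (fun x => x.1.1.2) hs

lemma single_commutator {V ι : Type*} [DecidableEq V] [DecidableEq ι] {src tgt : ι → V}
    (hinj : ∀ e e', src e = src e' → tgt e = tgt e' → e = e')
    (hsym : ∀ e e', ¬ (tgt e = src e' ∧ src e = tgt e')) (e : ι) :
    (fun e' => (Pi.single (src e) 1 : V → ℚ) (src e') * (Pi.single (tgt e) 1 : V → ℚ) (tgt e') -
      (Pi.single (tgt e) 1 : V → ℚ) (src e') * (Pi.single (src e) 1 : V → ℚ) (tgt e')) =
      Pi.single e 1 := by
  ext e'
  have h2 := hinj e e'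
  have h3 := hsym e e'
  have h4 := hsym e' e'
  simp only [Pi.single_apply]
  split_ifs <;> grind

set_option maxHeartbeats 4000000 in
theorem false_of_embedding {B : Type*} {V ι K : Type*} [Fintype V] [Fintype ι] [DecidableEq V]
    [DecidableEq ι] [Nonempty ι] (hcard : Fintype.card V ≤ Fintype.card ι) (src tgt : ι → V)
    (hinj : ∀ e e', src e = src e' → tgt e = tgt e' → e = e')
    (hsym : ∀ e e', ¬ (tgt e = src e' ∧ src e = tgt e'))
    [Group K] (x : V → K) (ab : K →* Multiplicative (V → ℚ))
    (hab : ∀ v, ab (x v) = Multiplicative.ofAdd (Pi.single v 1))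
    (hcomm : ∀ e, x (src e) * x (tgt e) = x (tgt e) * x (src e))
    {v : List (B × Bool)} (hv : FreeGroup.IsCyclicallyReduced v) (hne : v ≠ [])
    (φ : K →* FreeGroup B ⧸ Subgroup.normalClosure {FreeGroup.mk v})
    (hφ : Function.Injective φ) : False := by
  classical
  obtain ⟨l₀, hl₀⟩ := List.exists_mem_of_ne_nil _ hne
  obtain ⟨m, _, M, W, hM, hM0, hred, hprim, hocc, hr⟩ := exists_cyclic_word v hv hne
  have hbW : ∃ i, (W i).1 = l₀.1 := by
    obtain ⟨i, hi⟩ := hocc l₀ hl₀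
    exact ⟨i, by rw [hi]⟩
  set N := Subgroup.normalClosure {FreeGroup.mk v}
  set r := wordElt W M with hrdef
  have hrN : r ∈ N := by rw [hr]; exact Subgroup.subset_normalClosure rfl
  choose y hy using fun i => QuotientGroup.mk'_surjective N (φ (x i))
  set c : ι → FreeGroup B := fun e => y (src e) * y (tgt e) * (y (tgt e) * y (src e))⁻¹ with hc
  have hcN : ∀ u ∈ Set.range c, u ∈ N := by
    rintro _ ⟨e, rfl⟩
    rw [← QuotientGroup.eq_one_iff]
    change QuotientGroup.mk' N (c e) = 1
    simp only [hc, map_mul, map_inv, hy]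
    rw [← map_mul, ← map_mul, hcomm, mul_inv_cancel]
  obtain ⟨C, hC⟩ := exists_finset_mem_closure_conj _ (Set.range c) (Set.finite_range c) hcN
  rw [← hr] at hC
  set S := (fun g => g⁻¹ * r * g) '' (C : Set (FreeGroup B))
  set L := Subgroup.closure (Set.range y ∪ S)
  have hyL : ∀ i, y i ∈ L := fun i => Subgroup.subset_closure (Or.inl ⟨i, rfl⟩)
  have hSL : ∀ g ∈ C, g⁻¹ * r * g ∈ L := fun g hg => Subgroup.subset_closure (Or.inr ⟨g, hg, rfl⟩)
  have hSN : ∀ g, g⁻¹ * r * g ∈ N := fun g => by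
    simpa using Subgroup.normalClosure_normal.conj_mem r hrN g⁻¹
  obtain ⟨p, hp⟩ := exists_lift_of_closure φ hφ (QuotientGroup.mk' N) (Set.range y ∪ S) (by
    rintro _ (⟨i, rfl⟩ | ⟨g, hg, rfl⟩)
    · exact ⟨x i, (hy i).symm⟩
    · exact ⟨1, by rw [map_one]; exact ((QuotientGroup.eq_one_iff _).2 (hSN g)).symm⟩)
  have hpy : ∀ i, p ⟨y i, hyL i⟩ = x i := fun i => hφ ((hp _).trans (hy i))
  have hpS : ∀ g (hg : g⁻¹ * r * g ∈ L), p ⟨_, hg⟩ = 1 := fun g hg => hφ (by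
    rw [hp, map_one]; exact (QuotientGroup.eq_one_iff _).2 (hSN g))
  obtain ⟨Q, hQ⟩ := Heis.exists_lift src tgt (ab.comp p)
  have hQy : ∀ i, (Q ⟨y i, hyL i⟩).a = Pi.single i 1 := fun i => by
    rw [hQ, MonoidHom.comp_apply, hpy, hab]; rfl
  have hQS : ∀ g (hg : g⁻¹ * r * g ∈ L), (Q ⟨_, hg⟩).a = 0 := fun g hg => by
    rw [hQ, MonoidHom.comp_apply, hpS, map_one]; rfl
  have hcL : ∀ e, c e ∈ L := fun e =>
    L.mul_mem (L.mul_mem (hyL _) (hyL _)) (L.inv_mem (L.mul_mem (hyL _) (hyL _)))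
  have hQc : ∀ e, (Q ⟨c e, hcL e⟩).z = Pi.single e 1 := fun e => by
    have h1 : (⟨c e, hcL e⟩ : L) = ⟨y (src e), hyL _⟩ * ⟨y (tgt e), hyL _⟩ *
      (⟨y (tgt e), hyL _⟩ * ⟨y (src e), hyL _⟩)⁻¹ := rfl
    rw [h1, map_mul, map_mul, map_inv, map_mul, Heis.commutator_z, hQy, hQy]
    exact single_commutator hinj hsym e
  set x₀ : FreeGroup B ⧸ L := QuotientGroup.mk 1
  have hfix : ∀ g ∈ L, g • x₀ = x₀ := fun g hg => by
    change QuotientGroup.mk (g * 1) = QuotientGroup.mk 1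
    rw [QuotientGroup.eq]
    simpa using hg
  have hCfix : ∀ g ∈ C, r • g • x₀ = g • x₀ := fun g hg => by
    have := hfix _ (hSL g hg)
    rwa [mul_smul, mul_smul, inv_smul_eq_iff] at this
  obtain ⟨D, hD, hdis, hrep⟩ := exists_orbit_reps W hM (C.image fun g => g • x₀) (by
    intro x hx
    obtain ⟨g, hg, rfl⟩ := mem_image.1 hx
    rw [iterate_next, hCfix g hg, hM0])
  have hDfix : ∀ x ∈ D, r • x = x := fun x hx => by
    obtain ⟨g, hg, rfl⟩ := mem_image.1 (hD hx)
    exact hCfix g hg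
  have hG : ∀ x ∈ D, ∃ g ∈ C, g • x₀ = x := fun x hx => mem_image.1 (hD hx)
  choose! G hGC hGx using hG
  set q : FreeGroup B → (ι → ℚ) := fun g => if h : g ∈ L then (Q ⟨g, h⟩).z else 0
  have hq : ∀ g (h : g ∈ L), q g = (Q ⟨g, h⟩).z := fun g h => dif_pos h
  set Θ : FreeGroup B ⧸ L → ((FreeGroup B ⧸ L) × B →₀ ℚ) × (ι → ℚ) :=
    fun x => (flow r x, q ((G x)⁻¹ * r * G x)) with hΘ
  set I := Submodule.span ℚ (Θ '' (D : Set (FreeGroup B ⧸ L)))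
  have hCI : ∀ g ∈ C, (flow (g⁻¹ * r * g) x₀, q (g⁻¹ * r * g)) ∈ I := fun g hg => by
    obtain ⟨x, hx, t, ht⟩ := hrep (g • x₀) (mem_image_of_mem _ hg)
    rw [iterate_next] at ht
    have h1 : wordElt W t • x = g • x₀ := congrArg Prod.fst ht
    have h2 : (t : ZMod m) = 0 := congrArg Prod.snd ht
    have hcm := wordElt_commute W h2 hM0
    refine Submodule.subset_span ⟨x, hx, ?_⟩
    rw [hΘ]
    refine Prod.ext ?_ ?_
    · change flow r x = flow (g⁻¹ * r * g) x₀
      rw [flow_inv_mul_mul _ _ _ (hCfix g hg), ← h1, flow_eq_of_commute hcm (hDfix x hx)]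
    · change q ((G x)⁻¹ * r * G x) = q (g⁻¹ * r * g)
      set u := wordElt W t
      have hl : (u * G x)⁻¹ * g ∈ L := by
        have h3 : (u * G x) • x₀ = g • x₀ := by rw [mul_smul, hGx x hx, h1]
        have h4 : (QuotientGroup.mk ((u * G x) * 1) : FreeGroup B ⧸ L) =
          QuotientGroup.mk (g * 1) := h3
        rw [mul_one, mul_one, QuotientGroup.eq] at h4
        exact h4
      have h5 : (⟨g⁻¹ * r * g, hSL g hg⟩ : L) =
          ⟨_, hl⟩⁻¹ * ⟨_, hSL _ (hGC x hx)⟩ * ⟨_, hl⟩ := by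
        ext
        change g⁻¹ * r * g = ((u * G x)⁻¹ * g)⁻¹ * ((G x)⁻¹ * r * G x) * ((u * G x)⁻¹ * g)
        have h6 : u * r * u⁻¹ = r := by rw [hcm.eq, mul_inv_cancel_right]
        conv_lhs => rw [← h6]
        group
      rw [hq _ (hSL g hg), hq _ (hSL _ (hGC x hx)), h5, map_mul, map_mul, map_inv,
        Heis.conj_eq (hQS _ _)]
  have hSI : ∀ u ∈ Subgroup.closure S, ∃ hu : u ∈ L, (Q ⟨u, hu⟩).a = 0 ∧ (flow u x₀, q u) ∈ I := by
    intro u hu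
    induction hu using Subgroup.closure_induction with
    | mem u hu =>
      obtain ⟨g, hg, rfl⟩ := hu
      exact ⟨hSL g hg, hQS g _, hCI g hg⟩
    | one =>
      have h1 : Q ⟨1, L.one_mem⟩ = 1 := map_one Q
      refine ⟨L.one_mem, by rw [h1]; rfl, ?_⟩
      rw [hq _ L.one_mem, h1, flow_one]
      exact I.zero_mem
    | mul g h _ _ ihg ihh =>
      obtain ⟨hg, hga, hgI⟩ := ihg
      obtain ⟨hh, hha, hhI⟩ := ihh
      have h1 : Q ⟨g * h, L.mul_mem hg hh⟩ = Q ⟨g, hg⟩ * Q ⟨h, hh⟩ := map_mul Q ⟨g, hg⟩ ⟨h, hh⟩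
      refine ⟨L.mul_mem hg hh, by rw [h1, Heis.mul_a, hga, hha, add_zero], ?_⟩
      convert I.add_mem hhI hgI using 1
      refine Prod.ext ?_ (funext fun e => ?_)
      · change flow (g * h) x₀ = flow h x₀ + flow g x₀
        rw [flow_mul, hfix h hh]
      · change q (g * h) e = q h e + q g e
        rw [hq _ hg, hq _ hh, hq _ (L.mul_mem hg hh), h1, Heis.mul_z, hga]
        simp [add_comm]
    | inv g _ ih =>
      obtain ⟨hg, hga, hgI⟩ := ih
      have h1 : Q ⟨g⁻¹, L.inv_mem hg⟩ = (Q ⟨g, hg⟩)⁻¹ := map_inv Q ⟨g, hg⟩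
      refine ⟨L.inv_mem hg, by rw [h1, Heis.inv_a, hga, neg_zero], ?_⟩
      convert I.neg_mem hgI using 1
      refine Prod.ext ?_ (funext fun e => ?_)
      · change flow g⁻¹ x₀ = -flow g x₀
        rw [flow_inv, hfix _ (L.inv_mem hg)]
      · change q g⁻¹ e = -q g e
        rw [hq _ hg, hq _ (L.inv_mem hg), h1, Heis.inv_z, hga]
        simp
  have hflowmul : ∀ g, ∀ h ∈ L, flow (g * h) x₀ = flow h x₀ + flow g x₀ := fun g h hh => by
    rw [flow_mul, hfix h hh]
  have hflowinv : ∀ g ∈ L, flow g⁻¹ x₀ = -flow g x₀ := fun g hg => by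
    rw [flow_inv, hfix _ (L.inv_mem hg)]
  have hcI : ∀ e, ((0, Pi.single e 1) : ((FreeGroup B ⧸ L) × B →₀ ℚ) × (ι → ℚ)) ∈ I := fun e => by
    obtain ⟨h1, -, h2⟩ := hSI (c e) (hC _ ⟨e, rfl⟩)
    rw [hq _ h1, hQc] at h2
    convert h2
    simp only [hc]
    rw [hflowmul _ _ (L.inv_mem (L.mul_mem (hyL _) (hyL _))),
      hflowinv _ (L.mul_mem (hyL _) (hyL _)), hflowmul _ _ (hyL _), hflowmul _ _ (hyL _)]
    abel
  have hsI : ∀ s : ι → ℚ, ((0, s) : ((FreeGroup B ⧸ L) × B →₀ ℚ) × (ι → ℚ)) ∈ I := fun s => by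
    have h1 : ((0, s) : ((FreeGroup B ⧸ L) × B →₀ ℚ) × (ι → ℚ)) =
        ∑ e, s e • (0, Pi.single e 1) := by
      refine Prod.ext ?_ ?_
      · simp [Prod.fst_sum]
      · rw [Prod.snd_sum]
        ext e
        simp [Finset.sum_apply, Pi.single_apply]
    rw [h1]
    exact I.sum_mem fun e _ => I.smul_mem _ (hcI e)
  obtain ⟨hIfin, hIle⟩ := finrank_le_card_of_le_span (le_refl I)
  set J := I.map (LinearMap.fst ℚ ((FreeGroup B ⧸ L) × B →₀ ℚ) (ι → ℚ))
  have hJ : Module.finrank ℚ J + Fintype.card ι ≤ Module.finrank ℚ I := finrank_map_fst_add_card_le hsI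
  set Y := Submodule.span ℚ (Set.range fun i => flow (y i) x₀)
  have hYfin : Module.Finite ℚ Y := Module.Finite.span_of_finite ℚ (Set.finite_range _)
  have hY : Module.finrank ℚ Y ≤ Fintype.card V := finrank_range_le_card _
  have hspan : LinearMap.ker (bdry (B := B) (X := FreeGroup B ⧸ L)) ≤ Y ⊔ J := by
    refine (ker_bdry_le_span L).trans (Submodule.span_le.2 ?_)
    rintro _ ⟨⟨g, hg⟩, rfl⟩
    simp only
    change flow g x₀ ∈ _
    induction hg using Subgroup.closure_induction with
    | mem g hg =>
      rcases hg with ⟨i, rfl⟩ | ⟨g, hg, rfl⟩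
      · exact Submodule.mem_sup_left (Submodule.subset_span ⟨i, rfl⟩)
      · exact Submodule.mem_sup_right ⟨_, hCI g hg, rfl⟩
    | one => simp
    | mul g h hg hh ihg ihh =>
      rw [hflowmul g h hh]
      exact Submodule.add_mem _ ihh ihg
    | inv g hg ih =>
      rw [hflowinv g hg]
      exact Submodule.neg_mem _ ih
  have hker : Module.Finite ℚ (LinearMap.ker (bdry (B := B) (X := FreeGroup B ⧸ L))) :=
    Submodule.finiteDimensional_of_le hspan
  have hle := (Submodule.finrank_mono hspan).trans (Submodule.finrank_add_le_finrank_add_finrank Y J)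
  obtain ⟨e₀⟩ := ‹Nonempty ι›
  obtain ⟨f, hf⟩ := exists_coeff_of_mem_span (hcI e₀)
  have hf1 : ∑ x ∈ D, f x • pathChain W M x = 0 := by
    have h1 := congrArg Prod.fst hf
    rw [Prod.fst_sum] at h1
    simp only [← flow_wordElt]
    exact h1.symm
  have := card_lt_finrank_ker_bdry hred hprim hbW hM f D
    (fun x hx => by rw [iterate_next, hDfix x hx, hM0]) hdis (by
      by_contra! h0
      rw [sum_eq_zero fun x hx => by rw [h0 x hx, zero_smul]] at hf
      have h1 := congrFun (congrArg Prod.snd hf) e₀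
      simp at h1) (by simp [hf1])
  omega

end

end

section
variable {B : Type*} {B' : Type*}

lemma exists_injective_hom_quotient (σ : FreeGroup B →* FreeGroup B') {r : FreeGroup B}
    {r' : FreeGroup B'} (h1 : σ r ∈ Subgroup.normalClosure {r'})
    (h2 : ∀ x, σ x ∈ Subgroup.normalClosure {r'} → x ∈ Subgroup.normalClosure {r}) :
    ∃ ψ : PresentedGroup ({r} : Set (FreeGroup B)) →* FreeGroup B' ⧸ Subgroup.normalClosure {r'},
      Function.Injective ψ := by
  have h3 : FreeGroup.lift (fun b => QuotientGroup.mk' (Subgroup.normalClosure {r'})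
      (σ (FreeGroup.of b))) = (QuotientGroup.mk' (Subgroup.normalClosure {r'})).comp σ :=
    FreeGroup.ext_hom _ _ fun b => by simp
  refine ⟨PresentedGroup.toGroup (f := fun b => QuotientGroup.mk' (Subgroup.normalClosure {r'})
    (σ (FreeGroup.of b))) ?_, ?_⟩
  · rintro _ rfl
    rw [h3]
    exact (QuotientGroup.eq_one_iff _).2 h1
  · rw [injective_iff_map_eq_one]
    intro a
    obtain ⟨x, rfl⟩ := PresentedGroup.mk_surjective _ a
    intro hx
    rw [PresentedGroup.mk_eq_one_iff]
    refine h2 x ((QuotientGroup.eq_one_iff _).1 ?_)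
    change (FreeGroup.lift _) x = 1 at hx
    rw [h3] at hx
    exact hx

/-- Every one-relator group embeds in one with a nonempty cyclically reduced relator. -/
lemma exists_embedding_cyclicallyReduced {B : Type} (r : FreeGroup B) :
    ∃ (B' : Type) (v : List (B' × Bool)), FreeGroup.IsCyclicallyReduced v ∧ v ≠ [] ∧
      ∃ ψ : PresentedGroup ({r} : Set (FreeGroup B)) →*
        FreeGroup B' ⧸ Subgroup.normalClosure {FreeGroup.mk v}, Function.Injective ψ := by
  classical
  obtain ⟨v, g, hvred, hr⟩ : ∃ (v : List (B × Bool)) (g : FreeGroup B),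
      FreeGroup.IsCyclicallyReduced v ∧ r = g * FreeGroup.mk v * g⁻¹ := by
    refine ⟨_, FreeGroup.mk (FreeGroup.reduceCyclically.conjugator r.toWord),
      FreeGroup.reduceCyclically.isCyclicallyReduced (FreeGroup.isReduced_toWord (x := r)), ?_⟩
    rw [FreeGroup.inv_mk, FreeGroup.mul_mk, FreeGroup.mul_mk,
      FreeGroup.reduceCyclically.conj_conjugator_reduceCyclically, FreeGroup.mk_toWord]
  by_cases hv : v = []
  · have hr1 : r = 1 := by
      rw [hr, hv, ← FreeGroup.one_eq_mk]; simp
    refine ⟨Option B, [(none, true)], by simp, by simp,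
      exists_injective_hom_quotient (FreeGroup.map some) ?_ ?_⟩
    · rw [hr1, map_one]; exact Subgroup.one_mem _
    · intro x hx
      set τ : FreeGroup (Option B) →* FreeGroup B :=
        FreeGroup.lift fun b => b.elim 1 FreeGroup.of
      have h1 : Subgroup.normalClosure {FreeGroup.mk [((none : Option B), true)]} ≤ τ.ker :=
        Subgroup.normalClosure_le_normal (by
          rintro _ rfl
          change τ (FreeGroup.of none) = 1
          simp [τ])
      have h2 : τ.comp (FreeGroup.map some) = MonoidHom.id _ :=
        FreeGroup.ext_hom _ _ fun b => by simp [τ]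
      have h3 : x = 1 := (DFunLike.congr_fun h2 x).symm.trans (h1 hx)
      rw [h3]; exact Subgroup.one_mem _
  · refine ⟨B, v, hvred, hv,
      exists_injective_hom_quotient (MonoidHom.id _) ?_ ?_⟩
    · rw [MonoidHom.id_apply, hr]
      exact Subgroup.normalClosure_normal.conj_mem _
        (Subgroup.subset_normalClosure (Set.mem_singleton _)) g
    · intro x hx
      have h1 : FreeGroup.mk v = g⁻¹ * r * g⁻¹⁻¹ := by rw [hr]; group
      have h2 : FreeGroup.mk v ∈ Subgroup.normalClosure {r} := by
        rw [h1]
        exact Subgroup.normalClosure_normal.conj_mem r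
          (Subgroup.subset_normalClosure (Set.mem_singleton r)) g⁻¹
      have h3 : Subgroup.normalClosure {FreeGroup.mk v} ≤ Subgroup.normalClosure {r} :=
        Subgroup.normalClosure_le_normal (Set.singleton_subset_iff.2 h2)
      exact h3 hx

end

/-- The homomorphism from a right-angled Artin group given by commuting images. -/
def raagLift {V G : Type*} [Group G] (Γ : SimpleGraph V) (f : V → G)
    (h : ∀ x y, Γ.Adj x y → f x * f y = f y * f x) : RAAG Γ →* G :=
  PresentedGroup.toGroup (f := f) (by
    rintro _ ⟨x, y, hxy, rfl⟩
    simp only [map_mul, map_inv, FreeGroup.lift_apply_of]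
    rw [h x y hxy, mul_inv_cancel])

@[simp] lemma raagLift_of {V G : Type*} [Group G] (Γ : SimpleGraph V) (f : V → G)
    (h : ∀ x y, Γ.Adj x y → f x * f y = f y * f x) (x : V) :
    raagLift Γ f h (PresentedGroup.of x) = f x :=
  PresentedGroup.toGroup.of _

lemma raag_of_mul_of {V : Type*} {Γ : SimpleGraph V} {x y : V} (h : Γ.Adj x y) :
    (PresentedGroup.of x * PresentedGroup.of y : RAAG Γ) =
      PresentedGroup.of y * PresentedGroup.of x :=
  PresentedGroup.mk_eq_mk_of_mul_inv_mem ⟨x, y, h, rfl⟩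

theorem isAcyclic_of_embedding {V B : Type} (Γ : SimpleGraph V) (r : FreeGroup B)
    (φ : RAAG Γ →* PresentedGroup ({r} : Set (FreeGroup B))) (hφ : Function.Injective φ) :
    Γ.IsAcyclic := by
  classical
  intro a c hc
  obtain ⟨B', v, hv, hne, ψ, hψ⟩ := exists_embedding_cyclicallyReduced r
  have hn := hc.three_le_length
  obtain ⟨n, hlen⟩ : ∃ n, c.length = n + 3 := ⟨c.length - 3, by omega⟩
  have hinj : ∀ i j : Fin (n + 3), c.getVert i = c.getVert j → i = j := fun i j h =>
    Fin.ext (hc.getVert_injOn' (by rw [Set.mem_ofPred_eq]; lia) (by rw [Set.mem_ofPred_eq]; lia) h)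
  have hadj : ∀ i : Fin (n + 3), Γ.Adj (c.getVert i) (c.getVert (i + 1 : Fin (n + 3))) := fun i => by
    have h1 := c.adj_getVert_succ (i := i) (by omega)
    rw [Fin.val_add_one]
    split_ifs with h
    · rw [h, Fin.val_last, show n + 2 + 1 = c.length by omega, c.getVert_length] at h1
      rwa [h, Fin.val_last, c.getVert_zero]
    · exact h1
  have h2 : (1 + 1 : Fin (n + 3)) ≠ 0 := by
    intro h
    have := congrArg Fin.val h
    simp only [Fin.val_add, Fin.val_one, Fin.val_zero] at this
    rw [Nat.mod_eq_of_lt (by omega)] at this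
    omega
  refine false_of_embedding (V := Fin (n + 3)) (ι := Fin (n + 3)) le_rfl id (· + 1)
    (fun e e' h _ => h) (fun e e' ⟨h, h'⟩ => h2 ?_) (fun i => (PresentedGroup.of (c.getVert i) : RAAG Γ))
    (raagLift Γ (fun u => Multiplicative.ofAdd fun i => if c.getVert i = u then 1 else 0)
      fun _ _ _ => mul_comm _ _) (fun i => ?_) (fun e => raag_of_mul_of (hadj e)) hv hne
    (ψ.comp φ) (hψ.comp hφ)
  · simp only [id] at h h'
    rw [← h] at h'
    rw [add_assoc] at h'
    exact left_eq_add.1 h'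
  · rw [raagLift_of]
    congr 1
    ext j
    rw [Pi.single_apply]
    exact if_congr ⟨hinj j i, fun h => by rw [h]⟩ rfl rfl

section
variable {J : Type*}

/-- The element of a one-relator group represented by a positive word. -/
def posElt {rels : Set (FreeGroup J)} (γ : List J) : PresentedGroup rels :=
  (γ.map PresentedGroup.of).prod

lemma mk_map_true (γ : List J) :
    FreeGroup.mk (γ.map fun j => (j, true)) = (γ.map FreeGroup.of).prod := by
  induction γ with
  | nil => rfl
  | cons j γ ih =>
    rw [List.map_cons, List.map_cons, List.prod_cons, ← ih, FreeGroup.of, FreeGroup.mul_mk]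
    rfl

lemma posElt_eq_mk {rels : Set (FreeGroup J)} (γ : List J) :
    (posElt γ : PresentedGroup rels) =
      PresentedGroup.mk rels (FreeGroup.mk (γ.map fun j => (j, true))) := by
  rw [mk_map_true, map_list_prod, List.map_map]
  rfl

lemma isReduced_map_true (γ : List J) : FreeGroup.IsReduced (γ.map fun j => (j, true)) :=
  List.Pairwise.isChain (List.pairwise_of_forall_mem_list (by simp))

lemma isCyclicallyReduced_map_true (γ : List J) :
    FreeGroup.IsCyclicallyReduced (γ.map fun j => (j, true)) :=
  ⟨isReduced_map_true γ, by
    intro a ha b hb _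
    have h1 := List.mem_of_mem_getLast? ha
    have h2 := List.mem_of_mem_head? hb
    simp only [List.mem_map] at h1 h2
    obtain ⟨_, _, rfl⟩ := h1
    obtain ⟨_, _, rfl⟩ := h2
    rfl⟩

/-- In a positive one-relator group, positive words omitting a letter of the relator
are determined by the element they represent. -/
theorem eq_of_posElt_eq {w : List J} {i : J} (hi : i ∈ w) {γ γ' : List J} (hγ : i ∉ γ)
    (hγ' : i ∉ γ')
    (h : (posElt γ : PresentedGroup ({(w.map FreeGroup.of).prod} : Set (FreeGroup J))) = posElt γ') :
    γ = γ' := by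
  classical
  rw [posElt_eq_mk, posElt_eq_mk, ← mul_inv_eq_one, ← map_inv, ← map_mul, FreeGroup.inv_mk,
    FreeGroup.mul_mk, PresentedGroup.mk_eq_one_iff, ← mk_map_true] at h
  have h1 := freiheitssatz (isCyclicallyReduced_map_true w) (b := i)
    ⟨(i, true), List.mem_map_of_mem hi, rfl⟩ (by
      intro a ha hai
      simp only [FreeGroup.invRev, List.mem_append, List.mem_reverse, List.mem_map] at ha
      subst hai
      rcases ha with ⟨b, hb, rfl⟩ | ⟨_, ⟨b, hb, rfl⟩, rfl⟩
      · exact hγ hb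
      · exact hγ' hb) h
  rw [← FreeGroup.mul_mk, ← FreeGroup.inv_mk, mul_inv_eq_one] at h1
  have h2 := congrArg FreeGroup.toWord h1
  rw [FreeGroup.toWord_mk, FreeGroup.toWord_mk,
    FreeGroup.isReduced_iff_reduce_eq.1 (isReduced_map_true γ),
    FreeGroup.isReduced_iff_reduce_eq.1 (isReduced_map_true γ')] at h2
  exact List.map_injective_iff.2 (fun a b h => congrArg Prod.fst h) h2

end

section
variable {A J U : Type*} [Group U]

/-- Left multiplication on stack states. -/
def lmul (u : U) : List (U × A) × U → List (U × A) × U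
  | ([], g) => ([], u * g)
  | ((h, a) :: L, g) => ((u * h, a) :: L, g)

@[simp] lemma lmul_nil (u g : U) : lmul u (([] : List (U × A)), g) = ([], u * g) := rfl
@[simp] lemma lmul_cons (u g h : U) (a : A) (L : List (U × A)) :
    lmul u ((h, a) :: L, g) = ((u * h, a) :: L, g) := rfl

lemma lmul_lmul (u v : U) (s : List (U × A) × U) : lmul u (lmul v s) = lmul (u * v) s := by
  rcases s with ⟨_ | ⟨⟨h, a⟩, L⟩, g⟩ <;> simp [mul_assoc]

@[simp] lemma lmul_one (s : List (U × A) × U) : lmul 1 s = s := by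
  rcases s with ⟨_ | ⟨⟨h, a⟩, L⟩, g⟩ <;> simp

open Classical in
/-- Pushing a letter on a stack state, contracting a completed piece. -/
noncomputable def push (c : J → A) (T : J → List (U × A)) (b : J → U) (a : A)
    (s : List (U × A) × U) : List (U × A) × U :=
  if h : ∃ j, c j = a ∧ T j <+: s.1 then
    lmul (b h.choose) (s.1.drop (T h.choose).length, s.2)
  else ((1, a) :: s.1, s.2)

variable {c : J → A} {T : J → List (U × A)} {b : J → U}

lemma push_of_not {a : A} {s : List (U × A) × U} (h : ∀ j, c j = a → ¬ T j <+: s.1) :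
    push c T b a s = ((1, a) :: s.1, s.2) := by
  rw [push, dif_neg]
  rintro ⟨j, h1, h2⟩
  exact h j h1 h2

lemma push_of_match (hT : ∀ i j, c i = c j → T i <+: T j → i = j) (j : J) (L : List (U × A))
    (g : U) : push c T b (c j) (T j ++ L, g) = lmul (b j) (L, g) := by
  have h : ∃ i, c i = c j ∧ T i <+: (T j ++ L, g).1 := ⟨j, rfl, List.prefix_append _ _⟩
  have h1 : h.choose = j := by
    obtain ⟨h2, h3⟩ := h.choose_spec
    rcases List.prefix_or_prefix_of_prefix h3 (List.prefix_append (T j) L) with h4 | h4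
    · exact hT _ _ h2 h4
    · exact (hT _ _ h2.symm h4).symm
  rw [push, dif_pos h, h1]
  simp

lemma push_cases (c : J → A) (T : J → List (U × A)) (b : J → U) (a : A)
    (s : List (U × A) × U) :
    (∃ j L, c j = a ∧ s.1 = T j ++ L ∧ push c T b a s = lmul (b j) (L, s.2)) ∨
      (∀ j, c j = a → ¬ T j <+: s.1) ∧ push c T b a s = ((1, a) :: s.1, s.2) := by
  by_cases h : ∃ j, c j = a ∧ T j <+: s.1
  · obtain ⟨h2, L, h3⟩ := h.choose_spec
    refine Or.inl ⟨h.choose, L, h2, h3.symm, ?_⟩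
    have h4 : s.1.drop (T h.choose).length = L :=
      (congrArg (List.drop (T h.choose).length) h3).symm.trans List.drop_left
    rw [push, dif_pos h, h4]
  · have h1 : ∀ j, c j = a → ¬ T j <+: s.1 := fun j h1 h2 => h ⟨j, h1, h2⟩
    exact Or.inr ⟨h1, push_of_not h1⟩

/-- A stack in which no letter completes a piece with the letters following it. -/
def StackReduced (c : J → A) (T : J → List (U × A)) (L : List (U × A)) : Prop :=
  ∀ X h a R, L = X ++ (h, a) :: R → ∀ i, c i = a → ¬ T i <+: R

lemma StackReduced.lmul {L : List (U × A)} (hL : StackReduced c T L) (u g : U) :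
    StackReduced c T (lmul u (L, g)).1 := by
  rcases L with _ | ⟨⟨h, a⟩, L⟩
  · exact hL
  · intro X h' a' R hX
    rcases X with _ | ⟨x, X⟩
    · obtain ⟨h1, rfl⟩ := List.cons_eq_cons.1 hX
      obtain ⟨-, rfl⟩ := Prod.ext_iff.1 h1
      exact hL [] h a L rfl
    · obtain ⟨h1, h2⟩ := List.cons_eq_cons.1 hX
      exact hL ((h, a) :: X) h' a' R (by rw [h2]; rfl)

lemma StackReduced.push {s : List (U × A) × U} (hs : StackReduced c T s.1) (a : A) :
    StackReduced c T (push c T b a s).1 := by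
  rcases push_cases c T b a s with ⟨j, L, -, h1, h2⟩ | ⟨h1, h2⟩
  · rw [h2]
    refine StackReduced.lmul (fun X h a R hX => ?_) _ _
    exact hs (T j ++ X) h a R (by rw [h1, hX, List.append_assoc])
  · rw [h2]
    intro X h a' R hX
    rcases X with _ | ⟨x, X⟩
    · obtain ⟨h3, rfl⟩ := List.cons_eq_cons.1 hX
      obtain ⟨-, rfl⟩ := Prod.ext_iff.1 h3
      exact h1
    · obtain ⟨h3, h4⟩ := List.cons_eq_cons.1 hX
      exact hs X h a' R h4

end

lemma isUnit_of_mul_eq_one {M : Type*} [Monoid M] {s y z : M} (hl : y * s = 1) (hr : s * z = 1) :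
    IsUnit s :=
  ⟨⟨s, y, by rwa [left_inv_eq_right_inv hl hr], hl⟩, rfl⟩

section
variable {A J U : Type*} [Group U]

/-- The word spelled by a list of blocks, each a list of pieces followed by a letter. -/
def expand (val : J → List A) (B : List (List J × A)) : List A :=
  B.flatMap fun x => (x.1.map val).flatten ++ [x.2]

@[simp] lemma expand_nil (val : J → List A) : expand val [] = [] := rfl

lemma expand_cons (val : J → List A) (x : List J × A) (B : List (List J × A)) :
    expand val (x :: B) = (x.1.map val).flatten ++ x.2 :: expand val B := by
  simp [expand]

lemma expand_append (val : J → List A) (B B' : List (List J × A)) :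
    expand val (B ++ B') = expand val B ++ expand val B' := by
  simp [expand]

lemma length_le_length_expand (val : J → List A) (B : List (List J × A)) :
    B.length ≤ (expand val B).length := by
  induction B with
  | nil => simp
  | cons x B ih => rw [expand_cons]; simp; omega

/-- The stack entry of a block. -/
def blk (b : J → U) (x : List J × A) : U × A := ((x.1.map b).prod, x.2)

/-- The stack of a piece. -/
abbrev stk (b : J → U) (B : J → List (List J × A)) (j : J) : List (U × A) := (B j).map (blk b)

/-- The overlap conditions making the stack machine work. -/
structure Admissible (c : J → A) (B : J → List (List J × A)) (b : J → U) (val : J → List A) :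
    Prop where
  val_eq : ∀ j, val j = c j :: expand val (B j)
  length_lt : ∀ j, ∀ x ∈ B j, ∀ p ∈ x.1, (val p).length < (val j).length
  not_prefix : ∀ i j X γ Y, B j = X ++ (γ, c i) :: Y →
    ¬ stk b B i <+: Y.map (blk b) ∧ ¬ Y.map (blk b) <+: stk b B i
  eq_of_prefix : ∀ i j, c i = c j → stk b B i <+: stk b B j → i = j

variable {c : J → A} {B : J → List (List J × A)} {b : J → U} {val : J → List A}

/-- The action of a word on stack states. -/
noncomputable def actw (c : J → A) (B : J → List (List J × A)) (b : J → U) (l : List A)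
    (s : List (U × A) × U) : List (U × A) × U :=
  l.foldr (push c (stk b B) b) s

lemma actw_append (l l' : List A) (s : List (U × A) × U) :
    actw c B b (l ++ l') s = actw c B b l (actw c B b l' s) :=
  List.foldr_append

lemma actw_cons (a : A) (l : List A) (s : List (U × A) × U) :
    actw c B b (a :: l) s = push c (stk b B) b a (actw c B b l s) := rfl

lemma actw_flatten (γ : List J) (h : ∀ p ∈ γ, ∀ s, actw c B b (val p) s = lmul (b p) s)
    (s : List (U × A) × U) :
    actw c B b (γ.map val).flatten s = lmul (γ.map b).prod s := by
  induction γ with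
  | nil => simp [actw]
  | cons p γ ih =>
    rw [List.map_cons, List.flatten_cons, actw_append, ih fun q hq => h q (List.mem_cons_of_mem _ hq),
      h p List.mem_cons_self, lmul_lmul, List.map_cons, List.prod_cons]

lemma Admissible.actw_val (H : Admissible c B b val) (N : ℕ) :
    ∀ j, (val j).length ≤ N → ∀ s, actw c B b (val j) s = lmul (b j) s := by
  induction N with
  | zero =>
    intro j hj
    rw [H.val_eq] at hj
    simp at hj
  | succ N ih =>
    intro j hj s
    have key : ∀ Y X, B j = X ++ Y →
        actw c B b (expand val Y) s = (Y.map (blk b) ++ s.1, s.2) := by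
      intro Y
      induction Y with
      | nil => intro X _; rfl
      | cons x Y ihY =>
        intro X hX
        obtain ⟨γ, a⟩ := x
        rw [expand_cons, actw_append, actw_cons, ihY (X ++ [(γ, a)]) (by rw [hX]; simp),
          push_of_not, actw_flatten]
        · simp [blk]
        · intro p hp s
          refine ih p ?_ s
          have := H.length_lt j (γ, a) (by rw [hX]; simp) p hp
          omega
        · intro i hi hpre
          subst hi
          obtain ⟨h1, h2⟩ := H.not_prefix i j X γ Y hX
          rcases List.prefix_or_prefix_of_prefix hpre (List.prefix_append _ _) with h | h
          · exact h1 h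
          · exact h2 h
    rw [H.val_eq, actw_cons, key (B j) [] rfl, push_of_match H.eq_of_prefix]

lemma stackReduced_actw (l : List A) {s : List (U × A) × U}
    (hs : StackReduced c (stk b B) s.1) : StackReduced c (stk b B) (actw c B b l s).1 := by
  induction l with
  | nil => exact hs
  | cons a l ih => exact ih.push a

variable {M : Type*} [Monoid M] (m : FreeMonoid A →* M) (ψ : U →* M)

/-- The monoid element represented by a stack. -/
def stackVal (L : List (U × A)) : M := (L.map fun x => ψ x.1 * m (FreeMonoid.of x.2)).prod

lemma stackVal_nil : stackVal m ψ [] = 1 := rfl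

lemma stackVal_cons (x : U × A) (L : List (U × A)) :
    stackVal m ψ (x :: L) = ψ x.1 * m (FreeMonoid.of x.2) * stackVal m ψ L := by
  simp [stackVal]

lemma stackVal_append (L L' : List (U × A)) :
    stackVal m ψ (L ++ L') = stackVal m ψ L * stackVal m ψ L' := by
  simp [stackVal]

/-- The monoid element represented by a stack state. -/
def stateVal (s : List (U × A) × U) : M := stackVal m ψ s.1 * ψ s.2

lemma stateVal_lmul (u : U) (s : List (U × A) × U) :
    stateVal m ψ (lmul u s) = ψ u * stateVal m ψ s := by
  rcases s with ⟨_ | ⟨⟨h, a⟩, L⟩, g⟩ <;>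
    simp [stateVal, stackVal_nil, stackVal_cons, mul_assoc]

lemma map_ofList_cons (a : A) (l : List A) :
    m (FreeMonoid.ofList (a :: l)) = m (FreeMonoid.of a) * m (FreeMonoid.ofList l) := by
  rw [← map_mul]; rfl

lemma map_ofList_append (l l' : List A) :
    m (FreeMonoid.ofList (l ++ l')) = m (FreeMonoid.ofList l) * m (FreeMonoid.ofList l') := by
  rw [← map_mul]; rfl

lemma map_ofList_flatten (hψ : ∀ j, ψ (b j) = m (FreeMonoid.ofList (val j))) (γ : List J) :
    m (FreeMonoid.ofList (γ.map val).flatten) = ψ (γ.map b).prod := by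
  induction γ with
  | nil => simp
  | cons j γ ih =>
    rw [List.map_cons, List.flatten_cons, map_ofList_append, ih, ← hψ, List.map_cons, List.prod_cons,
      map_mul]

lemma stackVal_map_blk (hψ : ∀ j, ψ (b j) = m (FreeMonoid.ofList (val j)))
    (Y : List (List J × A)) :
    stackVal m ψ (Y.map (blk b)) = m (FreeMonoid.ofList (expand val Y)) := by
  induction Y with
  | nil => simp [stackVal_nil]
  | cons x Y ih =>
    rw [expand_cons, List.map_cons, stackVal_cons, ih, map_ofList_append, map_ofList_cons,
      map_ofList_flatten m ψ hψ, mul_assoc]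
    rfl

lemma stateVal_push (H : Admissible c B b val) (hψ : ∀ j, ψ (b j) = m (FreeMonoid.ofList (val j)))
    (a : A) (s : List (U × A) × U) :
    stateVal m ψ (push c (stk b B) b a s) = m (FreeMonoid.of a) * stateVal m ψ s := by
  rcases push_cases c (stk b B) b a s with ⟨j, L, rfl, h2, h3⟩ | ⟨-, h⟩
  · rw [h3, stateVal_lmul, hψ, H.val_eq, map_ofList_cons, ← stackVal_map_blk m ψ hψ, stateVal,
      stateVal, h2, stackVal_append]
    simp only [mul_assoc]
  · rw [h, stateVal, stateVal, stackVal_cons]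
    simp [mul_assoc]

lemma stateVal_actw (H : Admissible c B b val) (hψ : ∀ j, ψ (b j) = m (FreeMonoid.ofList (val j)))
    (l : List A) (s : List (U × A) × U) :
    stateVal m ψ (actw c B b l s) = m (FreeMonoid.ofList l) * stateVal m ψ s := by
  induction l with
  | nil => simp [actw]
  | cons a l ih => rw [actw_cons, stateVal_push m ψ H hψ, ih, map_ofList_cons, mul_assoc]

/-- If the stack machine respects the relations of `M`, then the pieces generate the unit group
and `U` maps isomorphically to it. -/
theorem Admissible.exists_units_equiv (H : Admissible c B b val)
    (hψ : ∀ j, ψ (b j) = m (FreeMonoid.ofList (val j)))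
    (hm : Function.Surjective m) (ρ : M →* Function.End (List (U × A) × U))
    (hρ : ∀ l s, ρ (m (FreeMonoid.ofList l)) s = actw c B b l s)
    (hb : Subgroup.closure (Set.range b) = ⊤)
    (hpiece : ∀ j q, q <+: val j → q ≠ [] → IsUnit (m (FreeMonoid.ofList q)) → q = val j) :
    Nonempty (U ≃* Mˣ) := by
  have hρmul : ∀ x y s, ρ (x * y) s = ρ x (ρ y s) := fun x y s => by rw [map_mul]; rfl
  have hρone : ∀ s, ρ 1 s = s := fun s => by rw [map_one]; rfl
  have hρψ : ∀ u s, ρ (ψ u) s = lmul u s := by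
    intro u
    have hu : u ∈ Subgroup.closure (Set.range b) := by rw [hb]; trivial
    induction hu using Subgroup.closure_induction with
    | mem u hu =>
      obtain ⟨j, rfl⟩ := hu
      intro s
      rw [hψ, hρ, H.actw_val _ j le_rfl]
    | one => intro s; rw [map_one, hρone, lmul_one]
    | mul x y _ _ hx hy => intro s; rw [map_mul, hρmul, hy, hx, lmul_lmul]
    | inv x _ hx =>
      intro s
      have h1 : s = ρ (ψ x) (lmul x⁻¹ s) := by rw [hx, lmul_lmul, mul_inv_cancel, lmul_one]
      conv_lhs => rw [h1]
      rw [← hρmul, ← map_mul, inv_mul_cancel, map_one, hρone]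
  have hval : ∀ x, stateVal m ψ (ρ x ([], 1)) = x := by
    intro x
    obtain ⟨l, rfl⟩ := hm x
    have := hρ (FreeMonoid.toList l) ([], 1)
    rw [FreeMonoid.ofList_toList] at this
    rw [this, stateVal_actw m ψ H hψ]
    simp [stateVal, stackVal_nil]
  have hred : ∀ x, StackReduced c (stk b B) (ρ x ([], 1)).1 := by
    intro x
    obtain ⟨l, rfl⟩ := hm x
    have := hρ (FreeMonoid.toList l) ([], 1)
    rw [FreeMonoid.ofList_toList] at this
    rw [this]
    exact stackReduced_actw _ (fun X h a R hX => by simp at hX)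
  have hunit : ∀ u : Mˣ, (ρ u ([], 1)).1 = [] := by
    intro u
    rcases hLg : ρ u ([], 1) with ⟨L, g⟩
    have hL : StackReduced c (stk b B) L := by have := hred u; rwa [hLg] at this
    have hu : (u : M) = stackVal m ψ L * ψ g := by
      have := hval u; rw [hLg] at this; exact this.symm
    rcases hs : lmul g (ρ (u⁻¹ : Mˣ) ([], 1)) with ⟨L', g'⟩
    have key : ∀ R X, L = X ++ R → ρ (stackVal m ψ R) (L', g') = (R ++ L', g') := by
      intro R
      induction R with
      | nil => intro X _; rw [stackVal_nil, hρone]; rfl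
      | cons x R ih =>
        intro X hX
        obtain ⟨h, a⟩ := x
        have hma : ∀ s, ρ (m (FreeMonoid.of a)) s = push c (stk b B) b a s := fun s => hρ [a] s
        rw [stackVal_cons, hρmul, hρmul, hρψ, ih (X ++ [(h, a)]) (by rw [hX]; simp), hma]
        rcases push_cases c (stk b B) b a (R ++ L', g') with ⟨j, Q, h1, h2, -⟩ | ⟨-, h1⟩
        · exfalso
          have h3 : ¬ stk b B j <+: R := hL X h a R hX j h1
          obtain ⟨Z, hZ⟩ : R <+: stk b B j :=
            (List.prefix_or_prefix_of_prefix ⟨Q, h2.symm⟩ (List.prefix_append R L')).resolve_left h3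
          obtain ⟨R', Z', hB, hR', rfl⟩ := List.map_eq_append_iff.1 hZ.symm
          have hZ' : Z' ≠ [] := by
            rintro rfl
            exact h3 ⟨[], by rw [← hZ]; simp⟩
          have hv : val j = (c j :: expand val R') ++ expand val Z' := by
            rw [H.val_eq, hB, expand_append]; rfl
          have hmv : IsUnit (m (FreeMonoid.ofList (val j))) := by
            rw [← hψ]; exact (Group.isUnit (b j)).map ψ
          have hs1 : m (FreeMonoid.ofList (c j :: expand val R')) =
              m (FreeMonoid.of a) * stackVal m ψ R := by
            rw [map_ofList_cons, ← stackVal_map_blk m ψ hψ, hR', h1]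
          obtain ⟨t, ht⟩ := hmv
          have h4 := hpiece j _ ⟨_, hv.symm⟩ (List.cons_ne_nil _ _) (isUnit_of_mul_eq_one
            (y := ψ g * ↑u⁻¹ * (stackVal m ψ X * ψ h)) (z := m (FreeMonoid.ofList (expand val Z')) * ↑t⁻¹)
            (by
              have h5 : (u : M) = (stackVal m ψ X * ψ h) * (m (FreeMonoid.of a) * stackVal m ψ R)
                  * ψ g := by
                rw [hu, hX, stackVal_append, stackVal_cons]; simp only [mul_assoc]
              have h6 : (stackVal m ψ X * ψ h) * (m (FreeMonoid.of a) * stackVal m ψ R) =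
                  u * ψ g⁻¹ := by
                rw [h5, mul_assoc _ (ψ g), ← map_mul, mul_inv_cancel, map_one, mul_one]
              rw [hs1, mul_assoc, h6, mul_assoc, Units.inv_mul_cancel_left, ← map_mul,
                mul_inv_cancel, map_one])
            (by rw [← mul_assoc, ← map_ofList_append, ← hv, ← ht, Units.mul_inv]))
          rw [hv] at h4
          have h5 : expand val Z' = [] := List.self_eq_append_right.1 h4
          have h6 := length_le_length_expand val Z'
          rw [h5] at h6
          exact hZ' (List.length_eq_zero_iff.1 (Nat.le_zero.1 h6))
        · rw [h1]; simp
    have h1 := key L [] rfl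
    have h2 : ρ (stackVal m ψ L) (L', g') = ([], 1) := by
      rw [← hs, ← hρψ, ← hρmul, ← hρmul, ← hu, Units.mul_inv, hρone]
    rw [h1] at h2
    exact (List.append_eq_nil_iff.1 (congrArg Prod.fst h2)).1
  refine ⟨MulEquiv.ofBijective ψ.toHomUnits ⟨?_, ?_⟩⟩
  · intro x y hxy
    have h1 : ψ x = ψ y := congrArg Units.val hxy
    have h2 := hρψ x ([], 1)
    rw [h1, hρψ] at h2
    simpa using (congrArg Prod.snd h2).symm
  · intro u
    refine ⟨(ρ u ([], 1)).2, Units.ext ?_⟩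
    have := hval u
    rw [stateVal, hunit u, stackVal_nil, one_mul] at this
    exact this

end

section
variable {A M : Type*} [Monoid M] (m : FreeMonoid A →* M)

/-- A minimal invertible word. -/
def IsPiece (p : List A) : Prop :=
  p ≠ [] ∧ IsUnit (m (FreeMonoid.ofList p)) ∧
    ∀ q, q <+: p → q ≠ [] → IsUnit (m (FreeMonoid.ofList q)) → q = p

variable {m}

lemma isUnit_right_of_append {p q : List A} (hp : IsUnit (m (FreeMonoid.ofList p)))
    (h : IsUnit (m (FreeMonoid.ofList (p ++ q)))) : IsUnit (m (FreeMonoid.ofList q)) := by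
  obtain ⟨u, hu⟩ := hp
  rwa [map_ofList_append, ← hu, Units.isUnit_units_mul] at h

lemma isUnit_left_of_append {p q : List A} (hq : IsUnit (m (FreeMonoid.ofList q)))
    (h : IsUnit (m (FreeMonoid.ofList (p ++ q)))) : IsUnit (m (FreeMonoid.ofList p)) := by
  obtain ⟨u, hu⟩ := hq
  rwa [map_ofList_append, ← hu, Units.isUnit_mul_units] at h

/-- A piece has no proper nonempty invertible suffix. -/
lemma IsPiece.eq_nil_of_append {p q : List A} (h : IsPiece m (p ++ q)) (hq : q ≠ [])
    (hu : IsUnit (m (FreeMonoid.ofList q))) : p = [] := by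
  by_contra hp
  have := h.2.2 p (List.prefix_append _ _) hp (isUnit_left_of_append hu h.2.1)
  exact hq (List.self_eq_append_right.1 this)

lemma exists_pieces (N : ℕ) : ∀ l : List A, l.length ≤ N → IsUnit (m (FreeMonoid.ofList l)) →
    ∃ ps : List (List A), ps.flatten = l ∧ ∀ p ∈ ps, IsPiece m p := by
  classical
  induction N with
  | zero =>
    intro l hl _
    exact ⟨[], (List.length_eq_zero_iff.1 (Nat.le_zero.1 hl)).symm, by simp⟩
  | succ N ih =>
    intro l hl hu
    by_cases hne : l = []
    · exact ⟨[], hne.symm, by simp⟩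
    have hex : ∃ n, ∃ p, p <+: l ∧ p ≠ [] ∧ IsUnit (m (FreeMonoid.ofList p)) ∧ p.length = n :=
      ⟨_, l, List.prefix_rfl, hne, hu, rfl⟩
    obtain ⟨p, ⟨q, rfl⟩, hp0, hpu, hpn⟩ := Nat.find_spec hex
    have hp : IsPiece m p := by
      refine ⟨hp0, hpu, fun q' hq' hq0 hqu => hq'.eq_of_length_le ?_⟩
      rw [hpn]
      exact Nat.find_min' hex ⟨q', hq'.trans (List.prefix_append _ _), hq0, hqu, rfl⟩
    have hpos := List.length_pos_of_ne_nil hp0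
    obtain ⟨ps, rfl, hps⟩ := ih q (by simp at hl; omega) (isUnit_right_of_append hpu hu)
    exact ⟨p :: ps, rfl, by simpa using ⟨hp, hps⟩⟩

end

section
variable {A J : Type*}

lemma prefix_of_map_prefix {α β : Type*} (f : α → β) : ∀ {P Q : List α},
    (∀ x ∈ P, ∀ y ∈ Q, f x = f y → x = y) → P.map f <+: Q.map f → P <+: Q
  | [], _, _, _ => List.nil_prefix
  | _ :: _, [], _, h => by simp at h
  | x :: P, y :: Q, hf, h => by
    rw [List.map_cons, List.map_cons, List.cons_prefix_cons] at h
    rw [List.cons_prefix_cons]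
    exact ⟨hf x (by simp) y (by simp) h.1, prefix_of_map_prefix f
      (fun x hx y hy => hf x (List.mem_cons_of_mem _ hx) y (List.mem_cons_of_mem _ hy)) h.2⟩

lemma exists_minimal_blocks (val : J → List A) (hval : ∀ j, val j ≠ []) :
    ∃ (c : J → A) (B : J → List (List J × A)), ∀ j, val j = c j :: expand val (B j) ∧
      ∀ c' B', val j = c' :: expand val B' → (B j).length ≤ B'.length := by
  classical
  have hexp : ∀ l : List A, expand val (l.map fun a => ([], a)) = l := by
    intro l
    induction l with
    | nil => rfl
    | cons a l ih => rw [List.map_cons, expand_cons, ih]; rfl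
  have hex : ∀ j, ∃ n c, ∃ B : List (List J × A), val j = c :: expand val B ∧ B.length = n := fun j => by
    obtain ⟨a, l, h⟩ := List.exists_cons_of_ne_nil (hval j)
    exact ⟨_, a, _, by rw [hexp, h], rfl⟩
  choose c B hB hn using fun j => Nat.find_spec (hex j)
  exact ⟨c, B, fun j => ⟨hB j, fun c' B' h => by
    rw [hn]; exact Nat.find_min' (hex j) ⟨c', B', h, rfl⟩⟩⟩

lemma length_le_of_mem_expand {val : J → List A} {Y : List (List J × A)} {x : List J × A}
    (hx : x ∈ Y) {p : J} (hp : p ∈ x.1) : (val p).length ≤ (expand val Y).length := by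
  induction Y with
  | nil => simp at hx
  | cons y Y ih =>
    rw [expand_cons]
    rcases List.mem_cons.1 hx with rfl | hx
    · have := (List.sublist_flatten_of_mem (List.mem_map_of_mem (f := val) hp)).length_le
      rw [List.length_append]
      omega
    · have := ih hx
      rw [List.length_append, List.length_cons]
      omega

theorem admissible_of_pieces {M : Type*} [Monoid M] {m : FreeMonoid A →* M} {val : J → List A}
    (hval : ∀ j, IsPiece m (val j)) (hinj : Function.Injective val) {w : List J} (hw : ∀ j, j ∈ w)
    {c : J → A} {B : J → List (List J × A)} (hcB : ∀ j, val j = c j :: expand val (B j) ∧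
      ∀ c' B', val j = c' :: expand val B' → (B j).length ≤ B'.length) :
    Admissible c B
      (PresentedGroup.of : J → PresentedGroup ({(w.map FreeGroup.of).prod} : Set (FreeGroup J))) val := by
  set b : J → PresentedGroup ({(w.map FreeGroup.of).prod} : Set (FreeGroup J)) := PresentedGroup.of
  have hlt : ∀ j, ∀ x ∈ B j, ∀ p ∈ x.1, (val p).length < (val j).length := fun j x hx p hp => by
    have h1 := length_le_of_mem_expand (val := val) hx hp
    have h2 := congrArg List.length (hcB j).1
    rw [List.length_cons] at h2
    omega
  have hblk : ∀ i j, ∀ x ∈ B i, ∀ y ∈ B j, blk b x = blk b y → x = y := by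
    intro i j x hx y hy h
    have h1 : ∃ n, n ∉ x.1 ∧ n ∉ y.1 := by
      rcases le_total (val i).length (val j).length with h | h
      · exact ⟨j, fun hj => by have := hlt i x hx j hj; omega,
          fun hj => by have := hlt j y hy j hj; omega⟩
      · exact ⟨i, fun hj => by have := hlt i x hx i hj; omega,
          fun hj => by have := hlt j y hy i hj; omega⟩
    obtain ⟨n, hnx, hny⟩ := h1
    exact Prod.ext (eq_of_posElt_eq (hw n) hnx hny (congrArg Prod.fst h)) (congrArg (·.2) h)
  refine ⟨fun j => (hcB j).1, hlt, ?_, ?_⟩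
  · intro i j X γ Y hX
    have hYmem : ∀ y ∈ Y, y ∈ B j := fun y hy => by rw [hX]; simp [hy]
    have hvj : val j = (c j :: (expand val X ++ (γ.map val).flatten)) ++ c i :: expand val Y := by
      rw [(hcB j).1, hX, expand_append, expand_cons]; simp
    have hu2 : ¬ IsUnit (m (FreeMonoid.ofList (c i :: expand val Y))) := fun h => by
      have h1 := hval j
      rw [hvj] at h1
      exact List.cons_ne_nil _ _ (h1.eq_nil_of_append (List.cons_ne_nil _ _) h)
    constructor
    · intro h
      obtain ⟨Z, rfl⟩ := prefix_of_map_prefix _ (fun x hx y hy => hblk i j x hx y (hYmem y hy)) h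
      rw [expand_append, ← List.cons_append, ← (hcB i).1] at hu2
      rcases Z with _ | ⟨⟨δ, d⟩, Z⟩
      · rw [expand_nil, List.append_nil] at hu2
        exact hu2 (hval i).2.1
      · have h1 := (hcB j).2 (c j) (X ++ (γ ++ i :: δ, d) :: Z) (by
          rw [(hcB j).1, hX, expand_append, expand_append, expand_cons, expand_cons, expand_append,
            expand_cons]
          simp [(hcB i).1])
        rw [hX] at h1
        simp only [List.length_append, List.length_cons] at h1
        omega
    · intro h
      obtain ⟨Z, hZ⟩ := prefix_of_map_prefix _ (fun x hx y hy => hblk j i x (hYmem x hx) y hy) h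
      have hvi : val i = (c i :: expand val Y) ++ expand val Z := by
        rw [(hcB i).1, ← hZ, expand_append]; rfl
      obtain ⟨s, hs⟩ := (hval i).2.1
      obtain ⟨t, ht⟩ := (hval j).2.1
      rw [hvi, map_ofList_append] at hs
      rw [hvj, map_ofList_append] at ht
      refine hu2 (isUnit_of_mul_eq_one
        (y := ↑t⁻¹ * m (FreeMonoid.ofList (c j :: (expand val X ++ (γ.map val).flatten))))
        (z := m (FreeMonoid.ofList (expand val Z)) * ↑s⁻¹) ?_ ?_)
      · rw [mul_assoc, ← ht, Units.inv_mul]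
      · rw [← mul_assoc, ← hs, Units.mul_inv]
  · intro i j hc h
    obtain ⟨Z, hZ⟩ := prefix_of_map_prefix _ (hblk i j) h
    refine hinj ((hval j).2.2 _ ?_ (hval i).1 (hval i).2.1)
    rw [(hcB i).1, (hcB j).1, ← hZ, expand_append, hc]
    exact List.prefix_append (c j :: expand val (B i)) _

end

/-- The group of units of a special one-relation monoid is a positive one-relator group. -/
theorem exists_units_equiv {k : ℕ} (w : List (Fin k)) : ∃ (n : ℕ) (w' : List (Fin n)),
    Nonempty ((OneRelMonoid w [])ˣ ≃*
      PresentedGroup ({(w'.map FreeGroup.of).prod} : Set (FreeGroup (Fin n)))) := by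
  classical
  set rel : FreeMonoid (Fin k) → FreeMonoid (Fin k) → Prop :=
    fun x y => x = FreeMonoid.ofList w ∧ y = FreeMonoid.ofList []
  set m := PresentedMonoid.mk rel
  have hmw : m (FreeMonoid.ofList w) = 1 := PresentedMonoid.mk_eq_mk_of_rel ⟨rfl, rfl⟩
  obtain ⟨ps, hw, hps⟩ := exists_pieces (m := m) _ w le_rfl (by rw [hmw]; exact isUnit_one)
  set J := {p // p ∈ ps}
  set val : J → List (Fin k) := Subtype.val
  set wJ : List J := ps.attach
  have hwJ : (wJ.map val).flatten = w := by
    rw [← hw]; exact congrArg List.flatten (List.attach_map_subtype_val ps)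
  have hval : ∀ j : J, IsPiece m (val j) := fun j => hps _ j.2
  obtain ⟨c, B, hcB⟩ := exists_minimal_blocks val fun j => (hval j).1
  have H := admissible_of_pieces hval Subtype.val_injective (List.mem_attach ps) hcB
  set b : J → PresentedGroup ({(wJ.map FreeGroup.of).prod} : Set (FreeGroup J)) := PresentedGroup.of
  have hbw : (wJ.map b).prod = 1 := by
    have h := PresentedGroup.one_of_mem (rels := ({(wJ.map FreeGroup.of).prod} : Set (FreeGroup J)))
      (Set.mem_singleton _)
    rw [map_list_prod, List.map_map] at h
    exact h
  set f : J → (PresentedMonoid rel)ˣ := fun j => (hval j).2.1.unit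
  have hf : ∀ γ : List J, (((γ.map f).prod : (PresentedMonoid rel)ˣ) : PresentedMonoid rel) =
      m (FreeMonoid.ofList (γ.map val).flatten) := by
    intro γ
    induction γ with
    | nil => simp
    | cons j γ ih =>
      rw [List.map_cons, List.prod_cons, List.map_cons, List.flatten_cons, map_ofList_append,
        Units.val_mul, ih]
      rfl
  have hfw : ∀ r ∈ ({(wJ.map FreeGroup.of).prod} : Set (FreeGroup J)), FreeGroup.lift f r = 1 := by
    intro r hr
    rw [Set.mem_singleton_iff.1 hr, map_list_prod, List.map_map]
    have : (⇑(FreeGroup.lift f) ∘ FreeGroup.of) = f := funext fun j => FreeGroup.lift_apply_of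
    rw [this]
    ext
    rw [hf, hwJ, hmw]; rfl
  set ψ : PresentedGroup ({(wJ.map FreeGroup.of).prod} : Set (FreeGroup J)) →* PresentedMonoid rel :=
    (Units.coeHom _).comp (PresentedGroup.toGroup hfw)
  have hψ : ∀ j, ψ (b j) = m (FreeMonoid.ofList (val j)) := fun j =>
    congrArg Units.val (PresentedGroup.toGroup.of hfw (x := j))
  set pu : Fin k → Function.End (List (PresentedGroup ({(wJ.map FreeGroup.of).prod} :
    Set (FreeGroup J)) × Fin k) × PresentedGroup ({(wJ.map FreeGroup.of).prod} :
    Set (FreeGroup J))) := push c (stk b B) b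
  have hpu : ∀ l s, FreeMonoid.lift pu (FreeMonoid.ofList l) s = actw c B b l s := by
    intro l s
    induction l with
    | nil => rw [FreeMonoid.ofList_nil, map_one]; rfl
    | cons a l ih =>
      rw [map_ofList_cons, FreeMonoid.lift_eval_of, actw_cons, ← ih]
      rfl
  set ρ : PresentedMonoid rel →* Function.End _ := PresentedMonoid.lift pu (by
    rintro x y ⟨hx, hy⟩
    funext s
    rw [hx, hy, hpu, hpu, ← hwJ, actw_flatten wJ fun p _ s => H.actw_val _ p le_rfl s, hbw, lmul_one]
    rfl)
  obtain ⟨e⟩ := H.exists_units_equiv m ψ hψ PresentedMonoid.surjective_mk ρ hpu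
    (PresentedGroup.closure_range_of _) (fun j => (hval j).2.2)
  set ε := Fintype.equivFin J
  refine ⟨Fintype.card J, wJ.map ε, ⟨e.symm.trans ?_⟩⟩
  have h := PresentedGroup.equivPresentedGroup
    ({(wJ.map FreeGroup.of).prod} : Set (FreeGroup J)) ε
  rw [Set.image_singleton, map_list_prod, List.map_map] at h
  rw [List.map_map]
  exact h

theorem eq_one_of_isUnit {k : ℕ} {u v : List (Fin k)} (hu : u ≠ []) (hv : v ≠ [])
    (x : OneRelMonoid u v) (hx : IsUnit x) : x = 1 := by
  have hz : ∀ l : List (Fin k), l ≠ [] →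
      FreeMonoid.lift (fun _ : Fin k => (0 : ℕ)) (FreeMonoid.ofList l) = 0 := by
    intro l hl
    obtain ⟨a, l, rfl⟩ := List.exists_cons_of_ne_nil hl
    rw [map_ofList_cons, FreeMonoid.lift_eval_of, zero_mul]
  set f : OneRelMonoid u v →* ℕ := PresentedMonoid.lift (fun _ => 0) (by
    rintro x y ⟨hx, hy⟩
    rw [hx, hy, hz u hu, hz v hv])
  induction x using PresentedMonoid.inductionOn with
  | h l =>
    have h1 := hx.map f
    by_cases hl : FreeMonoid.toList l = []
    · have : l = 1 := hl
      rw [this, map_one]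
    · have h2 : f (PresentedMonoid.mk _ l) = 0 := hz _ hl
      rw [h2] at h1
      simp at h1

lemma exists_injective_swap {k : ℕ} (u v : List (Fin k)) :
    ∃ f : OneRelMonoid u v →* OneRelMonoid v u, Function.Injective f := by
  have key : ∀ u v : List (Fin k), ∃ f : OneRelMonoid u v →* OneRelMonoid v u,
      ∀ a, f (PresentedMonoid.of _ a) = PresentedMonoid.of _ a := by
    intro u v
    have h1 : FreeMonoid.lift (fun a => (PresentedMonoid.of _ a : OneRelMonoid v u)) =
        PresentedMonoid.mk _ := FreeMonoid.hom_eq fun a => by rw [FreeMonoid.lift_eval_of]; rfl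
    exact ⟨PresentedMonoid.lift (fun a => PresentedMonoid.of _ a) (by
      rintro x y ⟨hx, hy⟩
      rw [hx, hy, h1]
      exact (PresentedMonoid.mk_eq_mk_of_rel ⟨rfl, rfl⟩).symm), fun a => PresentedMonoid.lift_of _ _⟩
  obtain ⟨f, hf⟩ := key u v
  obtain ⟨g, hg⟩ := key v u
  have : g.comp f = MonoidHom.id _ := PresentedMonoid.ext _ fun a => by
    rw [MonoidHom.comp_apply, hf, hg]; rfl
  exact ⟨f, Function.LeftInverse.injective (g := g) (DFunLike.congr_fun this)⟩

/-- A group embedding in a one-relation monoid embeds in a positive one-relator group. -/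
theorem exists_embedding_positive {G : Type*} [Group G] {k : ℕ} {u v : List (Fin k)}
    (φ : G →* OneRelMonoid u v) (hφ : Function.Injective φ) :
    ∃ (n : ℕ) (w : List (Fin n))
      (ψ : G →* PresentedGroup ({(w.map FreeGroup.of).prod} : Set (FreeGroup (Fin n)))),
      Function.Injective ψ := by
  have special : ∀ (w : List (Fin k)) (φ : G →* OneRelMonoid w []), Function.Injective φ →
      ∃ (n : ℕ) (w : List (Fin n))
        (ψ : G →* PresentedGroup ({(w.map FreeGroup.of).prod} : Set (FreeGroup (Fin n)))),
        Function.Injective ψ := by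
    intro w φ hφ
    obtain ⟨n, w', ⟨e⟩⟩ := exists_units_equiv w
    exact ⟨n, w', e.toMonoidHom.comp φ.toHomUnits, e.injective.comp fun x y h =>
      hφ (congrArg Units.val h)⟩
  by_cases hv : v = []
  · subst hv
    exact special u φ hφ
  · by_cases hu : u = []
    · subst hu
      obtain ⟨f, hf⟩ := exists_injective_swap [] v
      exact special v (f.comp φ) (hf.comp hφ)
    · have h1 : ∀ x : G, x = 1 := fun x => hφ (by
        rw [map_one]; exact eq_one_of_isUnit hu hv _ ((Group.isUnit x).map φ))
      exact ⟨0, [], 1, fun x y _ => (h1 x).trans (h1 y).symm⟩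

theorem exists_subsingleton_neighbors {V : Type*} [Finite V] [Nonempty V] {G : SimpleGraph V}
    (hG : G.IsAcyclic) : ∃ u, ∀ x y, G.Adj u x → G.Adj u y → x = y := by
  have := Fintype.ofFinite V
  by_contra! H
  have long : ∀ n, ∃ (u v : V) (p : G.Walk u v), p.IsPath ∧ p.length = n := by
    intro n
    induction n with
    | zero => exact ⟨Classical.arbitrary V, _, .nil, .nil, rfl⟩
    | succ n ih =>
      obtain ⟨u, v, p, hp, hn⟩ := ih
      obtain ⟨x, y, hx, hy, hxy⟩ := H u
      obtain ⟨z, hz, hzp⟩ : ∃ z, G.Adj u z ∧ z ∉ p.support := by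
        by_contra! h
        exact hxy ((hG.eq_snd_of_adj_start hp hx (h x hx)).trans
          (hG.eq_snd_of_adj_start hp hy (h y hy)).symm)
      exact ⟨z, v, .cons hz.symm p, hp.cons hzp, by rw [SimpleGraph.Walk.length_cons, hn]⟩
  obtain ⟨u, v, p, hp, hn⟩ := long (Fintype.card V)
  exact hp.length_lt.ne hn

theorem exists_embedding_of_infinite_neighbors {W : Type*} [Nonempty W] {T : SimpleGraph W}
    (hinf : ∀ p, {q | T.Adj p q}.Infinite)
    (hsq : ∀ p p' q q', T.Adj p q → T.Adj p q' → T.Adj p' q → T.Adj p' q' → p = p' ∨ q = q')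
    {V : Type*} [Finite V] {G : SimpleGraph V} (hG : G.IsAcyclic) : Nonempty (G ↪g T) := by
  classical
  induction hn : Nat.card V generalizing V with
  | zero =>
    have := Finite.card_eq_zero_iff.1 hn
    exact ⟨⟨⟨isEmptyElim, fun x => isEmptyElim x⟩, fun {x} => isEmptyElim x⟩⟩
  | succ n ih =>
    have : Nonempty V := (Nat.card_pos_iff.1 (by omega)).1
    obtain ⟨u, hu⟩ := exists_subsingleton_neighbors hG
    obtain ⟨f⟩ := ih (hG.induce {x | x ≠ u}) (by
      have := Nat.card_congr (Equiv.optionSubtypeNe u).symm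
      rw [Finite.card_option] at this
      change Nat.card {x // x ≠ u} = n
      omega)
    obtain ⟨p, hp⟩ : ∃ p, ∀ x : {x | x ≠ u}, f x = p ↔ G.Adj u x := by
      by_cases h : ∃ x, G.Adj u x
      · obtain ⟨x, hx⟩ := h
        refine ⟨f ⟨x, hx.ne'⟩, fun y => ⟨fun h => ?_, fun h => ?_⟩⟩
        · rw [f.injective h]; exact hx
        · exact congrArg f (Subtype.ext (hu _ _ h hx))
      · have hW : Infinite W :=
          Set.infinite_univ_iff.1 ((hinf (Classical.arbitrary W)).mono (Set.subset_univ _))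
        obtain ⟨p, hp⟩ := (Set.finite_range f).infinite_compl.nonempty
        exact ⟨p, fun x => ⟨fun h => (hp ⟨x, h⟩).elim, fun h' => (h ⟨x, h'⟩).elim⟩⟩
    obtain ⟨q, hq, hqf⟩ : ∃ q, T.Adj p q ∧ ∀ x, f x ≠ q ∧ (f x ≠ p → ¬ T.Adj (f x) q) := by
      have hfin : (⋃ x, ({f x} ∪ {q | f x ≠ p ∧ T.Adj p q ∧ T.Adj (f x) q})).Finite := by
        refine Set.finite_iUnion fun x => (Set.finite_singleton _).union ?_
        refine Set.Subsingleton.finite fun q hq q' hq' => ?_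
        exact (hsq p (f x) q q' hq.2.1 hq'.2.1 hq.2.2 hq'.2.2).resolve_left fun h => hq.1 h.symm
      obtain ⟨q, hq, hq'⟩ := ((hinf p).sdiff hfin).nonempty
      refine ⟨q, hq, fun x => ⟨fun h => hq' ?_, fun h h' => hq' ?_⟩⟩
      · exact Set.mem_iUnion.2 ⟨x, Or.inl h.symm⟩
      · exact Set.mem_iUnion.2 ⟨x, Or.inr ⟨h, hq, h'⟩⟩
    have hqa : ∀ x : {x | x ≠ u}, T.Adj q (f x) ↔ G.Adj u x := fun x => by
      rw [← hp x]
      exact ⟨fun h => by_contra fun h' => (hqf x).2 h' h.symm, fun h => h ▸ hq.symm⟩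
    set g : V → W := fun x => if h : x ≠ u then f ⟨x, h⟩ else q
    have hgu : g u = q := dif_neg (by simp)
    have hgf : ∀ x (h : x ≠ u), g x = f ⟨x, h⟩ := fun x h => dif_pos h
    refine ⟨⟨⟨g, fun x y h => ?_⟩, fun {x y} => ?_⟩⟩
    · by_cases hx : x = u <;> by_cases hy : y = u
      · rw [hx, hy]
      · rw [hx, hgu, hgf y hy] at h
        exact ((hqf _).1 h.symm).elim
      · rw [hy, hgu, hgf x hx] at h
        exact ((hqf _).1 h).elim
      · rw [hgf x hx, hgf y hy] at h
        exact congrArg Subtype.val (f.injective h)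
    · change T.Adj (g x) (g y) ↔ G.Adj x y
      by_cases hx : x = u <;> by_cases hy : y = u
      · rw [hx, hy]; simp
      · rw [hx, hgu, hgf y hy, hqa]
      · rw [hy, hgu, hgf x hx, T.adj_comm, hqa, G.adj_comm]
      · rw [hgf x hx, hgf y hy, f.map_adj_iff]; rfl

/-- The coset graph of a pair of subgroups: two cosets are adjacent when they have a common
representative. -/
def cosetGraph {G : Type*} [Group G] (H K : Subgroup G) : SimpleGraph ((G ⧸ H) ⊕ (G ⧸ K)) where
  Adj p q := ∃ g : G, (p = .inl ↑g ∧ q = .inr ↑g) ∨ (p = .inr ↑g ∧ q = .inl ↑g)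
  symm := ⟨fun p q ⟨g, h⟩ => ⟨g, h.elim (fun h => .inr h.symm) fun h => .inl h.symm⟩⟩
  loopless := ⟨by rintro p ⟨g, ⟨h, h'⟩ | ⟨h, h'⟩⟩ <;> rw [h] at h' <;> cases h'⟩

section cosetGraph

variable {G : Type*} [Group G] {H K : Subgroup G}

lemma cosetGraph_smul (g : G) {p q : (G ⧸ H) ⊕ (G ⧸ K)} (h : (cosetGraph H K).Adj p q) :
    (cosetGraph H K).Adj (g • p) (g • q) := by
  obtain ⟨x, ⟨rfl, rfl⟩ | ⟨rfl, rfl⟩⟩ := h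
  · exact ⟨g * x, .inl ⟨rfl, rfl⟩⟩
  · exact ⟨g * x, .inr ⟨rfl, rfl⟩⟩

lemma cosetGraph_square (hHK : ∀ h ∈ H, ∀ k ∈ K, ∀ h' ∈ H, ∀ k' ∈ K, h * k * h' * k' = 1 → h = 1 ∨ k = 1)
    {p p' : G ⧸ H} {q q' : G ⧸ K} (h₁ : (cosetGraph H K).Adj (.inl p) (.inr q))
    (h₂ : (cosetGraph H K).Adj (.inl p) (.inr q')) (h₃ : (cosetGraph H K).Adj (.inl p') (.inr q))
    (h₄ : (cosetGraph H K).Adj (.inl p') (.inr q')) : p = p' ∨ q = q' := by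
  obtain ⟨g₁, h₁ | h₁⟩ := h₁ <;> simp only [Sum.inl.injEq, Sum.inr.injEq, reduceCtorEq, false_and] at h₁
  obtain ⟨g₂, h₂ | h₂⟩ := h₂ <;> simp only [Sum.inl.injEq, Sum.inr.injEq, reduceCtorEq, false_and] at h₂
  obtain ⟨g₃, h₃ | h₃⟩ := h₃ <;> simp only [Sum.inl.injEq, Sum.inr.injEq, reduceCtorEq, false_and] at h₃
  obtain ⟨g₄, h₄ | h₄⟩ := h₄ <;> simp only [Sum.inl.injEq, Sum.inr.injEq, reduceCtorEq, false_and] at h₄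
  rcases hHK (g₁⁻¹ * g₂) (QuotientGroup.eq.1 (h₁.1.symm.trans h₂.1))
    (g₂⁻¹ * g₄) (QuotientGroup.eq.1 (h₂.2.symm.trans h₄.2))
    (g₄⁻¹ * g₃) (QuotientGroup.eq.1 (h₄.1.symm.trans h₃.1))
    (g₃⁻¹ * g₁) (QuotientGroup.eq.1 (h₃.2.symm.trans h₁.2)) (by group) with h | h
  · right
    rw [h₁.2, h₂.2, inv_mul_eq_one.1 h]
  · left
    rw [h₂.1, h₄.1, inv_mul_eq_one.1 h]

lemma cosetGraph_infinite (hH : (H : Set G).Infinite) (hK : (K : Set G).Infinite)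
    (hHK : ∀ h ∈ H, h ∈ K → h = 1) (p : (G ⧸ H) ⊕ (G ⧸ K)) :
    {q | (cosetGraph H K).Adj p q}.Infinite := by
  rcases p with p | p <;> induction p using QuotientGroup.induction_on with | H g
  · refine (hH.image (f := fun h => .inr ((g * h : G) : G ⧸ K)) fun x hx y hy h => ?_).mono ?_
    · have h1 := QuotientGroup.eq.1 (Sum.inr.inj h)
      rw [show (g * x)⁻¹ * (g * y) = x⁻¹ * y by group] at h1
      exact inv_mul_eq_one.1 (hHK _ (mul_mem (inv_mem hx) hy) h1)
    · rintro _ ⟨x, hx, rfl⟩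
      exact ⟨g * x, .inl ⟨congrArg _ (QuotientGroup.eq.2 (by simpa using hx)), rfl⟩⟩
  · refine (hK.image (f := fun h => .inl ((g * h : G) : G ⧸ H)) fun x hx y hy h => ?_).mono ?_
    · have h1 := QuotientGroup.eq.1 (Sum.inl.inj h)
      rw [show (g * x)⁻¹ * (g * y) = x⁻¹ * y by group] at h1
      exact inv_mul_eq_one.1 (hHK _ h1 (mul_mem (inv_mem hx) hy))
    · rintro _ ⟨x, hx, rfl⟩
      exact ⟨g * x, .inr ⟨congrArg _ (QuotientGroup.eq.2 (by simpa using hx)), rfl⟩⟩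

theorem exists_embedding_cosetGraph (hH : (H : Set G).Infinite) (hK : (K : Set G).Infinite)
    (hHK : ∀ h ∈ H, ∀ k ∈ K, ∀ h' ∈ H, ∀ k' ∈ K, h * k * h' * k' = 1 → h = 1 ∨ k = 1)
    {V : Type*} [Finite V] {Γ : SimpleGraph V} (hΓ : Γ.IsAcyclic) : Nonempty (Γ ↪g cosetGraph H K) := by
  have : Nonempty ((G ⧸ H) ⊕ (G ⧸ K)) := ⟨.inl ((1 : G) : G ⧸ H)⟩
  refine exists_embedding_of_infinite_neighbors (cosetGraph_infinite hH hK fun h h1 h2 => ?_) ?_ hΓ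
  · rcases hHK h h1 h⁻¹ (inv_mem h2) 1 (one_mem _) 1 (one_mem _) (by group) with h | h
    · exact h
    · exact inv_eq_one.1 h
  · have absurd_inl : ∀ p p', ¬ (cosetGraph H K).Adj (.inl p) (.inl p') := by
      rintro p p' ⟨g, h | h⟩ <;> simp at h
    have absurd_inr : ∀ p p', ¬ (cosetGraph H K).Adj (.inr p) (.inr p') := by
      rintro p p' ⟨g, h | h⟩ <;> simp at h
    rintro (p | p) (p' | p') (q | q) (q' | q') h₁ h₂ h₃ h₄ <;>
      first
      | exact (absurd_inl _ _ h₁).elim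
      | exact (absurd_inl _ _ h₂).elim
      | exact (absurd_inl _ _ h₃).elim
      | exact (absurd_inr _ _ h₁).elim
      | exact (absurd_inr _ _ h₂).elim
      | exact (absurd_inr _ _ h₃).elim
      | exact (cosetGraph_square hHK h₁ h₂ h₃ h₄).imp (congrArg _) (congrArg _)
      | exact (cosetGraph_square hHK h₁.symm h₃.symm h₂.symm h₄.symm).symm.imp (congrArg _) (congrArg _)

end cosetGraph

lemma exists_injective_of_embedding {V W : Type*} {Γ : SimpleGraph V} {Δ : SimpleGraph W} (f : Γ ↪g Δ) :
    ∃ φ : RAAG Γ →* RAAG Δ, Function.Injective φ := by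
  classical
  set φ : RAAG Γ →* RAAG Δ := raagLift Γ (fun x => PresentedGroup.of (f x)) fun x y h =>
    raag_of_mul_of (f.map_adj_iff.2 h)
  set g : W → RAAG Γ := Function.extend f PresentedGroup.of 1
  have hg : ∀ x, g (f x) = PresentedGroup.of x := f.injective.extend_apply _ _
  have hg' : ∀ p, (¬ ∃ x, f x = p) → g p = 1 := fun p hp => Function.extend_apply' _ _ _ hp
  set ψ : RAAG Δ →* RAAG Γ := raagLift Δ g fun p q h => by
    by_cases hp : ∃ x, f x = p
    · obtain ⟨x, rfl⟩ := hp
      by_cases hq : ∃ y, f y = q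
      · obtain ⟨y, rfl⟩ := hq
        rw [hg, hg, raag_of_mul_of (f.map_adj_iff.1 h)]
      · rw [hg' q hq, mul_one, one_mul]
    · rw [hg' p hp, mul_one, one_mul]
  have : ψ.comp φ = MonoidHom.id _ := PresentedGroup.ext fun x => by
    simp only [MonoidHom.comp_apply, φ, ψ, raagLift_of, hg, MonoidHom.id_apply]
  exact ⟨φ, Function.LeftInverse.injective (DFunLike.congr_fun this)⟩

/-- A group acting on a graph and the right-angled Artin group of the graph act together on the
latter, compatibly and with the right-angled Artin group acting faithfully. -/
lemma exists_perm_representation {V G : Type*} [Group G] [MulAction G V] (Γ : SimpleGraph V)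
    (hΓ : ∀ (g : G) x y, Γ.Adj x y → Γ.Adj (g • x) (g • y)) :
    ∃ (ρ : G →* Equiv.Perm (RAAG Γ)) (L : RAAG Γ →* Equiv.Perm (RAAG Γ)), Function.Injective L ∧
      ∀ g x, ρ g * L (PresentedGroup.of x) * (ρ g)⁻¹ = L (PresentedGroup.of (g • x)) := by
  set μ : G → RAAG Γ →* RAAG Γ := fun g => raagLift Γ (fun x => PresentedGroup.of (g • x))
    fun x y h => raag_of_mul_of (hΓ g x y h)
  have hμ : ∀ g x, μ g (PresentedGroup.of x) = PresentedGroup.of (g • x) := fun g x => raagLift_of _ _ _ _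
  have hmul : ∀ g h z, μ (g * h) z = μ g (μ h z) := fun g h => DFunLike.congr_fun <|
    show μ (g * h) = (μ g).comp (μ h) from PresentedGroup.ext fun x => by
      simp only [MonoidHom.comp_apply, hμ, mul_smul]
  have hone : ∀ z, μ 1 z = z := DFunLike.congr_fun <|
    show μ 1 = MonoidHom.id _ from PresentedGroup.ext fun x => by
      simp only [MonoidHom.id_apply, hμ, one_smul]
  refine ⟨⟨⟨fun g => ⟨μ g, μ g⁻¹, fun z => ?_, fun z => ?_⟩, Equiv.ext hone⟩,
    fun g h => Equiv.ext (hmul g h)⟩, MulAction.toPermHom _ _, MulAction.toPerm_injective,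
    fun g x => mul_inv_eq_of_eq_mul (Equiv.ext fun z => ?_)⟩
  · rw [← hmul, inv_mul_cancel, hone]
  · rw [← hmul, mul_inv_cancel, hone]
  · change μ g (PresentedGroup.of x * z) = PresentedGroup.of (g • x) * μ g z
    rw [map_mul, hμ]

/-- The bi-infinite path. -/
def intPath : SimpleGraph ℤ where
  Adj i j := j = i + 1 ∨ i = j + 1
  symm := ⟨fun _ _ h => h.symm⟩
  loopless := ⟨fun i h => by omega⟩

lemma intPath_vadd (g : Multiplicative ℤ) (x y : ℤ) (h : intPath.Adj x y) :
    intPath.Adj (g • x) (g • y) := by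
  change y = x + 1 ∨ x = y + 1 at h
  change g.toAdd + y = g.toAdd + x + 1 ∨ g.toAdd + x = g.toAdd + y + 1
  omega

lemma intPath_succ (i : ℤ) : intPath.Adj i (i + 1) := .inl rfl

/-- The map from the right-angled Artin group of the bi-infinite path sending the `i`-th generator
to the conjugate of `x` by the `i`-th power of `t`. -/
def conjPow {G : Type*} [Group G] (t x : G) (h : Commute x (t * x * t⁻¹)) : RAAG intPath →* G :=
  raagLift intPath (fun i => t ^ i * x * (t ^ i)⁻¹) (by
    have key : ∀ i : ℤ, Commute (t ^ i * x * (t ^ i)⁻¹) (t ^ (i + 1) * x * (t ^ (i + 1))⁻¹) := by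
      intro i
      have h1 : t ^ (i + 1) * x * (t ^ (i + 1))⁻¹ = t ^ i * (t * x * t⁻¹) * (t ^ i)⁻¹ := by
        rw [zpow_add, zpow_one]; group
      rw [h1]
      exact (Commute.conj_iff _).2 h
    rintro i j (rfl | rfl)
    · exact key i
    · exact (key j).symm)

lemma conjPow_of {G : Type*} [Group G] (t x : G) (h : Commute x (t * x * t⁻¹)) (i : ℤ) :
    conjPow t x h (PresentedGroup.of i) = t ^ i * x * (t ^ i)⁻¹ :=
  raagLift_of _ _ _ _

/-- The bi-infinite path group is faithfully represented by conjugates of a single element. -/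
lemma exists_conjPow_injective : ∃ (G : Type) (_ : Group G) (t x : G) (h : Commute x (t * x * t⁻¹)),
    Function.Injective (conjPow t x h) := by
  obtain ⟨ρ, L, hL, h⟩ := exists_perm_representation intPath intPath_vadd
  have ht : ∀ i : ℤ, ρ (Multiplicative.ofAdd 1) ^ i * L (PresentedGroup.of 0) *
      (ρ (Multiplicative.ofAdd 1) ^ i)⁻¹ = L (PresentedGroup.of i) := by
    intro i
    rw [← map_zpow, h, ← ofAdd_zsmul]
    change L (PresentedGroup.of (i • 1 + 0)) = _
    simp
  have hc : Commute (L (PresentedGroup.of 0)) (ρ (Multiplicative.ofAdd 1) * L (PresentedGroup.of 0) *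
      (ρ (Multiplicative.ofAdd 1))⁻¹) := by
    have h1 := ht 1
    rw [zpow_one] at h1
    rw [h1]
    exact (show Commute (PresentedGroup.of 0 : RAAG intPath) (PresentedGroup.of 1) from
      raag_of_mul_of (intPath_succ 0)).map L
  refine ⟨_, _, ρ (Multiplicative.ofAdd 1), L (PresentedGroup.of 0), hc, ?_⟩
  have : conjPow _ _ hc = L := PresentedGroup.ext fun i => by rw [conjPow_of, ht]
  rw [this]
  exact hL

/-- The right-angled Artin group of the coset graph of two subgroups generated by free generators
embeds in that of the bi-infinite path. -/
lemma exists_cosetGraph_embedding : ∃ φ : RAAG (cosetGraph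
    (Subgroup.zpowers (FreeGroup.of false)) (Subgroup.zpowers (FreeGroup.of true))) →* RAAG intPath,
    Function.Injective φ := by
  set H := Subgroup.zpowers (FreeGroup.of false)
  set K := Subgroup.zpowers (FreeGroup.of true)
  obtain ⟨ρ, L, hL, h⟩ := exists_perm_representation (G := FreeGroup Bool) (cosetGraph H K)
    fun g _ _ => cosetGraph_smul g
  set σ : FreeGroup Bool →* RAAG intPath := FreeGroup.lift fun b =>
    bif b then PresentedGroup.of 3 else PresentedGroup.of 0
  have hσ₀ : σ (FreeGroup.of false) = PresentedGroup.of 0 := FreeGroup.lift_apply_of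
  have hσ₃ : σ (FreeGroup.of true) = PresentedGroup.of 3 := FreeGroup.lift_apply_of
  have hconj : ∀ (x : FreeGroup Bool) (s : RAAG intPath), Commute (σ x) s → ∀ g g' : FreeGroup Bool,
      (g : FreeGroup Bool ⧸ Subgroup.zpowers x) = g' →
        σ g * s * (σ g)⁻¹ = σ g' * s * (σ g')⁻¹ := by
    intro x s hs g g' hg
    obtain ⟨k, hk⟩ := QuotientGroup.eq.1 hg
    have hk' : g' = g * x ^ k := eq_mul_of_inv_mul_eq hk.symm
    have h1 : σ x ^ k * s * (σ x ^ k)⁻¹ = s := mul_inv_eq_of_eq_mul (hs.zpow_left k).eq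
    calc σ g * s * (σ g)⁻¹ = σ g * (σ x ^ k * s * (σ x ^ k)⁻¹) * (σ g)⁻¹ := by rw [h1]
      _ = σ g' * s * (σ g')⁻¹ := by rw [hk', map_mul, map_zpow]; group
  have h01 : Commute (σ (FreeGroup.of false)) (PresentedGroup.of 1) := by
    rw [hσ₀]; exact raag_of_mul_of (intPath_succ 0)
  have h32 : Commute (σ (FreeGroup.of true)) (PresentedGroup.of 2) := by
    rw [hσ₃]; exact (raag_of_mul_of (intPath_succ 2)).symm
  set f : (FreeGroup Bool ⧸ H) ⊕ (FreeGroup Bool ⧸ K) → RAAG intPath := Sum.elim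
    (fun p => σ p.out * PresentedGroup.of 1 * (σ p.out)⁻¹)
    (fun p => σ p.out * PresentedGroup.of 2 * (σ p.out)⁻¹)
  have hf₁ : ∀ g : FreeGroup Bool, f (.inl g) = σ g * PresentedGroup.of 1 * (σ g)⁻¹ := fun g =>
    hconj _ _ h01 _ _ (QuotientGroup.out_eq' _)
  have hf₂ : ∀ g : FreeGroup Bool, f (.inr g) = σ g * PresentedGroup.of 2 * (σ g)⁻¹ := fun g =>
    hconj _ _ h32 _ _ (QuotientGroup.out_eq' _)
  have hf : ∀ g : FreeGroup Bool, Commute (f (.inl g)) (f (.inr g)) := fun g => by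
    rw [hf₁, hf₂]
    exact (Commute.conj_iff _).2 (raag_of_mul_of (intPath_succ 1))
  set φ : RAAG (cosetGraph H K) →* RAAG intPath := raagLift _ f (by
    rintro p q ⟨g, ⟨rfl, rfl⟩ | ⟨rfl, rfl⟩⟩
    · exact hf g
    · exact (hf g).symm)
  set θ₀ : ℤ → Equiv.Perm (RAAG (cosetGraph H K)) := fun i =>
    if i = 0 then ρ (FreeGroup.of false) else
    if i = 1 then L (PresentedGroup.of (.inl ((1 : FreeGroup Bool) : FreeGroup Bool ⧸ H))) else
    if i = 2 then L (PresentedGroup.of (.inr ((1 : FreeGroup Bool) : FreeGroup Bool ⧸ K))) else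
    if i = 3 then ρ (FreeGroup.of true) else 1
  have hfix : ∀ g x, g • x = x → Commute (ρ g) (L (PresentedGroup.of x)) := fun g x hx => by
    have h1 := h g x
    rw [hx] at h1
    exact eq_mul_of_mul_inv_eq h1
  have hθ₀ : ∀ i, Commute (θ₀ i) (θ₀ (i + 1)) := by
    intro i
    by_cases h0 : i = 0
    · subst h0
      exact hfix _ _ (congrArg Sum.inl (QuotientGroup.eq.2 (by simp [H])))
    by_cases h1 : i = 1
    · subst h1
      exact Commute.map (show Commute (PresentedGroup.of (.inl _) : RAAG (cosetGraph H K)) _ from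
        raag_of_mul_of ⟨1, .inl ⟨rfl, rfl⟩⟩) L
    by_cases h2 : i = 2
    · subst h2
      exact (hfix _ _ (congrArg Sum.inr (QuotientGroup.eq.2 (by simp [K])))).symm
    by_cases h3 : i = 3
    · subst h3
      exact Commute.one_right _
    · have : θ₀ i = 1 := by simp only [θ₀, h0, h1, h2, h3, if_false]
      rw [this]
      exact Commute.one_left _
  set θ : RAAG intPath →* Equiv.Perm (RAAG (cosetGraph H K)) := raagLift _ θ₀ (by
    rintro i j (rfl | rfl)
    · exact hθ₀ i
    · exact (hθ₀ j).symm)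
  have hθ : ∀ i, θ (PresentedGroup.of i) = θ₀ i := raagLift_of _ _ _
  have hθσ : ∀ g, θ (σ g) = ρ g := DFunLike.congr_fun <|
    show θ.comp σ = ρ from FreeGroup.ext_hom _ _ fun b => by
      cases b
      · rw [MonoidHom.comp_apply, hσ₀, hθ]; rfl
      · rw [MonoidHom.comp_apply, hσ₃, hθ]; rfl
  have key : θ.comp φ = L := PresentedGroup.ext fun p => by
    have hφ : φ (PresentedGroup.of p) = f p := raagLift_of _ _ _ _
    rw [MonoidHom.comp_apply, hφ]
    rcases p with p | p <;> induction p using QuotientGroup.induction_on with | H g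
    · rw [hf₁, map_mul, map_mul, map_inv, hθσ, hθ]
      refine (h g _).trans (congrArg (fun z => L (PresentedGroup.of (Sum.inl z))) ?_)
      change ((g * 1 : FreeGroup Bool) : FreeGroup Bool ⧸ H) = g
      rw [mul_one]
    · rw [hf₂, map_mul, map_mul, map_inv, hθσ, hθ]
      refine (h g _).trans (congrArg (fun z => L (PresentedGroup.of (Sum.inr z))) ?_)
      change ((g * 1 : FreeGroup Bool) : FreeGroup Bool ⧸ K) = g
      rw [mul_one]
  refine ⟨φ, Function.Injective.of_comp (f := θ) ?_⟩
  rw [← MonoidHom.coe_comp, key]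
  exact hL

/-- Every right-angled Artin group of a finite forest embeds in that of the bi-infinite path. -/
theorem exists_intPath_embedding {V : Type*} [Finite V] {Γ : SimpleGraph V} (hΓ : Γ.IsAcyclic) :
    ∃ φ : RAAG Γ →* RAAG intPath, Function.Injective φ := by
  set D : Bool → Matrix.SpecialLinearGroup (Fin 2) ℤ := fun b =>
    bif b then ⟨!![1, 0; 1, 1], by simp [Matrix.det_fin_two]⟩
    else ⟨!![1, 1; 0, 1], by simp [Matrix.det_fin_two]⟩
  set S : FreeGroup Bool →* Matrix.SpecialLinearGroup (Fin 2) ℤ := FreeGroup.lift D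
  have hS : ∀ b, S (FreeGroup.of b) = D b := fun b => FreeGroup.lift_apply_of
  have hfalse : ∀ n : ℤ, ((D false ^ n : Matrix.SpecialLinearGroup (Fin 2) ℤ) :
      Matrix (Fin 2) (Fin 2) ℤ) = !![1, n; 0, 1] := by
    intro n
    set c : Multiplicative ℤ →* Matrix.SpecialLinearGroup (Fin 2) ℤ :=
      MonoidHom.mk' (fun n => ⟨!![1, n.toAdd; 0, 1], by simp [Matrix.det_fin_two]⟩) fun x y => by
        refine Subtype.ext ?_
        change !![1, x.toAdd + y.toAdd; 0, 1] = !![1, x.toAdd; 0, 1] * (!![1, y.toAdd; 0, 1] : Matrix (Fin 2) (Fin 2) ℤ)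
        simp [add_comm]
    change ((c (Multiplicative.ofAdd 1) ^ n : Matrix.SpecialLinearGroup (Fin 2) ℤ) :
      Matrix (Fin 2) (Fin 2) ℤ) = _
    rw [← map_zpow, ← ofAdd_zsmul, smul_eq_mul, mul_one]
    rfl
  have htrue : ∀ n : ℤ, ((D true ^ n : Matrix.SpecialLinearGroup (Fin 2) ℤ) :
      Matrix (Fin 2) (Fin 2) ℤ) = !![1, 0; n, 1] := by
    intro n
    set c : Multiplicative ℤ →* Matrix.SpecialLinearGroup (Fin 2) ℤ :=
      MonoidHom.mk' (fun n => ⟨!![1, 0; n.toAdd, 1], by simp [Matrix.det_fin_two]⟩) fun x y => by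
        refine Subtype.ext ?_
        change !![1, 0; x.toAdd + y.toAdd, 1] = !![1, 0; x.toAdd, 1] * (!![1, 0; y.toAdd, 1] : Matrix (Fin 2) (Fin 2) ℤ)
        simp
    change ((c (Multiplicative.ofAdd 1) ^ n : Matrix.SpecialLinearGroup (Fin 2) ℤ) :
      Matrix (Fin 2) (Fin 2) ℤ) = _
    rw [← map_zpow, ← ofAdd_zsmul, smul_eq_mul, mul_one]
    rfl
  have hinf : ∀ b : Bool, (Subgroup.zpowers (FreeGroup.of b) : Set (FreeGroup Bool)).Infinite := by
    intro b
    refine Set.infinite_range_of_injective fun m n h => ?_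
    have h1 := congrArg (FreeGroup.lift fun _ : Bool => Multiplicative.ofAdd (1 : ℤ)) h
    simpa [← ofAdd_zsmul] using h1
  obtain ⟨f⟩ := exists_embedding_cosetGraph (hinf false) (hinf true) (by
    rintro _ ⟨i, rfl⟩ _ ⟨j, rfl⟩ _ ⟨k, rfl⟩ _ ⟨l, rfl⟩ h
    have h1 := congrArg S (eq_inv_of_mul_eq_one_left ((mul_assoc _ _ _).symm.trans h))
    simp only [mul_inv_rev, ← zpow_neg, map_mul, map_zpow, hS] at h1
    have h2 := congrFun (congrFun (congrArg Subtype.val h1) 0) 0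
    have h3 : 1 + i * j = 1 := by
      simpa [hfalse, htrue, Matrix.mul_apply, -zpow_neg] using h2
    have h4 : i * j = 0 := by linarith
    rcases mul_eq_zero.1 h4 with rfl | rfl
    · exact .inl (zpow_zero _)
    · exact .inr (zpow_zero _)) hΓ
  obtain ⟨φ, hφ⟩ := exists_injective_of_embedding f
  obtain ⟨ψ, hψ⟩ := exists_cosetGraph_embedding
  exact ⟨ψ.comp φ, hψ.comp hφ⟩

section HNNExtension

open HNNExtension

lemma exists_reducedWord_prod_eq {G : Type*} [Group G] {A B : Subgroup G} {φ : A ≃* B}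
    (x : HNNExtension G A B φ) : ∃ w : NormalWord.ReducedWord G A B, w.prod φ = x := by
  obtain ⟨d⟩ := NormalWord.TransversalPair.nonempty G A B
  exact ⟨_, (NormalWord.equiv φ d).symm_apply_apply x⟩

theorem HNNExtension_map_injective {G G' : Type*} [Group G] [Group G'] {A B : Subgroup G} {φ : A ≃* B}
    {A' B' : Subgroup G'} {φ' : A' ≃* B'} {e : G →* G'} (he : Function.Injective e)
    (hA : ∀ g, e g ∈ A' → g ∈ A) (hB : ∀ g, e g ∈ B' → g ∈ B)
    (F : HNNExtension G A B φ →* HNNExtension G' A' B' φ') (hF : ∀ g, F (of g) = of (e g))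
    (hFt : F t = t) : Function.Injective F := by
  refine (injective_iff_map_eq_one F).2 fun x hx => ?_
  obtain ⟨w, rfl⟩ := exists_reducedWord_prod_eq x
  have hu : ∀ (u : ℤˣ) g, e g ∈ toSubgroup A' B' u → g ∈ toSubgroup A B u := by
    intro u g h
    rcases Int.units_eq_one_or u with rfl | rfl
    · exact hA g h
    · exact hB g h
  set w' : NormalWord.ReducedWord G' A' B' :=
    { head := e w.head
      toList := w.toList.map fun x => (x.1, e x.2)
      chain := by
        rw [List.isChain_map]
        exact w.chain.imp fun x y h h' => h (hu _ _ h') }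
  have hw : F (w.prod φ) = w'.prod φ' := by
    simp only [NormalWord.ReducedWord.prod, map_mul, hF, map_list_prod, List.map_map, w']
    congr 3
    funext x
    simp [hF, hFt]
  have h1 : w'.toList = [] := ReducedWord.toList_eq_nil_of_mem_of_range φ' w' (by
    rw [← hw, hx]; exact one_mem _)
  have h2 : w.toList = [] := List.map_eq_nil_iff.1 h1
  have h3 : w.prod φ = of w.head := by simp [NormalWord.ReducedWord.prod, h2]
  rw [h3, hF, ← map_one of] at hx
  rw [h3, he ((of_injective φ' hx).trans (map_one e).symm), map_one]

lemma exists_cyclic_HNNExtension {G : Type*} [Group G] (f g : Multiplicative ℤ →* G)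
    (hf : Function.Injective f) (hg : Function.Injective g) :
    ∃ φ : f.range ≃* g.range, ∀ n, ((φ ⟨f n, n, rfl⟩ : g.range) : G) = g n := by
  refine ⟨(MonoidHom.ofInjective hf).symm.trans (MonoidHom.ofInjective hg), fun n => ?_⟩
  have : (MonoidHom.ofInjective hf).symm ⟨f n, n, rfl⟩ = n :=
    (MonoidHom.ofInjective hf).symm_apply_apply n
  rw [MulEquiv.trans_apply, this]
  rfl

/-- Two elements generating a Klein bottle group of isometries. -/
lemma exists_klein_bottle : ∃ (G : Type) (_ : Group G) (c b : G), c * b ^ 3 * c * b = 1 ∧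
    (∀ n : ℤ, c ^ n = 1 → n = 0) ∧ (∀ n : ℤ, b ^ n = 1 → n = 0) ∧
    (∀ i j n : ℤ, (c ^ 2) ^ i * (b ^ 2) ^ j = c ^ n → j = 0) ∧
    (∀ i j n : ℤ, (c ^ 2) ^ i * (b ^ 2) ^ j = b ^ n → i = 0) := by
  set c : Equiv.Perm (ℤ × ℤ) := Equiv.addRight (1, -2)
  set b : Equiv.Perm (ℤ × ℤ) :=
    ⟨fun p => (-p.1, p.2 + 1), fun p => (-p.1, p.2 - 1), fun p => by simp, fun p => by simp⟩
  have hc : ∀ (n : ℤ) p, (c ^ n) p = (p.1 + n, p.2 - 2 * n) := fun n p => by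
    induction n generalizing p with
    | zero => simp
    | succ n ih => rw [zpow_add_one, Equiv.Perm.mul_apply, ih]; simp [c]; constructor <;> ring
    | pred n ih => rw [zpow_sub_one, Equiv.Perm.mul_apply, ih]; simp [c, Equiv.Perm.inv_def]; constructor <;> ring
  have hb : ∀ (n : ℤ) (k : ℤ), (b ^ n) (0, k) = (0, k + n) := fun n k => by
    induction n generalizing k with
    | zero => simp
    | succ n ih => rw [zpow_add_one, Equiv.Perm.mul_apply, show b (0, k) = (0, k + 1) from rfl, ih]; simp; ring
    | pred n ih =>
      rw [zpow_sub_one, Equiv.Perm.mul_apply, show b⁻¹ (0, k) = (0, k - 1) from rfl, ih]; simp; ring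
  have hcb : ∀ i j : ℤ, ((c ^ 2) ^ i * (b ^ 2) ^ j) (0, 0) = (2 * i, 2 * j - 4 * i) := fun i j => by
    rw [← zpow_natCast, ← zpow_natCast, ← zpow_mul, ← zpow_mul, Equiv.Perm.mul_apply, hb, hc]
    ext <;> push_cast <;> ring
  refine ⟨Equiv.Perm (ℤ × ℤ), inferInstance, c, b, ?_, fun n h => ?_, fun n h => ?_, fun i j n h => ?_, fun i j n h => ?_⟩
  · ext p <;> simp [c, b, pow_succ]
    ring
  · have h1 := congrArg (fun e => e (0, 0)) h
    simpa [hc] using h1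
  · have h1 := congrArg (fun e => e (0, 0)) h
    simpa [hb] using h1
  · have h1 := congrArg (fun e => e (0, 0)) h
    simp only [hcb, hc, Prod.mk.injEq] at h1
    omega
  · have h1 := congrArg (fun e => e (0, 0)) h
    simp only [hcb, hb, Prod.mk.injEq] at h1
    omega

lemma commute_sq_of_mul_eq_one {G : Type*} [Group G] {c b : G} (h : c * b ^ 3 * c * b = 1) :
    Commute (c ^ 2) (b ^ 2) := by
  have h1 : c * b * b ^ 2 * (c * b) = 1 := by
    rw [← h, pow_succ' b 2]; simp only [mul_assoc]
  have h2 : b ^ 2 = (c * b)⁻¹ * (c * b)⁻¹ := by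
    exact eq_inv_mul_of_mul_eq (eq_inv_of_mul_eq_one_left h1)
  have h3 : Commute (c * b) (b ^ 2) := by
    rw [h2]
    exact (Commute.refl _).inv_right.mul_right (Commute.refl _).inv_right
  have h4 : Commute (c * b * b⁻¹) (b ^ 2) := h3.mul_left ((Commute.refl b).pow_right 2).inv_left
  rw [mul_inv_cancel_right] at h4
  exact h4.pow_left 2

theorem exists_conjPow_sq_injective : ∃ (G : Type) (_ : Group G) (t c : G)
    (_ : c * (t * c * t⁻¹) ^ 3 * c * (t * c * t⁻¹) = 1) (h : Commute (c ^ 2) (t * c ^ 2 * t⁻¹)),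
    Function.Injective (conjPow t (c ^ 2) h) := by
  obtain ⟨G₀, _, t₀, x₀, h₀, hinj⟩ := exists_conjPow_injective
  obtain ⟨K, _, c, b, hcb, hc, hb, hci, hbi⟩ := exists_klein_bottle
  have hz : ∀ x : K, (∀ n : ℤ, x ^ n = 1 → n = 0) → Function.Injective (zpowersHom K x) := fun x hx =>
    (injective_iff_map_eq_one _).2 fun n hn => hx _ hn
  obtain ⟨φ, hφ⟩ := exists_cyclic_HNNExtension _ _ (hz c hc) (hz b hb)
  obtain ⟨φ', hφ'⟩ := exists_cyclic_HNNExtension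
    (MonoidHom.inl (Multiplicative ℤ) (Multiplicative ℤ)) (MonoidHom.inr _ _)
    (fun x y h => congrArg Prod.fst h) (fun x y h => congrArg Prod.snd h)
  have htc : t * of c * t⁻¹ = (of b : HNNExtension K _ _ φ) := by
    have h1 := t_mul_of (φ := φ) ⟨_, Multiplicative.ofAdd 1, rfl⟩
    rw [hφ] at h1
    simp only [zpowersHom_apply, toAdd_ofAdd, zpow_one] at h1
    rw [h1, mul_inv_cancel_right]
  have hrel : of c * (t * of c * t⁻¹) ^ 3 * of c * (t * of c * t⁻¹) = (1 : HNNExtension K _ _ φ) := by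
    rw [htc, ← map_pow, ← map_mul, ← map_mul, ← map_mul, hcb, map_one]
  have hsq : Commute (of c ^ 2 : HNNExtension K _ _ φ) (t * of c ^ 2 * t⁻¹) := by
    rw [← conj_pow]
    exact commute_sq_of_mul_eq_one hrel
  set e : Multiplicative ℤ × Multiplicative ℤ →* K :=
    (zpowersHom K (c ^ 2)).noncommCoprod (zpowersHom K (b ^ 2)) fun m n =>
      (commute_sq_of_mul_eq_one hcb).zpow_zpow _ _
  have he : ∀ m n, e (m, n) = (c ^ 2) ^ m.toAdd * (b ^ 2) ^ n.toAdd := fun m n => rfl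
  have hel : ∀ n, e (n, 1) = (c ^ 2) ^ n.toAdd := fun n => by rw [he, toAdd_one, zpow_zero, mul_one]
  have her : ∀ n, e (1, n) = (b ^ 2) ^ n.toAdd := fun n => by rw [he, toAdd_one, zpow_zero, one_mul]
  set F : HNNExtension (Multiplicative ℤ × Multiplicative ℤ) _ _ φ' →* HNNExtension K _ _ φ :=
    lift (of.comp e) t (by
      rintro ⟨_, n, rfl⟩
      rw [hφ']
      simp only [MonoidHom.comp_apply, MonoidHom.inl_apply, MonoidHom.inr_apply, hel, her, map_zpow,
        map_pow]
      rw [← htc, ← mul_inv_eq_iff_eq_mul, conj_pow, conj_zpow])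
  have hFof : ∀ g, F (of g) = of (e g) := fun g => lift_of _ _ _ _
  have hFt : F t = t := lift_t _ _ _
  have hF : Function.Injective F := by
    refine HNNExtension_map_injective (e := e) ?_ ?_ ?_ F hFof hFt
    · refine (injective_iff_map_eq_one e).2 ?_
      rintro ⟨m, n⟩ h
      exact Prod.ext (hbi m.toAdd n.toAdd 0 (h.trans (zpow_zero b).symm))
        (hci m.toAdd n.toAdd 0 (h.trans (zpow_zero c).symm))
    · rintro ⟨m, n⟩ ⟨k, hk⟩
      exact ⟨m, Prod.ext rfl (hci m.toAdd n.toAdd k.toAdd hk.symm).symm⟩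
    · rintro ⟨m, n⟩ ⟨k, hk⟩
      exact ⟨n, Prod.ext (hbi m.toAdd n.toAdd k.toAdd hk.symm).symm rfl⟩
  set p : Multiplicative ℤ × Multiplicative ℤ →* G₀ :=
    (zpowersHom G₀ x₀).noncommCoprod (zpowersHom G₀ (t₀ * x₀ * t₀⁻¹)) fun m n => h₀.zpow_zpow _ _
  have hp : ∀ m n, p (m, n) = x₀ ^ m.toAdd * (t₀ * x₀ * t₀⁻¹) ^ n.toAdd := fun m n => rfl
  have hpl : ∀ n, p (n, 1) = x₀ ^ n.toAdd := fun n => by rw [hp, toAdd_one, zpow_zero, mul_one]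
  have hpr : ∀ n, p (1, n) = (t₀ * x₀ * t₀⁻¹) ^ n.toAdd := fun n => by
    rw [hp, toAdd_one, zpow_zero, one_mul]
  set P : HNNExtension (Multiplicative ℤ × Multiplicative ℤ) _ _ φ' →* G₀ := lift p t₀ (by
    rintro ⟨_, n, rfl⟩
    rw [hφ']
    simp only [MonoidHom.inl_apply, MonoidHom.inr_apply, hpl, hpr]
    rw [← mul_inv_eq_iff_eq_mul, conj_zpow])
  set e₁ : Multiplicative ℤ × Multiplicative ℤ := (Multiplicative.ofAdd 1, 1)
  have he₁ : Commute (of e₁ : HNNExtension _ _ _ φ') (t * of e₁ * t⁻¹) := by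
    have h1 := t_mul_of (φ := φ') ⟨_, Multiplicative.ofAdd 1, rfl⟩
    rw [hφ'] at h1
    rw [show t * of e₁ * t⁻¹ = _ from mul_inv_eq_of_eq_mul h1]
    exact (Commute.all _ _).map of
  have hPe : P.comp (conjPow t (of e₁) he₁) = conjPow t₀ x₀ h₀ := PresentedGroup.ext fun i => by
    simp only [MonoidHom.comp_apply, conjPow_of, map_mul, map_inv, map_zpow, P, lift_t, lift_of, e₁,
      hpl, toAdd_ofAdd, zpow_one]
  have hFe : F.comp (conjPow t (of e₁) he₁) = conjPow t (of c ^ 2) hsq := PresentedGroup.ext fun i => by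
    simp only [MonoidHom.comp_apply, conjPow_of, map_mul, map_inv, map_zpow, hFt, hFof, e₁, hel,
      toAdd_ofAdd, zpow_one, map_pow]
  refine ⟨HNNExtension K _ _ φ, inferInstance, t, of c, hrel, hsq, ?_⟩
  rw [← hFe, MonoidHom.coe_comp]
  refine hF.comp (Function.Injective.of_comp (f := P) ?_)
  rw [← MonoidHom.coe_comp, hPe]
  exact hinj

end HNNExtension

/-- The right-angled Artin group of the bi-infinite path embeds in a special one-relation monoid. -/
theorem exists_intPath_monoid_embedding :
    ∃ (w : List (Fin 2)) (φ : RAAG intPath →* OneRelMonoid w []), Function.Injective φ := by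
  obtain ⟨G, _, t, c, hrel, hc, hinj⟩ := exists_conjPow_sq_injective
  set w : List (Fin 2) := [0, 1, 1, 0, 1, 0, 1, 0, 0, 1, 1, 0] with hwdef
  set x : OneRelMonoid w [] := PresentedMonoid.of _ 0
  set y : OneRelMonoid w [] := PresentedMonoid.of _ 1
  have hw : x * y * y * x * y * x * y * x * x * y * y * x = 1 := by
    have h : (PresentedMonoid.mk _ (FreeMonoid.ofList w) : OneRelMonoid w []) = 1 :=
      PresentedMonoid.mk_eq_mk_of_rel ⟨rfl, rfl⟩
    rw [← h]
    rfl
  obtain ⟨x', hx'⟩ : IsUnit x := isUnit_of_mul_eq_one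
    (y := x * y * y * x * y * x * y * x * x * y * y) (z := y * y * x * y * x * y * x * x * y * y * x)
    hw (by simpa only [mul_assoc] using hw)
  have hmid : y * y * x * y * x * y * x * x * y * y = ↑x'⁻¹ * ↑x'⁻¹ := by
    rw [Units.eq_mul_inv_iff_mul_eq]
    refine Units.eq_inv_of_mul_eq_one_left ?_
    rw [hx']
    simpa only [mul_assoc] using hw
  obtain ⟨y', hy'⟩ : IsUnit y := isUnit_of_mul_eq_one
    (y := ↑x' * ↑x' * (y * y * x * y * x * y * x * x * y))
    (z := y * x * y * x * y * x * x * y * y * (↑x' * ↑x'))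
    (by rw [mul_assoc, hmid]; simp [mul_assoc])
    (by
      have h : y * (y * x * y * x * y * x * x * y * y * (↑x' * ↑x')) =
        y * y * x * y * x * y * x * x * y * y * (↑x' * ↑x') := by simp only [mul_assoc]
      rw [h, hmid]; simp [mul_assoc])
  have hw' : x' * y' * y' * x' * y' * x' * y' * x' * x' * y' * y' * x' = 1 := by
    ext
    simpa only [Units.val_mul, hx', hy', Units.val_one] using hw
  have hrel' : x' * y' * (y' * (x' * y') * y'⁻¹) ^ 3 * (x' * y') * (y' * (x' * y') * y'⁻¹) = 1 := by
    rw [← hw', conj_pow]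
    simp only [pow_succ, pow_zero, one_mul]
    group
  have hcomm : Commute ((x' * y') ^ 2) (y' * (x' * y') ^ 2 * y'⁻¹) := by
    rw [← conj_pow]
    exact commute_sq_of_mul_eq_one hrel'
  set f : Fin 2 → G := ![c * t⁻¹, t]
  set F : OneRelMonoid w [] →* G := PresentedMonoid.lift f (by
    rintro p q ⟨hp, hq⟩
    rw [hp, hq, FreeMonoid.lift_apply, FreeMonoid.lift_apply, FreeMonoid.toList_ofList,
      FreeMonoid.toList_ofList, List.map_nil, List.prod_nil, ← hrel, conj_pow, hwdef]
    simp [f, pow_succ, mul_assoc])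
  have hFx : F x = c * t⁻¹ := PresentedMonoid.lift_of _ _
  have hFy : F y = t := PresentedMonoid.lift_of _ _
  set θ : (OneRelMonoid w [])ˣ →* G := F.comp (Units.coeHom _)
  have hθx : θ x' = c * t⁻¹ := by rw [← hFx, ← hx']; rfl
  have hθy : θ y' = t := by rw [← hFy, ← hy']; rfl
  have key : θ.comp (conjPow y' ((x' * y') ^ 2) hcomm) = conjPow t (c ^ 2) hc :=
    PresentedGroup.ext fun i => by
      simp only [MonoidHom.comp_apply, conjPow_of, map_mul, map_inv, map_zpow, map_pow, hθx, hθy,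
        inv_mul_cancel_right]
  refine ⟨w, (Units.coeHom _).comp (conjPow y' ((x' * y') ^ 2) hcomm), ?_⟩
  refine Units.val_injective.comp (Function.Injective.of_comp (f := θ) ?_)
  rw [← MonoidHom.coe_comp, key]
  exact hinj

end OneRelator

/-- For a finite simple graph `Γ`, the following are equivalent:
(i) `Γ` is a forest;
(ii) `A(Γ)` embeds into a one-relator group;
(iii) `A(Γ)` embeds into a positive one-relator group;
(iv) `A(Γ)` embeds into a one-relation monoid `Mon⟨A | u = v⟩`;
(v) `A(Γ)` embeds into a special one-relation monoid `Mon⟨A | w = 1⟩`. -/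
theorem raag_embeds_in_one_relation_monoid_tfae
    {V : Type} [Fintype V] (Γ : SimpleGraph V) :
    [ Γ.IsAcyclic,
      ∃ (k : ℕ) (r : FreeGroup (Fin k))
        (φ : RAAG Γ →* PresentedGroup ({r} : Set (FreeGroup (Fin k)))),
        Function.Injective φ,
      ∃ (k : ℕ) (w : List (Fin k))
        (φ : RAAG Γ →* PresentedGroup
          ({(w.map FreeGroup.of).prod} : Set (FreeGroup (Fin k)))),
        Function.Injective φ,
      ∃ (k : ℕ) (u v : List (Fin k)) (φ : RAAG Γ →* OneRelMonoid u v),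
        Function.Injective φ,
      ∃ (k : ℕ) (w : List (Fin k)) (φ : RAAG Γ →* OneRelMonoid w []),
        Function.Injective φ ].TFAE := by
  tfae_have 1 → 5 := fun h => by
    obtain ⟨φ, hφ⟩ := OneRelator.exists_intPath_embedding h
    obtain ⟨w, ψ, hψ⟩ := OneRelator.exists_intPath_monoid_embedding
    exact ⟨2, w, ψ.comp φ, hψ.comp hφ⟩
  tfae_have 5 → 4 := fun ⟨k, w, φ, hφ⟩ => ⟨k, w, [], φ, hφ⟩
  tfae_have 4 → 3 := fun ⟨_, _, _, φ, hφ⟩ => OneRelator.exists_embedding_positive φ hφ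
  tfae_have 3 → 2 := fun ⟨k, _, φ, hφ⟩ => ⟨k, _, φ, hφ⟩
  tfae_have 2 → 1 := fun ⟨_, r, φ, hφ⟩ => OneRelator.isAcyclic_of_embedding Γ r φ hφ
  tfae_finish
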